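/- Suppose p(x_0,…,x_{k-1},y) is a ((k,n)+ℓ)-ary polynomial over ℚ and P is a d-dimensional k-template. Then there are M < ω and, for each surjection π : {0,…,d-1} → {0,…,m-1} (m ≤ d), a first-order L_OF-formula φ_π(z,x,y) (z an m-tuple, x an n-tuple, y an ℓ-tuple of free variables) such that: whenever c ∈ ℝ^ℓ, H_c is the zero k-hypergraph of p(x_0,…,x_{k-1},c), and L(M^d,P) is embeddable into H_c, then there is a surjection π such that the set defined in ℝ by φ_π(z,x,c) is the graph of a function ℝ^m → ℝ^n that is an immersion of L(ℝ^m,P^π) into H_c. -/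

import Mathlib

open Cardinal

universe u v

/-- `f` is one-to-one in each coordinate: if `a` and `b` differ in exactly one
coordinate, then `f a ≠ f b`. -/
def OneToOneEachCoord {d : ℕ} {X C : Type*} (f : (Fin d → X) → C) : Prop :=
  ∀ a b : Fin d → X, (∃ i, a i ≠ b i ∧ ∀ j, j ≠ i → a j = b j) → f a ≠ f b

/-- `Q` is a homomorphic image of the template `P`: there is a surjection of `P`
onto `Q` preserving coordinate equalities. -/
def IsHomImage {d : ℕ} {α β : Type*} (P : Finset (Fin d → α)) (Q : Finset (Fin d → β)) : Prop :=
  ∃ f : (Fin d → α) → (Fin d → β),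
    (∀ x ∈ P, f x ∈ Q) ∧ (∀ y ∈ Q, ∃ x ∈ P, f x = y) ∧
    (∀ x ∈ P, ∀ y ∈ P, ∀ i, x i = y i → f x i = f y i)

/-- The edge set of the template hypergraph `L(X^d, P)`: the edges are the
`k`-element subsets of `X^d` that are homomorphic images of `P`. -/
def LEdges (k : ℕ) {d : ℕ} {α : Type*} (P : Finset (Fin d → α)) (X : Type*) :
    Set (Finset (Fin d → X)) :=
  {Q | Q.card = k ∧ IsHomImage P Q}

/-- Image of a finset (with classical decidable equality). -/
noncomputable def fimg {V W : Type*} (g : V → W) (e : Finset V) : Finset W :=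
  @Finset.image _ _ (Classical.decEq W) g e

/-- `g` is an embedding of the hypergraph with edge set `E₁` into the one with
edge set `E₂`: an injection on vertices mapping every edge to an edge. -/
def IsHGEmbedding {V W : Type*} (E₁ : Set (Finset V)) (E₂ : Set (Finset W)) (g : V → W) : Prop :=
  Function.Injective g ∧ ∀ e ∈ E₁, fimg g e ∈ E₂

def Embeddable {V W : Type*} (E₁ : Set (Finset V)) (E₂ : Set (Finset W)) : Prop :=
  ∃ g, IsHGEmbedding E₁ E₂ g

/-- The hypergraph with edge set `E` has a coloring with at most `κ` colors
that is not constant on any edge. -/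
def ProperlyColorable {V : Type u} (E : Set (Finset V)) (κ : Cardinal.{u}) : Prop :=
  ∃ (C : Type u) (φ : V → C), #C ≤ κ ∧ ∀ e ∈ E, ∃ x ∈ e, ∃ y ∈ e, φ x ≠ φ y

/-- The chromatic number: the least `κ` admitting a proper `κ`-coloring. -/
noncomputable def chromaticNumber {V : Type u} (E : Set (Finset V)) : Cardinal.{u} :=
  sInf {κ | ProperlyColorable E κ}

/-- The edge set of the zero `k`-hypergraph of a `(k,n)`-ary real polynomial:
the `k`-element subsets of `ℝ^n` admitting an enumeration on which `p` vanishes. -/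
def zeroEdges (k n : ℕ) (p : MvPolynomial (Fin k × Fin n) ℝ) : Set (Finset (Fin n → ℝ)) :=
  {s | ∃ a : Fin k → (Fin n → ℝ), Function.Injective a ∧
        fimg a Finset.univ = s ∧ MvPolynomial.eval (fun v => a v.1 v.2) p = 0}

/-- An immersion of `L(X^d, P)` into the `k`-hypergraph with vertices `V` and edges `E`:
a map one-to-one in each coordinate sending every edge on which it is injective
to an edge of the target. -/
def IsImmersion {d : ℕ} {α X V : Type*} (k : ℕ) (P : Finset (Fin d → α))
    (E : Set (Finset V)) (f : (Fin d → X) → V) : Prop :=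
  OneToOneEachCoord f ∧ ∀ Q ∈ LEdges k P X, Set.InjOn f ↑Q → fimg f Q ∈ E

/-- The π-collapse of a `d`-tuple: coordinate `j < m` is the restriction of `x`
to `π ⁻¹ {j}` (recorded as a partial function on `Fin d`). -/
def piCollapse {d m : ℕ} {α : Type*} (π : Fin d → Fin m) (x : Fin d → α) :
    Fin m → (Fin d → Option α) :=
  fun j i => if π i = j then some (x i) else none

/-- The π-collapse `P^π` of a template `P`. -/
noncomputable def collapseT {d m : ℕ} {α : Type*} (π : Fin d → Fin m)
    (P : Finset (Fin d → α)) : Finset (Fin m → (Fin d → Option α)) :=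
  @Finset.image _ _ (Classical.decEq _) (piCollapse π) P

/-- Terms of the first-order language of ordered fields `{+,-,×,0,1,≤}`,
with variables indexed by `ℕ`. -/
inductive OFTerm : Type
  | var : ℕ → OFTerm
  | zero : OFTerm
  | one : OFTerm
  | add : OFTerm → OFTerm → OFTerm
  | mul : OFTerm → OFTerm → OFTerm
  | neg : OFTerm → OFTerm

/-- First-order formulas of the language of ordered fields (with equality;
`≠`, `∨`, `→`, `∀`, `<` etc. are expressible from `=`, `≤`, `¬`, `∧`, `∃`). -/
inductive OFFml : Type
  | eq : OFTerm → OFTerm → OFFml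
  | le : OFTerm → OFTerm → OFFml
  | not : OFFml → OFFml
  | and : OFFml → OFFml → OFFml
  | ex : ℕ → OFFml → OFFml

def OFTerm.eval (v : ℕ → ℝ) : OFTerm → ℝ
  | var i => v i
  | zero => 0
  | one => 1
  | add s t => s.eval v + t.eval v
  | mul s t => s.eval v * t.eval v
  | neg t => - t.eval v

/-- Realization (satisfaction) of a formula in the ordered field `ℝ`
under the valuation `v`. -/
def OFFml.Realize (v : ℕ → ℝ) : OFFml → Prop
  | eq s t => s.eval v = t.eval v
  | le s t => s.eval v ≤ t.eval v
  | not φ => ¬ φ.Realize v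
  | and φ ψ => φ.Realize v ∧ ψ.Realize v
  | ex i φ => ∃ r : ℝ, φ.Realize (Function.update v i r)

def OFTerm.fv : OFTerm → Finset ℕ
  | var i => {i}
  | zero => ∅
  | one => ∅
  | add s t => s.fv ∪ t.fv
  | mul s t => s.fv ∪ t.fv
  | neg t => t.fv

/-- The free variables of a formula. -/
def OFFml.fv : OFFml → Finset ℕ
  | eq s t => s.fv ∪ t.fv
  | le s t => s.fv ∪ t.fv
  | not φ => φ.fv
  | and φ ψ => φ.fv ∪ ψ.fv
  | ex i φ => φ.fv.erase i

/-- The edge set of the zero `k`-hypergraph `H_c` of `p(x₀,…,x_{k-1}, c)`, where `p`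
is a `((k,n)+ℓ)`-ary polynomial over `ℚ` and `c ∈ ℝ^ℓ`. -/
def zeroEdgesParam (k n ℓ : ℕ) (p : MvPolynomial ((Fin k × Fin n) ⊕ Fin ℓ) ℚ)
    (c : Fin ℓ → ℝ) : Set (Finset (Fin n → ℝ)) :=
  {s | ∃ a : Fin k → (Fin n → ℝ), Function.Injective a ∧ fimg a Finset.univ = s ∧
        MvPolynomial.aeval (Sum.elim (fun v : Fin k × Fin n => a v.1 v.2) c) p = (0 : ℝ)}

/-- The valuation assigning variables `0,…,m-1` to `z`, `m,…,m+n-1` to `x`,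
`m+n,…,m+n+ℓ-1` to `y`, and `0` to all other variables. -/
noncomputable def valu (m n ℓ : ℕ) (z : Fin m → ℝ) (x : Fin n → ℝ) (y : Fin ℓ → ℝ) :
    ℕ → ℝ := fun i =>
  if h : i < m then z ⟨i, h⟩
  else if h' : i - m < n then x ⟨i - m, h'⟩
  else if h'' : i - m - n < ℓ then y ⟨i - m - n, h''⟩
  else 0

/-! ### Definability over the real field -/

/-- A set of real tuples is definable if it is defined by a formula, for every assignment of
variables to its coordinates. -/
def Dfn {ι : Type*} (S : (ι → ℝ) → Prop) : Prop :=
  ∀ e : ι → ℕ, ∃ φ : OFFml, (∀ i ∈ φ.fv, i ∈ Set.range e) ∧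
    ∀ v : ℕ → ℝ, φ.Realize v ↔ S (fun i => v (e i))

/-- A real function is definable if its graph is. -/
def DFun {ι : Type*} (f : (ι → ℝ) → ℝ) : Prop :=
  Dfn (fun w : Option ι → ℝ => f (fun i => w (some i)) = w none)

namespace Dfn

variable {ι κ : Type*}

theorem congr {S T : (ι → ℝ) → Prop} (h : Dfn S) (hST : ∀ v, T v ↔ S v) : Dfn T := by
  have : T = S := funext fun v => propext (hST v)
  rwa [this]

theorem reindex {S : (ι → ℝ) → Prop} (h : Dfn S) (g : ι → κ) :
    Dfn (fun w : κ → ℝ => S (fun i => w (g i))) := by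
  intro e
  obtain ⟨φ, h1, h2⟩ := h (e ∘ g)
  refine ⟨φ, fun i hi => ?_, h2⟩
  obtain ⟨j, rfl⟩ := h1 i hi
  exact ⟨g j, rfl⟩

theorem not {S : (ι → ℝ) → Prop} (h : Dfn S) : Dfn (fun v => ¬ S v) := by
  intro e
  obtain ⟨φ, h1, h2⟩ := h e
  exact ⟨.not φ, h1, fun v => not_congr (h2 v)⟩

theorem and {S T : (ι → ℝ) → Prop} (h : Dfn S) (h' : Dfn T) : Dfn (fun v => S v ∧ T v) := by
  intro e
  obtain ⟨φ, h1, h2⟩ := h e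
  obtain ⟨ψ, h3, h4⟩ := h' e
  refine ⟨.and φ ψ, fun i hi => ?_, fun v => and_congr (h2 v) (h4 v)⟩
  rcases Finset.mem_union.1 hi with hi | hi
  exacts [h1 i hi, h3 i hi]

theorem or {S T : (ι → ℝ) → Prop} (h : Dfn S) (h' : Dfn T) : Dfn (fun v => S v ∨ T v) :=
  (h.not.and h'.not).not.congr fun v => by tauto

theorem imp {S T : (ι → ℝ) → Prop} (h : Dfn S) (h' : Dfn T) : Dfn (fun v => S v → T v) :=
  (h.and h'.not).not.congr fun v => by tauto

theorem const (p : Prop) : Dfn (fun _ : ι → ℝ => p) := by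
  intro e
  by_cases hp : p
  · exact ⟨.eq .zero .zero, by simp [OFFml.fv, OFTerm.fv], fun v => by
      simp [OFFml.Realize, hp]⟩
  · exact ⟨.not (.eq .zero .zero), by simp [OFFml.fv, OFTerm.fv], fun v => by
      simp [OFFml.Realize, hp]⟩

theorem ex_option [Finite ι] {S : (Option ι → ℝ) → Prop} (h : Dfn S) :
    Dfn (fun v : ι → ℝ => ∃ r : ℝ, S (fun o => o.elim r v)) := by
  intro e
  obtain ⟨N, hN⟩ := (Set.finite_range e).exists_notMem
  obtain ⟨φ, h1, h2⟩ := h (fun o => o.elim N e)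
  refine ⟨.ex N φ, fun i hi => ?_, fun v => exists_congr fun r => ?_⟩
  · obtain ⟨hi1, hi2⟩ := Finset.mem_erase.1 hi
    obtain ⟨o, ho⟩ := h1 i hi2
    cases o with
    | none => exact absurd ho.symm hi1
    | some j => exact ⟨j, ho⟩
  · rw [h2]
    refine iff_of_eq (congrArg S (funext fun o => ?_))
    cases o with
    | none => simp
    | some j =>
      have : e j ≠ N := fun h => hN ⟨j, h⟩
      simp [Function.update_of_ne this]

theorem ex_fun [Finite ι] [Finite κ] {S : (ι → ℝ) → (κ → ℝ) → Prop}
    (h : Dfn (fun w : ι ⊕ κ → ℝ => S (fun i => w (.inl i)) (fun j => w (.inr j)))) :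
    Dfn (fun v : ι → ℝ => ∃ y : κ → ℝ, S v y) := by
  suffices H : ∀ S : (ι → ℝ) → (κ → ℝ) → Prop,
      Dfn (fun w : ι ⊕ κ → ℝ => S (fun i => w (.inl i)) (fun j => w (.inr j))) →
      Dfn (fun v : ι → ℝ => ∃ y : κ → ℝ, S v y) from H S h
  refine Finite.induction_empty_option (P := fun κ : Type _ => ∀ S : (ι → ℝ) → (κ → ℝ) → Prop,
    Dfn (fun w : ι ⊕ κ → ℝ => S (fun i => w (.inl i)) (fun j => w (.inr j))) →
    Dfn (fun v : ι → ℝ => ∃ y : κ → ℝ, S v y)) ?_ ?_ ?_ κ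
  · intro α β e ih S hS
    refine (ih (fun v y => S v (y ∘ e.symm)) ?_).congr fun v => ?_
    · exact (hS.reindex (Sum.map id e.symm))
    · constructor
      · rintro ⟨y, hy⟩
        exact ⟨y ∘ e, by simpa [Function.comp_assoc] using hy⟩
      · rintro ⟨y, hy⟩
        exact ⟨_, hy⟩
  · intro S hS
    refine (hS.reindex (fun i : ι ⊕ PEmpty => i.elim id PEmpty.elim)).congr fun v => ?_
    constructor
    · rintro ⟨y, hy⟩
      have : (fun j : PEmpty => v (PEmpty.elim j)) = y := funext fun a => a.elim
      subst this
      exact hy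
    · intro h
      exact ⟨_, h⟩
  · intro α _ ih S hS
    refine (ih (fun v y => ∃ r, S v (fun o => o.elim r y)) ?_).congr fun v => ?_
    · have := (hS.reindex (fun i : ι ⊕ Option α =>
        i.elim (fun i => some (Sum.inl i)) (fun o => o.elim none fun j => some (.inr j))))
      refine this.ex_option.congr fun w => exists_congr fun r => ?_
      refine iff_of_eq (congrArg _ (funext fun o => ?_))
      cases o <;> rfl
    · constructor
      · rintro ⟨y, hy⟩
        refine ⟨fun a => y (some a), y none, ?_⟩
        convert hy with o
        cases o <;> rfl
      · rintro ⟨y, r, hy⟩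
        exact ⟨_, hy⟩

theorem all_fun [Finite ι] [Finite κ] {S : (ι → ℝ) → (κ → ℝ) → Prop}
    (h : Dfn (fun w : ι ⊕ κ → ℝ => S (fun i => w (.inl i)) (fun j => w (.inr j)))) :
    Dfn (fun v : ι → ℝ => ∀ y : κ → ℝ, S v y) :=
  (ex_fun (S := fun v y => ¬ S v y) h.not).not.congr fun v => by push Not; rfl

theorem ex [Finite ι] {S : (ι → ℝ) → ℝ → Prop}
    (h : Dfn (fun w : Option ι → ℝ => S (fun i => w (some i)) (w none))) :
    Dfn (fun v : ι → ℝ => ∃ y : ℝ, S v y) := h.ex_option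

theorem all [Finite ι] {S : (ι → ℝ) → ℝ → Prop}
    (h : Dfn (fun w : Option ι → ℝ => S (fun i => w (some i)) (w none))) :
    Dfn (fun v : ι → ℝ => ∀ y : ℝ, S v y) :=
  (ex (S := fun v y => ¬ S v y) h.not).not.congr fun v => by push Not; rfl

theorem forall_finset {A : Type*} (s : Finset A) {S : A → (ι → ℝ) → Prop} (h : ∀ a, Dfn (S a)) :
    Dfn (fun v => ∀ a ∈ s, S a v) := by
  classical
  induction s using Finset.induction_on with
  | empty => exact (const True).congr fun v => by simp
  | insert a s _ ih => exact ((h a).and ih).congr fun v => by simp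

theorem forall_finite {A : Type*} [Finite A] {S : A → (ι → ℝ) → Prop} (h : ∀ a, Dfn (S a)) :
    Dfn (fun v => ∀ a, S a v) := by
  have := Fintype.ofFinite A
  exact (forall_finset Finset.univ h).congr fun v => by simp

theorem subst [Finite ι] [Finite κ] {S : (κ → ℝ) → Prop} (h : Dfn S)
    {T : (ι → ℝ) → κ → ℝ} (hT : ∀ j, DFun (fun v => T v j)) : Dfn (fun v => S (T v)) := by
  refine (ex_fun (S := fun v y => (∀ j, T v j = y j) ∧ S y) ?_).congr fun v => ?_
  · refine Dfn.and (forall_finite fun j => ?_) (h.reindex Sum.inr)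
    exact (hT j).reindex (fun o => o.elim (Sum.inr j) Sum.inl)
  · constructor
    · exact fun h => ⟨_, fun j => rfl, h⟩
    · rintro ⟨y, hy, h⟩
      rwa [show T v = y from funext hy]

theorem eq_var (i j : ι) : Dfn (fun v => v i = v j) := fun e =>
  ⟨.eq (.var (e i)) (.var (e j)), by simp [OFFml.fv, OFTerm.fv], fun _ => Iff.rfl⟩

theorem le_var (i j : ι) : Dfn (fun v => v i ≤ v j) := fun e =>
  ⟨.le (.var (e i)) (.var (e j)), by simp [OFFml.fv, OFTerm.fv], fun _ => Iff.rfl⟩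

end Dfn

namespace DFun

variable {ι κ : Type*}

theorem var (i : ι) : DFun (fun v => v i) := Dfn.eq_var (some i) none

theorem congr {f g : (ι → ℝ) → ℝ} (h : DFun f) (hg : ∀ v, g v = f v) : DFun g := by
  rwa [show g = f from funext hg]

theorem comp [Finite ι] [Finite κ] {f : (κ → ℝ) → ℝ} (h : DFun f)
    {T : (ι → ℝ) → κ → ℝ} (hT : ∀ j, DFun (fun v => T v j)) : DFun (fun v => f (T v)) := by
  refine Dfn.subst (T := fun w o => Option.elim o (w none) (T fun i => w (some i))) h fun o => ?_
  cases o with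
  | none => exact var none
  | some j => exact (hT j).reindex (fun o => o.elim none fun i => some (some i))

theorem reindex {f : (ι → ℝ) → ℝ} (h : DFun f) (g : ι → κ) :
    DFun (fun w : κ → ℝ => f (fun i => w (g i))) :=
  Dfn.reindex h (Option.map g)

theorem zero : DFun (fun _ : ι → ℝ => 0) := fun e =>
  ⟨.eq .zero (.var (e none)), by simp [OFFml.fv, OFTerm.fv], fun _ => Iff.rfl⟩

theorem one : DFun (fun _ : ι → ℝ => 1) := fun e =>
  ⟨.eq .one (.var (e none)), by simp [OFFml.fv, OFTerm.fv], fun _ => Iff.rfl⟩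

variable [Finite ι]

theorem neg {f : (ι → ℝ) → ℝ} (hf : DFun f) : DFun (fun v => - f v) := by
  have h : DFun (fun w : Unit → ℝ => - w ()) := fun e =>
    ⟨.eq (.neg (.var (e (some ())))) (.var (e none)), by simp [OFFml.fv, OFTerm.fv],
      fun _ => Iff.rfl⟩
  exact h.comp (T := fun v _ => f v) fun _ => hf

theorem add {f g : (ι → ℝ) → ℝ} (hf : DFun f) (hg : DFun g) : DFun (fun v => f v + g v) := by
  have h : DFun (fun w : Bool → ℝ => w true + w false) := fun e =>
    ⟨.eq (.add (.var (e (some true))) (.var (e (some false)))) (.var (e none)),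
      by simp [OFFml.fv, OFTerm.fv], fun _ => Iff.rfl⟩
  exact h.comp (T := fun v b => cond b (f v) (g v)) fun b => by cases b <;> assumption

theorem mul {f g : (ι → ℝ) → ℝ} (hf : DFun f) (hg : DFun g) : DFun (fun v => f v * g v) := by
  have h : DFun (fun w : Bool → ℝ => w true * w false) := fun e =>
    ⟨.eq (.mul (.var (e (some true))) (.var (e (some false)))) (.var (e none)),
      by simp [OFFml.fv, OFTerm.fv], fun _ => Iff.rfl⟩
  exact h.comp (T := fun v b => cond b (f v) (g v)) fun b => by cases b <;> assumption

theorem sub {f g : (ι → ℝ) → ℝ} (hf : DFun f) (hg : DFun g) : DFun (fun v => f v - g v) :=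
  (hf.add hg.neg).congr fun _ => sub_eq_add_neg _ _

theorem eq {f g : (ι → ℝ) → ℝ} (hf : DFun f) (hg : DFun g) : Dfn (fun v => f v = g v) :=
  (Dfn.eq_var true false).subst (T := fun v b => cond b (f v) (g v))
    fun b => by cases b <;> assumption

theorem le {f g : (ι → ℝ) → ℝ} (hf : DFun f) (hg : DFun g) : Dfn (fun v => f v ≤ g v) :=
  (Dfn.le_var true false).subst (T := fun v b => cond b (f v) (g v))
    fun b => by cases b <;> assumption

theorem lt {f g : (ι → ℝ) → ℝ} (hf : DFun f) (hg : DFun g) : Dfn (fun v => f v < g v) :=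
  (hg.le hf).not.congr fun _ => not_le.symm

theorem sum {A : Type*} (s : Finset A) {f : A → (ι → ℝ) → ℝ} (h : ∀ a, DFun (f a)) :
    DFun (fun v => ∑ a ∈ s, f a v) := by
  classical
  induction s using Finset.induction_on with
  | empty => exact zero.congr fun v => by simp
  | insert a s ha ih => exact ((h a).add ih).congr fun v => by simp [ha]

theorem natCast (n : ℕ) : DFun (fun _ : ι → ℝ => (n : ℝ)) := by
  induction n with
  | zero => exact zero.congr fun _ => by simp
  | succ n ih => exact (ih.add one).congr fun _ => by simp

theorem inv {f : (ι → ℝ) → ℝ} (hf : DFun f) : DFun (fun v => (f v)⁻¹) := by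
  have h : DFun (fun w : Unit → ℝ => (w ())⁻¹) := by
    refine Dfn.congr (S := fun w : Option Unit → ℝ =>
      (w none * w (some ()) = 1) ∨ (w (some ()) = 0 ∧ w none = 0)) ?_ fun w => ?_
    · exact (((var none).mul (var _)).eq one).or (((var _).eq zero).and ((var _).eq zero))
    · by_cases h : w (some ()) = 0
      · simp [h, eq_comm]
      · simp only [h, false_and, or_false]
        exact eq_comm.trans (mul_eq_one_iff_eq_inv₀ h).symm
  exact h.comp (T := fun v _ => f v) fun _ => hf

theorem abs {f : (ι → ℝ) → ℝ} (hf : DFun f) : DFun (fun v => |f v|) := by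
  have h : DFun (fun w : Unit → ℝ => |w ()|) := by
    refine Dfn.congr (S := fun w : Option Unit → ℝ =>
      (0 ≤ w (some ()) ∧ w (some ()) = w none) ∨
        (w (some ()) < 0 ∧ - w (some ()) = w none)) ?_ fun w => ?_
    · exact ((zero.le (var _)).and ((var _).eq (var _))).or
        (((var _).lt zero).and ((var _).neg.eq (var _)))
    · rcases le_or_gt 0 (w (some ())) with h | h
      · simp [abs_of_nonneg h, h, h.not_gt]
      · simp [abs_of_neg h, h, h.not_ge]
  exact h.comp (T := fun v _ => f v) fun _ => hf

theorem ratCast (q : ℚ) : DFun (fun _ : ι → ℝ => (q : ℝ)) := by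
  have h : DFun (fun _ : ι → ℝ => (q.num : ℝ)) := by
    obtain ⟨n, h | h⟩ := q.num.eq_nat_or_neg
    · exact (natCast n).congr fun _ => by simp [h]
    · exact (natCast n).neg.congr fun _ => by simp [h]
  exact (h.mul (natCast q.den).inv).congr fun _ => by
    rw [← div_eq_mul_inv]; exact Rat.cast_def q

theorem aeval {σ : Type*} (q : MvPolynomial σ ℚ) {T : (ι → ℝ) → σ → ℝ}
    (hT : ∀ j, DFun (fun v => T v j)) : DFun (fun v => MvPolynomial.aeval (T v) q) := by
  induction q using MvPolynomial.induction_on with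
  | C a => exact (ratCast a).congr fun v => by simp
  | add p q hp hq => exact (hp.add hq).congr fun v => by simp
  | mul_X p j hp => exact (hp.mul (hT j)).congr fun v => by simp

end DFun

/-! ### Definable choice for closed sets -/

section Choice

theorem isClosed_minimizers {κ : Type*} {X : (κ → ℝ) → Prop} {h : (κ → ℝ) → ℝ} (hh : Continuous h)
    (hX : IsClosed {θ | X θ}) : IsClosed {θ | X θ ∧ ∀ θ', X θ' → h θ ≤ h θ'} := by
  simp only [Set.ofPred_and, Set.ofPred_forall]
  exact hX.inter (isClosed_iInter fun θ' => isClosed_iInter fun _ =>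
    isClosed_le hh continuous_const)

variable {ι κ : Type*} [Finite ι] [Finite κ]

theorem Dfn.minimizers {X : (ι → ℝ) → (κ → ℝ) → Prop}
    (hX : Dfn (fun w : ι ⊕ κ → ℝ => X (fun i => w (.inl i)) (fun j => w (.inr j))))
    {h : (κ → ℝ) → ℝ} (hh : DFun h) :
    Dfn (fun w : ι ⊕ κ → ℝ => X (fun i => w (.inl i)) (fun j => w (.inr j)) ∧
      ∀ θ, X (fun i => w (.inl i)) θ → h (fun j => w (.inr j)) ≤ h θ) := by
  refine hX.and (Dfn.all_fun (S := fun (w : ι ⊕ κ → ℝ) θ => X (fun i => w (.inl i)) θ →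
    h (fun j => w (.inr j)) ≤ h θ) (Dfn.imp ?_ ?_))
  · exact hX.reindex (κ := (ι ⊕ κ) ⊕ κ) (Sum.map Sum.inl id)
  · exact (hh.reindex (κ := (ι ⊕ κ) ⊕ κ) fun j => Sum.inl (Sum.inr j)).le (hh.reindex Sum.inr)

theorem exists_dfn_compact {X : (ι → ℝ) → (κ → ℝ) → Prop}
    (hX : Dfn (fun w : ι ⊕ κ → ℝ => X (fun i => w (.inl i)) (fun j => w (.inr j))))
    (hcl : ∀ v, IsClosed {θ | X v θ}) :
    ∃ Y : (ι → ℝ) → (κ → ℝ) → Prop,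
      Dfn (fun w : ι ⊕ κ → ℝ => Y (fun i => w (.inl i)) (fun j => w (.inr j))) ∧
      (∀ v θ, Y v θ → X v θ) ∧ (∀ v, (∃ θ, X v θ) → ∃ θ, Y v θ) ∧
      ∀ v, IsCompact {θ | Y v θ} := by
  have := Fintype.ofFinite κ
  let h : (κ → ℝ) → ℝ := fun θ => ∑ j, θ j * θ j
  have hh : DFun h := DFun.sum _ fun j => (DFun.var j).mul (DFun.var j)
  have hcont : Continuous h := by fun_prop
  have hbdd : ∀ r : ℝ, IsCompact {θ | h θ ≤ r} := fun r => by
    refine Metric.isCompact_of_isClosed_isBounded (isClosed_le hcont continuous_const) ?_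
    refine (Metric.isBounded_closedBall (x := (0 : κ → ℝ)) (r := |r| + 1)).subset fun θ hθ => ?_
    rw [mem_closedBall_zero_iff, pi_norm_le_iff_of_nonneg (by positivity)]
    intro j
    have h1 : θ j * θ j ≤ h θ :=
      Finset.single_le_sum (f := fun j => θ j * θ j) (fun i _ => mul_self_nonneg _)
        (Finset.mem_univ j)
    rw [Real.norm_eq_abs]
    have h2 : |θ j| * |θ j| ≤ |r| := by
      rw [abs_mul_abs_self]; exact (h1.trans hθ).trans (le_abs_self r)
    nlinarith [abs_nonneg (θ j), abs_nonneg r]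
  refine ⟨fun v θ => X v θ ∧ ∀ θ', X v θ' → h θ ≤ h θ', hX.minimizers hh, fun v θ h => h.1, fun v ⟨θ₀, hθ₀⟩ => ?_, fun v => ?_⟩
  · obtain ⟨θ, hθ, hmin⟩ := ((hbdd (h θ₀)).inter_left (hcl v)).exists_isMinOn
      ⟨θ₀, hθ₀, le_refl (h θ₀)⟩ hcont.continuousOn
    refine ⟨θ, hθ.1, fun θ' hθ' => ?_⟩
    rcases le_total (h θ') (h θ₀) with h1 | h1
    · exact hmin ⟨hθ', h1⟩
    · exact (show h θ ≤ h θ₀ from hθ.2).trans h1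
  · rcases Set.eq_empty_or_nonempty {θ | X v θ ∧ ∀ θ', X v θ' → h θ ≤ h θ'} with he | ⟨θ₀, hθ₀⟩
    · rw [he]; exact isCompact_empty
    · exact (hbdd (h θ₀)).of_isClosed_subset (isClosed_minimizers hcont (hcl v))
        fun θ hθ => hθ.2 _ hθ₀.1

theorem exists_dfn_choice {X : (ι → ℝ) → (κ → ℝ) → Prop}
    (hX : Dfn (fun w : ι ⊕ κ → ℝ => X (fun i => w (.inl i)) (fun j => w (.inr j))))
    (hcl : ∀ v, IsClosed {θ | X v θ}) :
    ∃ Y : (ι → ℝ) → (κ → ℝ) → Prop,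
      Dfn (fun w : ι ⊕ κ → ℝ => Y (fun i => w (.inl i)) (fun j => w (.inr j))) ∧
      (∀ v θ, Y v θ → X v θ) ∧ (∀ v, (∃ θ, X v θ) → ∃ θ, Y v θ) ∧
      ∀ v θ θ', Y v θ → Y v θ' → θ = θ' := by
  classical
  have := Fintype.ofFinite κ
  suffices H : ∀ s : Finset κ, ∃ Y : (ι → ℝ) → (κ → ℝ) → Prop,
      Dfn (fun w : ι ⊕ κ → ℝ => Y (fun i => w (.inl i)) (fun j => w (.inr j))) ∧
      (∀ v θ, Y v θ → X v θ) ∧ (∀ v, (∃ θ, X v θ) → ∃ θ, Y v θ) ∧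
      (∀ v, IsCompact {θ | Y v θ}) ∧ ∀ v θ θ', Y v θ → Y v θ' → ∀ j ∈ s, θ j = θ' j by
    obtain ⟨Y, h1, h2, h3, -, h5⟩ := H Finset.univ
    exact ⟨Y, h1, h2, h3, fun v θ θ' h h' => funext fun j => h5 v θ θ' h h' j (Finset.mem_univ j)⟩
  intro s
  induction s using Finset.induction_on with
  | empty =>
    obtain ⟨Y, h1, h2, h3, h4⟩ := exists_dfn_compact hX hcl
    exact ⟨Y, h1, h2, h3, h4, fun _ _ _ _ _ j hj => absurd hj (Finset.notMem_empty j)⟩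
  | insert a s _ ih =>
    obtain ⟨Y, h1, h2, h3, h4, h5⟩ := ih
    have hc : Continuous fun θ : κ → ℝ => θ a := continuous_apply a
    refine ⟨fun v θ => Y v θ ∧ ∀ θ', Y v θ' → θ a ≤ θ' a, h1.minimizers (DFun.var a), fun v θ h => h2 v θ h.1, fun v hv => ?_, fun v => ?_,
      fun v θ θ' h h' j hj => ?_⟩
    · obtain ⟨θ, hθ, hmin⟩ := (h4 v).exists_isMinOn (h3 v hv) hc.continuousOn
      exact ⟨θ, hθ, fun θ' hθ' => hmin hθ'⟩
    · exact (h4 v).of_isClosed_subset (isClosed_minimizers hc (h4 v).isClosed) fun θ hθ => hθ.1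
    · rcases Finset.mem_insert.1 hj with rfl | hj
      · exact le_antisymm (h.2 _ h'.1) (h'.2 _ h.1)
      · exact h5 v θ θ' h.1 h'.1 j hj

theorem exists_dfn_radius {Y : (ι → ℝ) → ℝ → Prop}
    (hY : Dfn (fun w : Option ι → ℝ => Y (fun i => w (some i)) (w none)))
    (hpos : ∀ v ε, Y v ε → 0 < ε) (hdown : ∀ v ε ε', Y v ε → 0 < ε' → ε' ≤ ε → Y v ε') :
    ∃ Z : (ι → ℝ) → ℝ → Prop,
      Dfn (fun w : Option ι → ℝ => Z (fun i => w (some i)) (w none)) ∧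
      (∀ v ε, Z v ε → Y v ε) ∧ (∀ v, (∃ ε, Y v ε) → ∃ ε, Z v ε) ∧
      ∀ v ε ε', Z v ε → Z v ε' → ε = ε' := by
  refine ⟨fun v ε => Y v ε ∧ (∀ ε', Y v ε' → ε' ≤ 1 → ε' ≤ ε + ε) ∧
    ∀ b, (∀ ε', Y v ε' → ε' ≤ 1 → ε' ≤ b) → ε + ε ≤ b, ?_, fun v ε h => h.1, ?_, ?_⟩
  · refine hY.and (Dfn.and ?_ ?_)
    · refine Dfn.all (S := fun (w : Option ι → ℝ) ε' => Y (fun i => w (some i)) ε' → ε' ≤ 1 →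
        ε' ≤ w none + w none) ?_
      exact (hY.reindex (Option.map some)).imp (((DFun.var _).le DFun.one).imp
        ((DFun.var _).le ((DFun.var _).add (DFun.var _))))
    · refine Dfn.all (S := fun (w : Option ι → ℝ) b =>
        (∀ ε', Y (fun i => w (some i)) ε' → ε' ≤ 1 → ε' ≤ b) → w none + w none ≤ b)
        (Dfn.imp ?_ (((DFun.var _).add (DFun.var _)).le (DFun.var _)))
      refine Dfn.all (S := fun (w : Option (Option ι) → ℝ) ε' =>
        Y (fun i => w (some (some i))) ε' → ε' ≤ 1 → ε' ≤ w none) ?_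
      exact (hY.reindex (Option.map (some ∘ some))).imp (((DFun.var _).le DFun.one).imp
        ((DFun.var _).le (DFun.var _)))
  · rintro v ⟨ε, hε⟩
    have hε0 := hpos v ε hε
    have hne : {r | Y v r ∧ r ≤ 1}.Nonempty :=
      ⟨min ε 1, hdown v ε _ hε (lt_min hε0 one_pos) (min_le_left _ _), min_le_right _ _⟩
    obtain ⟨s, hs⟩ := Real.exists_isLUB hne ⟨1, fun r hr => hr.2⟩
    obtain ⟨r, hr⟩ := hne
    have hs0 : 0 < s := (hpos v r hr.1).trans_le (hs.1 hr)
    obtain ⟨r', hr', h1, -⟩ := hs.exists_between (half_lt_self hs0)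
    refine ⟨s / 2, hdown v r' _ hr'.1 (half_pos hs0) h1.le, fun ε' h h' => ?_, fun b hb => ?_⟩
    · rw [add_halves]; exact hs.1 ⟨h, h'⟩
    · rw [add_halves]; exact hs.2 fun x hx => hb x hx.1 hx.2
  · rintro v ε ε' ⟨-, h1, h2⟩ ⟨-, h3, h4⟩
    linarith [h2 _ h3, h4 _ h1]

theorem exists_dfn_uniform {η : Type*} [Finite η] {X : (ι → ℝ) → (κ → ℝ) → Prop}
    (hX : Dfn (fun w : ι ⊕ κ → ℝ => X (fun i => w (.inl i)) (fun j => w (.inr j))))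
    (hcl : ∀ v, IsClosed {θ | X v θ})
    {G : (ι → ℝ) → (κ → ℝ) → ℝ → Prop}
    (hG : Dfn (fun w : Option (ι ⊕ κ) → ℝ =>
      G (fun i => w (some (.inl i))) (fun j => w (some (.inr j))) (w none)))
    (hpos : ∀ v θ ε, G v θ ε → 0 < ε)
    (hdown : ∀ v θ ε ε', G v θ ε → 0 < ε' → ε' ≤ ε → G v θ ε')
    (hex : ∀ v θ, X v θ → ∃ ε, G v θ ε)
    {R : (ι → ℝ) → (κ → ℝ) → ℝ → (η → ℝ) → Prop}
    (hR : Dfn (fun w : Option (ι ⊕ κ) ⊕ η → ℝ =>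
      R (fun i => w (.inl (some (.inl i)))) (fun j => w (.inl (some (.inr j)))) (w (.inl none))
        (fun j => w (.inr j)))) :
    ∃ φ : (ι → ℝ) → (η → ℝ) → Prop,
      Dfn (fun w : ι ⊕ η → ℝ => φ (fun i => w (.inl i)) (fun j => w (.inr j))) ∧
      ∀ v, (∃ θ, X v θ) → ∃ θ ε, G v θ ε ∧ ∀ z, φ v z ↔ R v θ ε z := by
  obtain ⟨X', h1, h2, h3, h4⟩ := exists_dfn_choice hX hcl
  obtain ⟨Z, g1, g2, g3, g4⟩ := exists_dfn_radius
    (Y := fun w : ι ⊕ κ → ℝ => G (fun i => w (.inl i)) (fun j => w (.inr j))) hG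
    (fun v ε => hpos _ _ ε) (fun v ε ε' => hdown _ _ ε ε')
  refine ⟨fun v z => ∃ θ ε, X' v θ ∧ Z (Sum.elim v θ) ε ∧ R v θ ε z, ?_, fun v hv => ?_⟩
  · refine Dfn.ex_fun (S := fun (w : ι ⊕ η → ℝ) θ => ∃ ε, X' (fun i => w (.inl i)) θ ∧
      Z (Sum.elim (fun i => w (.inl i)) θ) ε ∧ R (fun i => w (.inl i)) θ ε
        (fun j => w (.inr j))) ?_
    refine Dfn.ex (S := fun (w : (ι ⊕ η) ⊕ κ → ℝ) ε =>
      X' (fun i => w (.inl (.inl i))) (fun j => w (.inr j)) ∧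
      Z (Sum.elim (fun i => w (.inl (.inl i))) (fun j => w (.inr j))) ε ∧
      R (fun i => w (.inl (.inl i))) (fun j => w (.inr j)) ε (fun j => w (.inl (.inr j)))) ?_
    refine Dfn.and ?_ (Dfn.and ?_ ?_)
    · exact h1.reindex (κ := Option ((ι ⊕ η) ⊕ κ)) (fun s => some (Sum.map Sum.inl id s))
    · refine (g1.reindex (κ := Option ((ι ⊕ η) ⊕ κ))
        (Option.map (Sum.map Sum.inl id))).congr fun w => ?_
      refine iff_of_eq (congrArg (fun u => Z u _) (funext fun s => ?_))
      cases s <;> rfl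
    · exact hR.reindex (κ := Option ((ι ⊕ η) ⊕ κ)) (fun s => s.elim (Option.map (Sum.map Sum.inl id))
        fun j => some (Sum.inl (Sum.inr j)))
  · obtain ⟨θ, hθ⟩ := h3 v hv
    obtain ⟨ε, hε⟩ := g3 (Sum.elim v θ) (hex v θ (h2 v θ hθ))
    refine ⟨θ, ε, g2 _ _ hε, fun z => ⟨?_, fun h => ⟨θ, ε, hθ, hε, h⟩⟩⟩
    rintro ⟨θ', ε', h, h', h''⟩
    obtain rfl := h4 v _ _ hθ h
    obtain rfl := g4 _ _ _ hε h'
    exact h''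

end Choice

/-! ### Sound pairs -/

/-- `φ` uniformly defines an immersion for the parameters in the definable set `γ`. -/
def Sound {α : Type v} (k n ℓ d : ℕ) (p : MvPolynomial ((Fin k × Fin n) ⊕ Fin ℓ) ℚ)
    (P : Finset (Fin d → α)) (γ : (Fin ℓ → ℝ) → Prop)
    (φ : (Fin ℓ → ℝ) → (Fin d ⊕ Fin n → ℝ) → Prop) : Prop :=
  Dfn γ ∧ Dfn (fun w : Fin ℓ ⊕ (Fin d ⊕ Fin n) → ℝ =>
    φ (fun i => w (.inl i)) (fun j => w (.inr j))) ∧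
  ∀ c, γ c → ∃ f : (Fin d → ℝ) → (Fin n → ℝ), (∀ z x, φ c (Sum.elim z x) ↔ f z = x) ∧
    IsImmersion k (collapseT id P) (zeroEdgesParam k n ℓ p c) f

/-- The definable sets of parameters for which an immersion is uniformly definable. -/
def SoundSet {α : Type v} (k n ℓ d : ℕ) (p : MvPolynomial ((Fin k × Fin n) ⊕ Fin ℓ) ℚ)
    (P : Finset (Fin d → α)) : Type :=
  {γ : (Fin ℓ → ℝ) → Prop // ∃ φ, Sound k n ℓ d p P γ φ}

section

variable {α : Type v} {k n ℓ d : ℕ} {p : MvPolynomial ((Fin k × Fin n) ⊕ Fin ℓ) ℚ}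
  {P : Finset (Fin d → α)}

theorem Sound.or {γ γ' : (Fin ℓ → ℝ) → Prop}
    {φ φ' : (Fin ℓ → ℝ) → (Fin d ⊕ Fin n → ℝ) → Prop} (h : Sound k n ℓ d p P γ φ)
    (h' : Sound k n ℓ d p P γ' φ') :
    Sound k n ℓ d p P (fun c => γ c ∨ γ' c)
      (fun c w => (γ c ∧ φ c w) ∨ (¬ γ c ∧ φ' c w)) := by
  refine ⟨h.1.or h'.1, ?_, fun c hc => ?_⟩
  · exact ((h.1.reindex Sum.inl).and h.2.1).or ((h.1.reindex Sum.inl).not.and h'.2.1)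
  · by_cases hγ : γ c
    · simpa only [hγ, true_and, not_true_eq_false, false_and, or_false] using h.2.2 c hγ
    · simpa only [hγ, false_and, not_false_eq_true, true_and, false_or] using
        h'.2.2 c (hc.resolve_left hγ)

instance : PartialOrder (SoundSet k n ℓ d p P) :=
  PartialOrder.lift (fun γ => γ.1) Subtype.val_injective

instance : IsDirectedOrder (SoundSet k n ℓ d p P) :=
  ⟨fun γ γ' => by
    obtain ⟨φ, h⟩ := γ.2
    obtain ⟨φ', h'⟩ := γ'.2
    exact ⟨⟨_, _, h.or h'⟩, fun c hc => Or.inl hc, fun c hc => Or.inr hc⟩⟩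

instance : Nonempty (SoundSet k n ℓ d p P) :=
  ⟨⟨fun _ => False, fun _ _ => False, Dfn.const _, Dfn.const _, fun _ h => h.elim⟩⟩

theorem exists_formulas_of_soundSet {M : ℕ} (γ : SoundSet k n ℓ d p P)
    (hγ : ∀ c, Embeddable (LEdges k P (Fin M)) (zeroEdgesParam k n ℓ p c) → γ.1 c) :
    ∃ Φ : (m : ℕ) → (Fin d → Fin m) → OFFml,
      (∀ (m : ℕ) (π : Fin d → Fin m), ∀ i ∈ (Φ m π).fv, i < m + n + ℓ) ∧
      ∀ c : Fin ℓ → ℝ,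
        Embeddable (LEdges k P (Fin M)) (zeroEdgesParam k n ℓ p c) →
        ∃ (m : ℕ) (π : Fin d → Fin m), m ≤ d ∧ Function.Surjective π ∧
          ∃ f : (Fin m → ℝ) → (Fin n → ℝ),
            (∀ (z : Fin m → ℝ) (x : Fin n → ℝ),
              ((Φ m π).Realize (valu m n ℓ z x c) ↔ f z = x)) ∧
            IsImmersion k (collapseT π P) (zeroEdgesParam k n ℓ p c) f := by
  obtain ⟨φ, -, hφ, hs⟩ := γ.2
  obtain ⟨ψ, h1, h2⟩ := hφ (Sum.elim (fun y : Fin ℓ => d + n + y)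
    (Sum.elim (fun i : Fin d => i) (fun j : Fin n => d + j)))
  refine ⟨fun m _ => if m = d then ψ else .eq .zero .zero, fun m π i hi => ?_, fun c hc => ?_⟩
  · dsimp only at hi
    split_ifs at hi with hm
    · subst hm
      obtain ⟨j, rfl⟩ := h1 i hi
      rcases j with y | i | j
      · simp
      · simp only [Sum.elim_inr, Sum.elim_inl]; omega
      · simp only [Sum.elim_inr]; omega
    · simp [OFFml.fv, OFTerm.fv] at hi
  · obtain ⟨f, hf, him⟩ := hs c (hγ c hc)
    refine ⟨d, id, le_rfl, Function.surjective_id, f, fun z x => ?_, him⟩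
    dsimp only
    rw [if_pos rfl, h2, ← hf]
    refine iff_of_eq (congrArg₂ φ (funext fun y => ?_) (funext fun j => ?_))
    · have e1 : ¬ (d + n + (y : ℕ) < d) := by omega
      have e2 : ¬ (d + n + (y : ℕ) - d < n) := by omega
      have e3 : d + n + (y : ℕ) - d - n = y := by omega
      simp only [valu, Sum.elim_inl, e1, e2, e3, dif_neg, not_false_eq_true, y.2, dif_pos]
    · rcases j with i | j
      · simp [valu]
      · simp [valu]

end

/-! ### Calculus of polynomial maps -/

section Calculus

variable {σ : Type*} [Fintype σ]

theorem contDiff_aeval (q : MvPolynomial σ ℚ) {n : WithTop ℕ∞} :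
    ContDiff ℝ n (fun v : σ → ℝ => MvPolynomial.aeval v q) := by
  induction q using MvPolynomial.induction_on with
  | C a => simpa using contDiff_const
  | add p q hp hq => simpa using hp.add hq
  | mul_X p j hp => simpa using hp.mul (contDiff_apply ℝ ℝ j)

theorem hasDerivAt_aeval (q : MvPolynomial σ ℚ) {T : ℝ → σ → ℝ} {T' : σ → ℝ} {s : ℝ}
    (hT : ∀ i, HasDerivAt (fun s => T s i) (T' i) s) :
    HasDerivAt (fun s => MvPolynomial.aeval (T s) q)
      (∑ i, MvPolynomial.aeval (T s) (MvPolynomial.pderiv i q) * T' i) s := by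
  classical
  induction q using MvPolynomial.induction_on with
  | C a => simpa using hasDerivAt_const s _
  | add p q hp hq =>
    simp only [map_add, add_mul, Finset.sum_add_distrib]
    exact hp.add hq
  | mul_X p j hp =>
    simp only [map_mul, MvPolynomial.aeval_X]
    convert! hp.mul (hT j) using 1
    simp only [Derivation.leibniz, MvPolynomial.pderiv_X, smul_eq_mul, map_add, map_mul, add_mul,
      Finset.sum_add_distrib, MvPolynomial.aeval_X, Finset.sum_mul]
    rw [add_comm]
    congr 1
    · exact Finset.sum_congr rfl fun i _ => by ring
    · rw [Finset.sum_eq_single j]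
      · simp
      · intro b _ hb
        simp [hb.symm]
      · simp

theorem exists_implicit {E : Type*} [NormedAddCommGroup E] [NormedSpace ℝ E] [CompleteSpace E]
    {Ψ : E × ℝ → ℝ} (hΨ : ContDiff ℝ 1 Ψ) {u : E × ℝ} (h0 : Ψ u = 0) {a : ℝ} (ha : a ≠ 0)
    (hd : HasDerivAt (fun t => Ψ (u.1, t)) a u.2) {N : Set (E × ℝ)} (hN : N ∈ nhds u) :
    ∃ h : E → ℝ, ∃ r > 0, ∃ δ > 0, h u.1 = u.2 ∧ ∀ y ∈ Metric.ball u.1 δ,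
      |h y - u.2| < r ∧ Ψ (y, h y) = 0 ∧ DifferentiableAt ℝ h y ∧
      ∀ t, |t - u.2| < r → (y, t) ∈ N ∧ (Ψ (y, t) = 0 → t = h y) := by
  have pn : (1 : WithTop ℕ∞) ≠ 0 := one_ne_zero
  have cdf : ContDiffAt ℝ 1 Ψ u := hΨ.contDiffAt
  have hinv : (fderiv ℝ Ψ u ∘L .inr ℝ E ℝ).IsInvertible := by
    have h1 : (fderiv ℝ Ψ u ∘L .inr ℝ E ℝ) 1 = a := by
      have h2 : HasFDerivAt Ψ (fderiv ℝ Ψ u) (u.1, u.2) :=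
        (cdf.differentiableAt pn).hasFDerivAt
      have h3 := h2.comp_hasDerivAt u.2
        ((hasDerivAt_const u.2 u.1).prodMk (hasDerivAt_id u.2))
      exact h3.unique hd
    refine ⟨ContinuousLinearEquiv.unitsEquivAut ℝ (Units.mk0 a ha), ?_⟩
    ext
    simp [← h1]
  have hev := cdf.eventually_apply_eq_iff_implicitFunction pn hinv
  obtain ⟨r, hr, hball⟩ := Metric.mem_nhds_iff.1 (Filter.inter_mem hev hN)
  set h := cdf.implicitFunction pn hinv
  have hself : h u.1 = u.2 := cdf.implicitFunction_apply_self pn hinv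
  have hC := cdf.contDiffAt_implicitFunction pn hinv
  have e1 : ∀ᶠ y in nhds u.1, |h y - u.2| < r := by
    have := hC.continuousAt.tendsto
    rw [show cdf.implicitFunction pn hinv u.1 = u.2 from hself] at this
    exact this.eventually (Metric.ball_mem_nhds _ hr)
  have e2 := hC.eventually (by simp)
  obtain ⟨δ, hδ, hb⟩ := Metric.mem_nhds_iff.1
    (Filter.inter_mem (Filter.inter_mem e1 e2) (Metric.ball_mem_nhds u.1 hr))
  have key : ∀ y ∈ Metric.ball u.1 δ, ∀ t, |t - u.2| < r → (y, t) ∈ Metric.ball u r := by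
    intro y hy t ht
    rw [Metric.mem_ball, Prod.dist_eq]
    exact max_lt (hb hy).2 ht
  refine ⟨h, r, hr, δ, hδ, hself, fun y hy => ?_⟩
  have h1 := (hb hy).1.1
  have h2 := hball (key y hy _ h1)
  have h3 : ContDiffAt ℝ 1 h y := (hb hy).1.2
  refine ⟨h1, (h2.1.2 rfl).trans h0, h3.differentiableAt pn,
    fun t ht => ⟨(hball (key y hy t ht)).2, fun hyt => ?_⟩⟩
  exact ((hball (key y hy t ht)).1.1 (hyt.trans h0.symm)).symm

theorem eq_zero_of_linear_ode {J : Type*} [Fintype J] {g : ℝ → J → ℝ} {A : ℝ → J → J → ℝ}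
    (hA : ∀ i j, ContinuousOn (fun s => A s i j) (Set.Icc 0 1))
    (hg : ∀ s ∈ Set.Icc (0 : ℝ) 1, ∀ j, HasDerivAt (fun s => g s j) (∑ i, A s j i * g s i) s)
    (h0 : g 0 = 0) : g 1 = 0 := by
  have hK : ∃ K, ∀ s ∈ Set.Icc (0 : ℝ) 1, ∑ j, ∑ i, |A s j i| ≤ K := by
    have hc : ContinuousOn (fun s => ∑ j, ∑ i, |A s j i|) (Set.Icc 0 1) :=
      continuousOn_finsetSum _ fun j _ => continuousOn_finsetSum _ fun i _ => (hA j i).abs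
    obtain ⟨K, hK⟩ := (isCompact_Icc.image_of_continuousOn hc).bddAbove
    exact ⟨K, fun s hs => hK ⟨s, hs, rfl⟩⟩
  obtain ⟨K, hK⟩ := hK
  have hd : ∀ s ∈ Set.Icc (0 : ℝ) 1, HasDerivAt g (fun j => ∑ i, A s j i * g s i) s :=
    fun s hs => hasDerivAt_pi.2 (hg s hs)
  refine eq_zero_of_abs_deriv_le_mul_abs_self_of_eq_zero_right (f := g)
    (f' := fun s j => ∑ i, A s j i * g s i) (K := K) (a := 0) (b := 1)
    (fun s hs => (hd s hs).continuousAt.continuousWithinAt)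
    (fun s hs => (hd s ⟨hs.1, hs.2.le⟩).hasDerivWithinAt) h0 (fun s hs => ?_) 1 (by simp)
  have hs' : s ∈ Set.Icc (0 : ℝ) 1 := ⟨hs.1, hs.2.le⟩
  have hK0 : 0 ≤ K := (by positivity : (0 : ℝ) ≤ ∑ j, ∑ i, |A s j i|).trans (hK s hs')
  rw [pi_norm_le_iff_of_nonneg (by positivity)]
  intro j
  calc ‖∑ i, A s j i * g s i‖ ≤ ∑ i, ‖A s j i * g s i‖ := norm_sum_le _ _
    _ ≤ ∑ i, |A s j i| * ‖g s‖ := by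
      refine Finset.sum_le_sum fun i _ => ?_
      rw [norm_mul]
      exact mul_le_mul_of_nonneg_left (norm_le_pi_norm _ _) (norm_nonneg _)
    _ = (∑ i, |A s j i|) * ‖g s‖ := (Finset.sum_mul ..).symm
    _ ≤ K * ‖g s‖ := by
      refine mul_le_mul_of_nonneg_right (le_trans ?_ (hK s hs')) (norm_nonneg _)
      exact Finset.single_le_sum (f := fun j => ∑ i, |A s j i|) (fun j _ => by positivity)
        (Finset.mem_univ j)

end Calculus

/-! ### Simultaneous branches of algebraic functions -/

section Branches

variable {β : Type} {n ℓ d : ℕ}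

/-- The point with coordinates `y`, last unknown `t` and parameters `c`. -/
def unknownPt {β K : Type*} {ℓ : ℕ} (y : β → K) (t : K) (c : Fin ℓ → K) : Option β ⊕ Fin ℓ → K :=
  Sum.elim (fun o => o.elim t y) c

/-- `x` consists of the roots of `F u (y, ·)` that are closest to `x₀ u`. -/
def RootAt (F : Fin n → MvPolynomial (Option β ⊕ Fin ℓ) ℚ) (c : Fin ℓ → ℝ) (x₀ : Fin n → ℝ)
    (y : β → ℝ) (x : Fin n → ℝ) : Prop :=
  ∀ u, MvPolynomial.aeval (unknownPt y (x u) c) (F u) = 0 ∧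
    ∀ t, MvPolynomial.aeval (unknownPt y t c) (F u) = 0 → |x u - x₀ u| ≤ |t - x₀ u|

theorem continuous_unknownPt (c : Fin ℓ → ℝ) :
    Continuous fun z : (β → ℝ) × ℝ => unknownPt z.1 z.2 c := by
  refine continuous_pi fun s => ?_
  rcases s with (_ | a) | j
  · exact continuous_snd
  · exact (continuous_apply a).comp continuous_fst
  · exact continuous_const

theorem contDiff_unknownPt [Fintype β] (c : Fin ℓ → ℝ) :
    ContDiff ℝ 1 fun z : (β → ℝ) × ℝ => unknownPt z.1 z.2 c := by
  refine contDiff_pi.2 fun s => ?_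
  rcases s with (_ | a) | j
  · exact contDiff_snd
  · exact (contDiff_apply ℝ ℝ a).comp contDiff_fst
  · exact contDiff_const

theorem hasDerivAt_unknownPt [Fintype β] (q : MvPolynomial (Option β ⊕ Fin ℓ) ℚ) (c : Fin ℓ → ℝ)
    {y : ℝ → β → ℝ} {y' : β → ℝ} {x : ℝ → ℝ} {x' s : ℝ}
    (hy : ∀ a, HasDerivAt (fun s => y s a) (y' a) s) (hx : HasDerivAt x x' s) :
    HasDerivAt (fun s => MvPolynomial.aeval (unknownPt (y s) (x s) c) q)
      (MvPolynomial.aeval (unknownPt (y s) (x s) c) (MvPolynomial.pderiv (.inl none) q) * x' +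
        ∑ a, MvPolynomial.aeval (unknownPt (y s) (x s) c)
          (MvPolynomial.pderiv (.inl (some a)) q) * y' a) s := by
  have := hasDerivAt_aeval q (T := fun s => unknownPt (y s) (x s) c)
    (T' := unknownPt y' x' 0) (s := s) (by
      rintro ((_ | a) | j)
      · exact hx
      · exact hy a
      · exact hasDerivAt_const _ _)
  convert! this using 1
  simp [Fintype.sum_sum_type, Fintype.sum_option, unknownPt]

theorem exists_branches [Fintype β] {F : Fin n → MvPolynomial (Option β ⊕ Fin ℓ) ℚ} {c : Fin ℓ → ℝ}
    {y₀ : β → ℝ} {x₀ : Fin n → ℝ} {τ : Fin d → β} {ω : Fin d → Fin n}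
    (hF : ∀ u, MvPolynomial.aeval (unknownPt y₀ (x₀ u) c) (F u) = 0)
    (hD : ∀ u, MvPolynomial.aeval (unknownPt y₀ (x₀ u) c)
      (MvPolynomial.pderiv (.inl none) (F u)) ≠ 0)
    (hτ : ∀ i, MvPolynomial.aeval (unknownPt y₀ (x₀ (ω i)) c)
      (MvPolynomial.pderiv (.inl (some (τ i))) (F (ω i))) ≠ 0) :
    ∃ (h : Fin n → (β → ℝ) → ℝ) (δ : ℝ), 0 < δ ∧ (∀ u, h u y₀ = x₀ u) ∧
      (∀ y ∈ Metric.ball y₀ δ, ∀ u, MvPolynomial.aeval (unknownPt y (h u y) c) (F u) = 0 ∧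
        DifferentiableAt ℝ (h u) y ∧ MvPolynomial.aeval (unknownPt y (h u y) c)
          (MvPolynomial.pderiv (.inl none) (F u)) ≠ 0) ∧
      (∀ y ∈ Metric.ball y₀ δ, ∀ x, RootAt F c x₀ y x ↔ x = fun u => h u y) ∧
      ∀ y ∈ Metric.ball y₀ δ, ∀ y' ∈ Metric.ball y₀ δ, ∀ i, y (τ i) ≠ y' (τ i) →
        (∀ a, a ≠ τ i → y a = y' a) → h (ω i) y ≠ h (ω i) y' := by
  have H : ∀ u, ∃ h : (β → ℝ) → ℝ, ∃ r > 0, ∃ δ > 0, h y₀ = x₀ u ∧ ∀ y ∈ Metric.ball y₀ δ,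
      |h y - x₀ u| < r ∧ MvPolynomial.aeval (unknownPt y (h y) c) (F u) = 0 ∧
      DifferentiableAt ℝ h y ∧
      ∀ t, |t - x₀ u| < r → (MvPolynomial.aeval (unknownPt y t c)
          (MvPolynomial.pderiv (.inl none) (F u)) ≠ 0 ∧
        ∀ i, ω i = u → MvPolynomial.aeval (unknownPt y t c)
          (MvPolynomial.pderiv (.inl (some (τ i))) (F u)) ≠ 0) ∧
        (MvPolynomial.aeval (unknownPt y t c) (F u) = 0 → t = h y) := by
    intro u
    have hc : ∀ q : MvPolynomial (Option β ⊕ Fin ℓ) ℚ,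
        Continuous fun z : (β → ℝ) × ℝ => MvPolynomial.aeval (unknownPt z.1 z.2 c) q :=
      fun q => (contDiff_aeval q (n := 0)).continuous.comp (continuous_unknownPt c)
    have hd := hasDerivAt_unknownPt (F u) c (y := fun _ => y₀) (y' := 0) (s := x₀ u)
      (fun a => hasDerivAt_const _ _) (hasDerivAt_id _)
    simp only [Pi.zero_apply, mul_zero, Finset.sum_const_zero, add_zero, mul_one] at hd
    refine exists_implicit (Ψ := fun z => MvPolynomial.aeval (unknownPt z.1 z.2 c) (F u))
      (u := (y₀, x₀ u)) ((contDiff_aeval _).comp (contDiff_unknownPt c)) (hF u) (hD u) hd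
      (N := {z | MvPolynomial.aeval (unknownPt z.1 z.2 c)
          (MvPolynomial.pderiv (.inl none) (F u)) ≠ 0 ∧
        ∀ i, ω i = u → MvPolynomial.aeval (unknownPt z.1 z.2 c)
          (MvPolynomial.pderiv (.inl (some (τ i))) (F u)) ≠ 0}) ?_
    refine Filter.inter_mem ((hc _).continuousAt.eventually_ne (hD u)) ?_
    refine (Filter.eventually_all (l := nhds (y₀, x₀ u))).2 fun i => ?_
    by_cases hi : ω i = u
    · subst hi
      filter_upwards [(hc _).continuousAt.eventually_ne (hτ i)] with z hz _ using hz
    · exact Filter.Eventually.of_forall fun z h => absurd h hi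
  choose h r hr δ hδ h0 hb using H
  obtain ⟨ε, hε, hεδ⟩ : ∃ ε > 0, ∀ u, ε ≤ δ u := by
    rcases isEmpty_or_nonempty (Fin n) with hn | hn
    · exact ⟨1, one_pos, fun u => hn.elim u⟩
    · obtain ⟨u, hu⟩ := Finite.exists_min δ
      exact ⟨δ u, hδ u, hu⟩
  have hb' : ∀ y ∈ Metric.ball y₀ ε, ∀ u, _ :=
    fun y hy u => hb u y (Metric.ball_subset_ball (hεδ u) hy)
  refine ⟨h, ε, hε, h0, fun y hy u => ?_, fun y hy x => ?_, fun y hy y' hy' i hi hne heq => ?_⟩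
  · obtain ⟨h1, h2, h3, h4⟩ := hb' y hy u
    exact ⟨h2, h3, (h4 _ h1).1.1⟩
  · constructor
    · intro hx
      funext u
      obtain ⟨h1, h2, h3, h4⟩ := hb' y hy u
      exact (h4 _ (((hx u).2 _ h2).trans_lt h1)).2 (hx u).1
    · rintro rfl u
      obtain ⟨h1, h2, h3, h4⟩ := hb' y hy u
      refine ⟨h2, fun t ht => ?_⟩
      rcases lt_or_ge |t - x₀ u| (r u) with h5 | h5
      · rw [(h4 t h5).2 ht]
      · exact h1.le.trans h5
  · obtain ⟨h1, h2, -, -⟩ := hb' y hy (ω i)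
    obtain ⟨-, h2', -, -⟩ := hb' y' hy' (ω i)
    rw [← heq] at h2'
    set t := h (ω i) y
    have hder : ∀ s : ℝ, HasDerivAt
        (fun s => MvPolynomial.aeval (unknownPt (y + s • (y' - y)) t c) (F (ω i)))
        (MvPolynomial.aeval (unknownPt (y + s • (y' - y)) t c)
          (MvPolynomial.pderiv (.inl (some (τ i))) (F (ω i))) * (y' (τ i) - y (τ i))) s := by
      intro s
      have := hasDerivAt_unknownPt (F (ω i)) c (y := fun s => y + s • (y' - y)) (y' := y' - y)
        (s := s) (x := fun _ => t) (x' := 0) (fun a => by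
          simpa using ((hasDerivAt_id s).mul_const (y' a - y a)).const_add (y a))
        (hasDerivAt_const _ _)
      convert! this using 1
      rw [mul_zero, zero_add, Finset.sum_eq_single (τ i)]
      · rfl
      · intro a _ ha
        simp [hne a ha]
      · simp
    obtain ⟨s, hs, hs0⟩ := exists_hasDerivAt_eq_zero (a := (0 : ℝ)) (b := 1) one_pos
      (fun s _ => (hder s).continuousAt.continuousWithinAt)
      (by simp [h2, h2']) fun s _ => hder s
    have hsb : y + s • (y' - y) ∈ Metric.ball y₀ ε :=
      (convex_ball y₀ ε).add_smul_sub_mem hy hy' ⟨hs.1.le, hs.2.le⟩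
    exact mul_ne_zero (((hb' _ hsb (ω i)).2.2.2 t h1).1.2 i rfl)
      (sub_ne_zero.2 (Ne.symm hi)) hs0

end Branches

/-! ### Prolongation of ideals along algebraic functions -/

section Prolong

variable {β Θ : Type} {k n ℓ d : ℕ}

/-- The point with coordinates `Y`, unknowns `X` and parameters `c`. -/
def blockPt {Θ K : Type*} {k n ℓ : ℕ} (Y : Θ → K) (X : Fin k × Fin n → K) (c : Fin ℓ → K) :
    (Θ ⊕ Fin k × Fin n) ⊕ Fin ℓ → K :=
  Sum.elim (Sum.elim Y X) c

/-- The `l`-th copy of the variables, the unknown being the `u`-th one. -/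
def copyVar (q : β → Fin k → Θ) (v : Fin k × Fin n) :
    Option β ⊕ Fin ℓ → (Θ ⊕ Fin k × Fin n) ⊕ Fin ℓ :=
  Sum.map (fun o => o.elim (.inr v) (fun a => .inl (q a v.1))) id

theorem blockPt_coord {Θ K : Type*} {k n ℓ : ℕ} (Y : Θ → K) (X : Fin k × Fin n → K)
    (c : Fin ℓ → K) : (∀ θ, blockPt Y X c (.inl (.inl θ)) = Y θ) ∧
      (∀ v, blockPt Y X c (.inl (.inr v)) = X v) ∧ ∀ j, blockPt Y X c (.inr j) = c j :=
  ⟨fun _ => rfl, fun _ => rfl, fun _ => rfl⟩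

theorem blockPt_comp_copyVar {K : Type*} (q : β → Fin k → Θ) (v : Fin k × Fin n) (Y : Θ → K)
    (X : Fin k × Fin n → K) (c : Fin ℓ → K) :
    blockPt Y X c ∘ copyVar q v = unknownPt (fun a => Y (q a v.1)) (X v) c := by
  funext s
  rcases s with (_ | a) | j <;> rfl

theorem aeval_copyVar {K : Type*} [Field K] [Algebra ℚ K] (q : β → Fin k → Θ) (v : Fin k × Fin n)
    (Y : Θ → K) (X : Fin k × Fin n → K) (c : Fin ℓ → K) (f : MvPolynomial (Option β ⊕ Fin ℓ) ℚ) :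
    MvPolynomial.aeval (blockPt Y X c) (MvPolynomial.rename (copyVar q v) f) =
      MvPolynomial.aeval (unknownPt (fun a => Y (q a v.1)) (X v) c) f := by
  rw [MvPolynomial.aeval_rename, blockPt_comp_copyVar]

variable [Fintype β] [DecidableEq Θ]

/-- The derivation `∂/∂Y_θ` extended to the algebraic functions defined by `F`, with
denominators cleared. -/
noncomputable def prolong (F : Fin n → MvPolynomial (Option β ⊕ Fin ℓ) ℚ) (q : β → Fin k → Θ)
    (θ : Θ) (G : MvPolynomial ((Θ ⊕ Fin k × Fin n) ⊕ Fin ℓ) ℚ) :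
    MvPolynomial ((Θ ⊕ Fin k × Fin n) ⊕ Fin ℓ) ℚ :=
  (∏ v : Fin k × Fin n,
      MvPolynomial.rename (copyVar q v) (MvPolynomial.pderiv (.inl none) (F v.2))) *
      MvPolynomial.pderiv (.inl (.inl θ)) G -
    ∑ v : Fin k × Fin n, (∏ v' ∈ Finset.univ.erase v,
        MvPolynomial.rename (copyVar q v') (MvPolynomial.pderiv (.inl none) (F v'.2))) *
      (∑ a, if q a v.1 = θ then
        MvPolynomial.rename (copyVar q v) (MvPolynomial.pderiv (.inl (some a)) (F v.2)) else 0) *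
      MvPolynomial.pderiv (.inl (.inr v)) G

variable [Fintype Θ]

theorem sum_mul_aeval_prolong {K : Type*} [Field K] [Algebra ℚ K]
    (F : Fin n → MvPolynomial (Option β ⊕ Fin ℓ) ℚ) (q : β → Fin k → Θ)
    (G : MvPolynomial ((Θ ⊕ Fin k × Fin n) ⊕ Fin ℓ) ℚ) (Y Y' : Θ → K) (X X' : Fin k × Fin n → K)
    (c : Fin ℓ → K)
    (hX : ∀ v, MvPolynomial.aeval (unknownPt (fun a => Y (q a v.1)) (X v) c)
        (MvPolynomial.pderiv (.inl none) (F v.2)) * X' v +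
      ∑ a, MvPolynomial.aeval (unknownPt (fun a => Y (q a v.1)) (X v) c)
        (MvPolynomial.pderiv (.inl (some a)) (F v.2)) * Y' (q a v.1) = 0) :
    ∑ θ, Y' θ * MvPolynomial.aeval (blockPt Y X c) (prolong F q θ G) =
      (∏ v : Fin k × Fin n, MvPolynomial.aeval (unknownPt (fun a => Y (q a v.1)) (X v) c)
        (MvPolynomial.pderiv (.inl none) (F v.2))) *
      (∑ θ, MvPolynomial.aeval (blockPt Y X c) (MvPolynomial.pderiv (.inl (.inl θ)) G) * Y' θ +
        ∑ v, MvPolynomial.aeval (blockPt Y X c) (MvPolynomial.pderiv (.inl (.inr v)) G) * X' v) := by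
  classical
  simp only [prolong, map_sub, map_mul, map_prod, map_sum, apply_ite (MvPolynomial.aeval _),
    map_zero, aeval_copyVar, mul_sub, Finset.sum_sub_distrib, mul_add]
  rw [sub_eq_add_neg]
  congr 1
  · rw [Finset.mul_sum]
    exact Finset.sum_congr rfl fun θ _ => by ring
  · rw [Finset.sum_congr rfl fun θ _ => Finset.mul_sum _ _ (Y' θ), Finset.mul_sum,
      Finset.sum_comm, ← Finset.sum_neg_distrib]
    refine Finset.sum_congr rfl fun v _ => ?_
    rw [← Finset.mul_prod_erase _ _ (Finset.mem_univ v)]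
    have h1 : ∀ A B : K, ∑ θ, Y' θ * (A * (∑ a, if q a v.1 = θ then
        MvPolynomial.aeval (unknownPt (fun a => Y (q a v.1)) (X v) c)
          (MvPolynomial.pderiv (.inl (some a)) (F v.2)) else 0) * B) =
        A * B * ∑ a, MvPolynomial.aeval (unknownPt (fun a => Y (q a v.1)) (X v) c)
          (MvPolynomial.pderiv (.inl (some a)) (F v.2)) * Y' (q a v.1) := by
      intro A B
      have : ∀ θ, Y' θ * (A * (∑ a, if q a v.1 = θ then
          MvPolynomial.aeval (unknownPt (fun a => Y (q a v.1)) (X v) c)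
            (MvPolynomial.pderiv (.inl (some a)) (F v.2)) else 0) * B) =
          A * B * ∑ a, if q a v.1 = θ then
            MvPolynomial.aeval (unknownPt (fun a => Y (q a v.1)) (X v) c)
            (MvPolynomial.pderiv (.inl (some a)) (F v.2)) * Y' θ else 0 := by
        intro θ
        rw [Finset.mul_sum, Finset.sum_mul, Finset.mul_sum, Finset.mul_sum]
        refine Finset.sum_congr rfl fun a _ => ?_
        split_ifs <;> ring
      rw [Finset.sum_congr rfl fun θ _ => this θ, ← Finset.mul_sum, Finset.sum_comm]
      simp
    rw [h1, eq_neg_of_add_eq_zero_right (hX v)]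
    ring

end Prolong

/-! ### Edges along segments -/

section Segment

variable {β Θ : Type} [Fintype β] [Fintype Θ] [DecidableEq Θ] {k n ℓ : ℕ}

theorem aeval_eq_zero_of_prolong {F : Fin n → MvPolynomial (Option β ⊕ Fin ℓ) ℚ}
    {q : β → Fin k → Θ} (Gs : Finset (MvPolynomial ((Θ ⊕ Fin k × Fin n) ⊕ Fin ℓ) ℚ))
    (hGs : ∀ θ, ∀ G ∈ Gs, prolong F q θ G ∈ Ideal.span (Gs : Set _)) {c : Fin ℓ → ℝ}
    {Y : ℝ → Θ → ℝ} {Y' : Θ → ℝ} {X X' : ℝ → Fin k × Fin n → ℝ}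
    (hY : ∀ s θ, HasDerivAt (fun s => Y s θ) (Y' θ) s)
    (hX : ∀ s ∈ Set.Icc (0 : ℝ) 1, ∀ v, HasDerivAt (fun s => X s v) (X' s v) s)
    (hF : ∀ s ∈ Set.Icc (0 : ℝ) 1, ∀ v,
      MvPolynomial.aeval (unknownPt (fun a => Y s (q a v.1)) (X s v) c)
        (MvPolynomial.pderiv (.inl none) (F v.2)) * X' s v +
      ∑ a, MvPolynomial.aeval (unknownPt (fun a => Y s (q a v.1)) (X s v) c)
        (MvPolynomial.pderiv (.inl (some a)) (F v.2)) * Y' (q a v.1) = 0)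
    (hD : ∀ s ∈ Set.Icc (0 : ℝ) 1, ∀ v,
      MvPolynomial.aeval (unknownPt (fun a => Y s (q a v.1)) (X s v) c)
        (MvPolynomial.pderiv (.inl none) (F v.2)) ≠ 0)
    (h0 : ∀ G ∈ Gs, MvPolynomial.aeval (blockPt (Y 0) (X 0) c) G = 0) :
    ∀ G ∈ Gs, MvPolynomial.aeval (blockPt (Y 1) (X 1) c) G = 0 := by
  have hC : ∀ θ, ∀ G : Gs, ∃ C : Gs → MvPolynomial ((Θ ⊕ Fin k × Fin n) ⊕ Fin ℓ) ℚ,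
      ∑ H : Gs, C H * H.1 = prolong F q θ G := by
    intro θ G
    obtain ⟨C, hC⟩ := (Submodule.mem_span_finset').1 (hGs θ G.1 G.2)
    exact ⟨C, hC⟩
  choose C hC using hC
  have hZ : ∀ s ∈ Set.Icc (0 : ℝ) 1, ∀ i, HasDerivAt (fun s => blockPt (Y s) (X s) c i)
      (blockPt Y' (X' s) 0 i) s := by
    rintro s hs ((θ | v) | j)
    · exact hY s θ
    · exact hX s hs v
    · exact hasDerivAt_const _ _
  have hcont : ∀ f : MvPolynomial ((Θ ⊕ Fin k × Fin n) ⊕ Fin ℓ) ℚ,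
      ContinuousOn (fun s => MvPolynomial.aeval (blockPt (Y s) (X s) c) f) (Set.Icc 0 1) :=
    fun f s hs => (hasDerivAt_aeval f (hZ s hs)).continuousAt.continuousWithinAt
  have key := eq_zero_of_linear_ode (J := Gs)
    (g := fun s G => MvPolynomial.aeval (blockPt (Y s) (X s) c) G.1)
    (A := fun s G H => (∏ v : Fin k × Fin n,
      MvPolynomial.aeval (unknownPt (fun a => Y s (q a v.1)) (X s v) c)
        (MvPolynomial.pderiv (.inl none) (F v.2)))⁻¹ *
      ∑ θ, Y' θ * MvPolynomial.aeval (blockPt (Y s) (X s) c) (C θ G H)) ?_ ?_ ?_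
  · intro G hG
    exact congrFun key ⟨G, hG⟩
  · intro G H
    refine ContinuousOn.mul (ContinuousOn.inv₀ ?_ fun s hs => ?_) ?_
    · refine continuousOn_finsetProd _ fun v _ => ?_
      simpa only [aeval_copyVar] using hcont (MvPolynomial.rename (copyVar q v)
        (MvPolynomial.pderiv (.inl none) (F v.2)))
    · exact Finset.prod_ne_zero_iff.2 fun v _ => hD s hs v
    · exact continuousOn_finsetSum _ fun θ _ => (hcont _).const_smul (Y' θ)
  · intro s hs G
    have := hasDerivAt_aeval G.1 (hZ s hs)
    convert! this using 1
    have e := sum_mul_aeval_prolong F q G.1 (Y s) Y' (X s) (X' s) c (hF s hs)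
    have hΔ := Finset.prod_ne_zero_iff.2 fun v (_ : v ∈ Finset.univ) => hD s hs v
    simp only [Fintype.sum_sum_type, blockPt_coord, Pi.zero_apply, mul_zero,
      Finset.sum_const_zero, add_zero]
    rw [← mul_right_inj' hΔ]
    refine Eq.trans ?_ e
    simp only [← hC, map_sum, map_mul, Finset.mul_sum, Finset.sum_mul]
    rw [Finset.sum_comm]
    refine Finset.sum_congr rfl fun θ _ => Finset.sum_congr rfl fun H _ => ?_
    rw [mul_assoc _⁻¹, mul_inv_cancel_left₀ hΔ]
    ring
  · funext G
    exact h0 G.1 G.2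

end Segment

/-! ### Immersions from algebraic functions -/

section Good

variable {β Θ : Type} [DecidableEq β] {k n ℓ d : ℕ} {α : Type v}

/-- The point `y` with `w i` added to its coordinate `τ i`, for each `i`. -/
def move (τ : Fin d → β) (y : β → ℝ) (w : Fin d → ℝ) (a : β) : ℝ :=
  y a + ∑ i, if τ i = a then w i else 0

/-- On the box of radius `ε` the root vectors are well-defined, one-to-one in each coordinate, and
they map copies of the pattern `x` to zeros of `p`. -/
def Good (p : MvPolynomial ((Fin k × Fin n) ⊕ Fin ℓ) ℚ) (x : Fin k → Fin d → α)
    (F : Fin n → MvPolynomial (Option β ⊕ Fin ℓ) ℚ) (τ : Fin d → β) (c : Fin ℓ → ℝ)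
    (y₀ : β → ℝ) (x₀ : Fin n → ℝ) (ε : ℝ) : Prop :=
  0 < ε ∧ (∀ w : Fin d → ℝ, (∀ i, |w i| < ε) → ∃ X, RootAt F c x₀ (move τ y₀ w) X) ∧
  (∀ w : Fin d → ℝ, (∀ i, |w i| < ε) → ∀ X X', RootAt F c x₀ (move τ y₀ w) X →
    RootAt F c x₀ (move τ y₀ w) X' → X = X') ∧
  (∀ i, ∀ w : Fin d → ℝ, (∀ j, |w j| < ε) → ∀ w' : Fin d → ℝ, (∀ j, |w' j| < ε) →
    (∀ j, j ≠ i → w j = w' j) → ∀ X, RootAt F c x₀ (move τ y₀ w) X →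
    RootAt F c x₀ (move τ y₀ w') X → w i = w' i) ∧
  ∀ W : Fin k × Fin d → ℝ, (∀ v, |W v| < ε) →
    (∀ l l' i, x l i = x l' i → W (l, i) = W (l', i)) → ∀ X : Fin k × Fin n → ℝ,
    (∀ l, RootAt F c x₀ (move τ y₀ fun i => W (l, i)) fun u => X (l, u)) →
    MvPolynomial.aeval (Sum.elim X c) p = 0

theorem Good.anti {p : MvPolynomial ((Fin k × Fin n) ⊕ Fin ℓ) ℚ} {x : Fin k → Fin d → α}
    {F : Fin n → MvPolynomial (Option β ⊕ Fin ℓ) ℚ} {τ : Fin d → β} {c : Fin ℓ → ℝ}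
    {y₀ : β → ℝ} {x₀ : Fin n → ℝ} {ε ε' : ℝ} (h : Good p x F τ c y₀ x₀ ε) (h0 : 0 < ε')
    (hε : ε' ≤ ε) : Good p x F τ c y₀ x₀ ε' :=
  ⟨h0, fun w hw => h.2.1 w fun i => (hw i).trans_le hε,
    fun w hw => h.2.2.1 w fun i => (hw i).trans_le hε,
    fun i w hw w' hw' => h.2.2.2.1 i w (fun i => (hw i).trans_le hε) w'
      fun i => (hw' i).trans_le hε,
    fun W hW => h.2.2.2.2 W fun i => (hW i).trans_le hε⟩

theorem move_mem_ball [Fintype β] {τ : Fin d → β} {y : β → ℝ} {δ : ℝ} (hδ : 0 < δ) {w : Fin d → ℝ}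
    (hw : ∀ i, |w i| < δ / (d + 1)) : move τ y w ∈ Metric.ball y δ := by
  rw [Metric.mem_ball, dist_pi_lt_iff hδ]
  intro a
  rw [Real.dist_eq, move, add_sub_cancel_left]
  calc |∑ i, if τ i = a then w i else 0| ≤ ∑ i : Fin d, δ / (d + 1) := by
        refine (Finset.abs_sum_le_sum_abs _ _).trans (Finset.sum_le_sum fun i _ => ?_)
        split_ifs
        · exact (hw i).le
        · simpa using by positivity
    _ < δ := by
        rw [Finset.sum_const, Finset.card_univ, Fintype.card_fin, nsmul_eq_mul, ← mul_div_assoc,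
          div_lt_iff₀ (by positivity)]
        linarith [mul_comm δ d]

variable [Fintype β] [Fintype Θ] [DecidableEq Θ]

theorem exists_good {p : MvPolynomial ((Fin k × Fin n) ⊕ Fin ℓ) ℚ} {x : Fin k → Fin d → α}
    {F : Fin n → MvPolynomial (Option β ⊕ Fin ℓ) ℚ} {τ : Fin d → β} {ω : Fin d → Fin n}
    {q : β → Fin k → Θ} {b : Θ → β} (hb : ∀ a l, b (q a l) = a)
    (hq : ∀ a l l', q a l = q a l' → ∀ i, τ i = a → x l i = x l' i)
    (Gs : Finset (MvPolynomial ((Θ ⊕ Fin k × Fin n) ⊕ Fin ℓ) ℚ))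
    (hGs : ∀ θ, ∀ G ∈ Gs, prolong F q θ G ∈ Ideal.span (Gs : Set _))
    (hp : MvPolynomial.rename (Sum.map Sum.inr id) p ∈
      Ideal.span (Gs : Set (MvPolynomial ((Θ ⊕ Fin k × Fin n) ⊕ Fin ℓ) ℚ)))
    {c : Fin ℓ → ℝ} {y₀ : β → ℝ} {x₀ : Fin n → ℝ}
    (hF : ∀ u, MvPolynomial.aeval (unknownPt y₀ (x₀ u) c) (F u) = 0)
    (hD : ∀ u, MvPolynomial.aeval (unknownPt y₀ (x₀ u) c)
      (MvPolynomial.pderiv (.inl none) (F u)) ≠ 0)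
    (hτ : ∀ i, MvPolynomial.aeval (unknownPt y₀ (x₀ (ω i)) c)
      (MvPolynomial.pderiv (.inl (some (τ i))) (F (ω i))) ≠ 0)
    (hG : ∀ G ∈ Gs, MvPolynomial.aeval
      (blockPt (fun θ => y₀ (b θ)) (fun v : Fin k × Fin n => x₀ v.2) c) G = 0) :
    ∃ ε, Good p x F τ c y₀ x₀ ε := by
  obtain ⟨h, δ, hδ, h0, hroot, huniq, hinj⟩ := exists_branches hF hD hτ
  have hball : ∀ w : Fin d → ℝ, (∀ i, |w i| < δ / (d + 1)) → move τ y₀ w ∈ Metric.ball y₀ δ :=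
    fun w hw => move_mem_ball hδ hw
  refine ⟨δ / (d + 1), by positivity, fun w hw => ⟨_, (huniq _ (hball w hw) _).2 rfl⟩,
    fun w hw X X' hX hX' => ?_, fun i w hw w' hw' hww X hX hX' => ?_, fun W hW hx X hX => ?_⟩
  · rw [(huniq _ (hball w hw) _).1 hX, (huniq _ (hball w hw) _).1 hX']
  · by_contra hne
    by_cases h2 : move τ y₀ w (τ i) = move τ y₀ w' (τ i)
    · have e : ∑ j ∈ Finset.univ.erase i, (if τ j = τ i then w j else 0) =
          ∑ j ∈ Finset.univ.erase i, (if τ j = τ i then w' j else 0) :=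
        Finset.sum_congr rfl fun j hj => by rw [hww j (Finset.ne_of_mem_erase hj)]
      have e1 := Finset.add_sum_erase Finset.univ (fun j => if τ j = τ i then w j else 0)
        (Finset.mem_univ i)
      have e2 := Finset.add_sum_erase Finset.univ (fun j => if τ j = τ i then w' j else 0)
        (Finset.mem_univ i)
      simp only [if_true] at e1 e2
      simp only [move] at h2
      exact hne (by linarith)
    · refine hinj _ (hball w hw) _ (hball w' hw') i h2 (fun a ha => ?_) ?_
      · simp only [move, add_right_inj]
        refine Finset.sum_congr rfl fun j _ => ?_
        split_ifs with hj
        · rw [hww j (by rintro rfl; exact ha hj.symm)]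
        · rfl
      · have := ((huniq _ (hball w hw) _).1 hX).symm.trans ((huniq _ (hball w' hw') _).1 hX')
        exact congrFun this (ω i)
  · classical
    set V : Fin k → β → ℝ := fun l a => ∑ i, if τ i = a then W (l, i) else 0 with hV
    have hVeq : ∀ a l l', q a l = q a l' → V l a = V l' a := by
      intro a l l' hll
      refine Finset.sum_congr rfl fun i _ => ?_
      split_ifs with hi
      · exact hx _ _ _ (hq a l l' hll i hi)
      · rfl
    obtain ⟨Y', hY'q⟩ : ∃ Y' : Θ → ℝ, ∀ a l, Y' (q a l) = V l a := by
      refine ⟨Function.extend (fun v : β × Fin k => q v.1 v.2) (fun v => V v.2 v.1) 0,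
        fun a l => Function.FactorsThrough.extend_apply (g := fun v : β × Fin k => V v.2 v.1)
          ?_ _ (a, l)⟩
      rintro ⟨a, l⟩ ⟨a', l'⟩ h
      obtain rfl : a = a' := by simpa only [hb] using congrArg b h
      exact hVeq a l l' h
    have hmem : ∀ s ∈ Set.Icc (0 : ℝ) 1, ∀ l,
        (fun a => y₀ a + s * V l a) ∈ Metric.ball y₀ δ := by
      intro s hs l
      have h1 := (convex_ball y₀ δ).add_smul_sub_mem (Metric.mem_ball_self hδ)
        (hball (fun i => W (l, i)) fun i => hW _) hs
      convert h1 using 1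
      funext a
      simp [move, V]
    have hYd : ∀ (s r : ℝ) a, HasDerivAt (fun s => y₀ a + s * r) r s := by
      intro s r a
      simpa using ((hasDerivAt_id s).mul_const r).const_add (y₀ a)
    have hXd : ∀ s ∈ Set.Icc (0 : ℝ) 1, ∀ v : Fin k × Fin n,
        HasDerivAt (fun s => h v.2 fun a => y₀ a + s * V v.1 a)
          (fderiv ℝ (h v.2) (fun a => y₀ a + s * V v.1 a) (V v.1)) s := by
      intro s hs v
      exact ((hroot _ (hmem s hs v.1) v.2).2.1.hasFDerivAt).comp_hasDerivAt s
        (hasDerivAt_pi.2 fun a => hYd s (V v.1 a) a)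
    have key := aeval_eq_zero_of_prolong Gs hGs (c := c) (q := q) (F := F)
      (Y := fun s θ => y₀ (b θ) + s * Y' θ) (Y' := Y')
      (X := fun s v => h v.2 fun a => y₀ a + s * V v.1 a)
      (X' := fun s v => fderiv ℝ (h v.2) (fun a => y₀ a + s * V v.1 a) (V v.1))
      (fun s θ => hYd s _ _) hXd ?_ ?_ ?_
    · have hspan : ∀ G ∈ Ideal.span (Gs : Set (MvPolynomial ((Θ ⊕ Fin k × Fin n) ⊕ Fin ℓ) ℚ)),
          MvPolynomial.aeval (blockPt (fun θ => y₀ (b θ) + 1 * Y' θ)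
            (fun v : Fin k × Fin n => h v.2 fun a => y₀ a + 1 * V v.1 a) c) G = 0 := by
        intro G hG'
        have : Ideal.span (Gs : Set _) ≤ RingHom.ker (MvPolynomial.aeval (R := ℚ)
            (blockPt (fun θ => y₀ (b θ) + 1 * Y' θ)
            (fun v : Fin k × Fin n => h v.2 fun a => y₀ a + 1 * V v.1 a) c)) :=
          Ideal.span_le.2 fun G hG => key G hG
        exact this hG'
      have h1 := hspan _ hp
      rw [MvPolynomial.aeval_rename] at h1
      convert h1 using 3
      funext s
      rcases s with v | j
      · have h2 := congrFun ((huniq _ (hball (fun i => W (v.1, i)) fun i => hW _) _).1 (hX v.1)) v.2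
        simp only [Sum.elim_inl, Function.comp_apply, Sum.map_inl, blockPt, Sum.elim_inr, one_mul]
        exact h2
      · rfl
    · intro s hs v
      have h1 := hasDerivAt_unknownPt (F v.2) c (fun a => hYd s (V v.1 a) a) (hXd s hs v)
      have h2 : HasDerivWithinAt (fun s => MvPolynomial.aeval (unknownPt (fun a => y₀ a + s * V v.1 a)
          (h v.2 fun a => y₀ a + s * V v.1 a) c) (F v.2)) 0 (Set.Icc 0 1) s :=
        (hasDerivWithinAt_const s _ (0 : ℝ)).congr
          (fun r hr => (hroot _ (hmem r hr v.1) v.2).1) (hroot _ (hmem s hs v.1) v.2).1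
      have h3 := (uniqueDiffOn_Icc (zero_lt_one' ℝ) s hs).eq_deriv _ h1.hasDerivWithinAt h2
      simpa only [hb, hY'q] using h3
    · intro s hs v
      simp only [hb, hY'q]
      exact (hroot _ (hmem s hs v.1) v.2).2.2
    · intro G hG'
      simpa [h0] using hG G hG'

end Good

/-! ### Definability of the immersions -/

section Definability

variable {ι : Type*} [Finite ι] {β : Type} [Fintype β] [DecidableEq β] {k n ℓ d : ℕ} {α : Type v}

theorem DFun.move (τ : Fin d → β) {y : (ι → ℝ) → β → ℝ} {w : (ι → ℝ) → Fin d → ℝ}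
    (hy : ∀ a, DFun fun v => y v a) (hw : ∀ i, DFun fun v => w v i) (a : β) :
    DFun fun v => move τ (y v) (w v) a := by
  refine (hy a).add (DFun.sum _ fun i => ?_)
  split_ifs
  · exact hw i
  · exact DFun.zero

theorem DFun.unknownPt {y : (ι → ℝ) → β → ℝ} {t : (ι → ℝ) → ℝ} {c : (ι → ℝ) → Fin ℓ → ℝ}
    (hy : ∀ a, DFun fun v => y v a) (ht : DFun t) (hc : ∀ j, DFun fun v => c v j)
    (s : Option β ⊕ Fin ℓ) : DFun fun v => unknownPt (y v) (t v) (c v) s := by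
  rcases s with (_ | a) | j
  · exact ht
  · exact hy a
  · exact hc j

theorem Dfn.rootAt (F : Fin n → MvPolynomial (Option β ⊕ Fin ℓ) ℚ) {c : (ι → ℝ) → Fin ℓ → ℝ}
    {x₀ x : (ι → ℝ) → Fin n → ℝ} {y : (ι → ℝ) → β → ℝ} (hc : ∀ j, DFun fun v => c v j)
    (hx₀ : ∀ u, DFun fun v => x₀ v u) (hy : ∀ a, DFun fun v => y v a)
    (hx : ∀ u, DFun fun v => x v u) : Dfn fun v => RootAt F (c v) (x₀ v) (y v) (x v) := by
  refine Dfn.forall_finite fun u => Dfn.and ?_ (Dfn.all ?_)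
  · exact (DFun.aeval (F u) (DFun.unknownPt hy (hx u) hc)).eq DFun.zero
  · refine Dfn.imp ?_ ?_
    · exact (DFun.aeval (F u) (DFun.unknownPt (fun a => (hy a).reindex some) (DFun.var none)
        fun j => (hc j).reindex some)).eq DFun.zero
    · exact (((hx u).reindex some).sub ((hx₀ u).reindex some)).abs.le
        ((DFun.var none).sub ((hx₀ u).reindex some)).abs

theorem Dfn.good (p : MvPolynomial ((Fin k × Fin n) ⊕ Fin ℓ) ℚ) (x : Fin k → Fin d → α)
    (F : Fin n → MvPolynomial (Option β ⊕ Fin ℓ) ℚ) (τ : Fin d → β) {c : (ι → ℝ) → Fin ℓ → ℝ}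
    {x₀ : (ι → ℝ) → Fin n → ℝ} {y : (ι → ℝ) → β → ℝ} {ε : (ι → ℝ) → ℝ}
    (hc : ∀ j, DFun fun v => c v j) (hy : ∀ a, DFun fun v => y v a)
    (hx₀ : ∀ u, DFun fun v => x₀ v u) (hε : DFun ε) :
    Dfn fun v => Good p x F τ (c v) (y v) (x₀ v) (ε v) := by
  refine (DFun.zero.lt hε).and (Dfn.and ?_ (Dfn.and ?_ (Dfn.and ?_ ?_)))
  · refine Dfn.all_fun (κ := Fin d) (Dfn.imp ?_ (Dfn.ex_fun (κ := Fin n) ?_))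
    · exact Dfn.forall_finite fun i => (DFun.var (Sum.inr i)).abs.lt (hε.reindex Sum.inl)
    · exact Dfn.rootAt F (fun j => (hc j).reindex (Sum.inl ∘ Sum.inl))
        (fun j => (hx₀ j).reindex (Sum.inl ∘ Sum.inl))
        (DFun.move τ (fun j => (hy j).reindex (Sum.inl ∘ Sum.inl))
          fun i => DFun.var (Sum.inl (Sum.inr i))) fun u => DFun.var (Sum.inr u)
  · refine Dfn.all_fun (κ := Fin d) (Dfn.imp ?_ (Dfn.all_fun (κ := Fin n)
      (Dfn.all_fun (κ := Fin n) (Dfn.imp ?_ (Dfn.imp ?_ ?_)))))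
    · exact Dfn.forall_finite fun i => (DFun.var (Sum.inr i)).abs.lt (hε.reindex Sum.inl)
    · exact Dfn.rootAt F (fun j => (hc j).reindex (Sum.inl ∘ Sum.inl ∘ Sum.inl))
        (fun j => (hx₀ j).reindex (Sum.inl ∘ Sum.inl ∘ Sum.inl))
        (DFun.move τ (fun j => (hy j).reindex (Sum.inl ∘ Sum.inl ∘ Sum.inl))
          fun i => DFun.var (Sum.inl (Sum.inl (Sum.inr i)))) fun u => DFun.var (Sum.inl (Sum.inr u))
    · exact Dfn.rootAt F (fun j => (hc j).reindex (Sum.inl ∘ Sum.inl ∘ Sum.inl))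
        (fun j => (hx₀ j).reindex (Sum.inl ∘ Sum.inl ∘ Sum.inl))
        (DFun.move τ (fun j => (hy j).reindex (Sum.inl ∘ Sum.inl ∘ Sum.inl))
          fun i => DFun.var (Sum.inl (Sum.inl (Sum.inr i)))) fun u => DFun.var (Sum.inr u)
    · refine (Dfn.forall_finite fun u : Fin n => (DFun.var (Sum.inl (Sum.inr u))).eq
        (DFun.var (Sum.inr u))).congr fun v => funext_iff
  · refine Dfn.forall_finite fun i => Dfn.all_fun (κ := Fin d) (Dfn.imp ?_
      (Dfn.all_fun (κ := Fin d) (Dfn.imp ?_ (Dfn.imp ?_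
      (Dfn.all_fun (κ := Fin n) (Dfn.imp ?_ (Dfn.imp ?_ ?_)))))))
    · exact Dfn.forall_finite fun i => (DFun.var (Sum.inr i)).abs.lt (hε.reindex Sum.inl)
    · exact Dfn.forall_finite fun i => (DFun.var (Sum.inr i)).abs.lt
        (hε.reindex (Sum.inl ∘ Sum.inl))
    · exact Dfn.forall_finite fun j => Dfn.imp (Dfn.const _)
        ((DFun.var (Sum.inl (Sum.inr j))).eq (DFun.var (Sum.inr j)))
    · exact Dfn.rootAt F (fun j => (hc j).reindex (Sum.inl ∘ Sum.inl ∘ Sum.inl))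
        (fun j => (hx₀ j).reindex (Sum.inl ∘ Sum.inl ∘ Sum.inl))
        (DFun.move τ (fun j => (hy j).reindex (Sum.inl ∘ Sum.inl ∘ Sum.inl))
          fun i => DFun.var (Sum.inl (Sum.inl (Sum.inr i)))) fun u => DFun.var (Sum.inr u)
    · exact Dfn.rootAt F (fun j => (hc j).reindex (Sum.inl ∘ Sum.inl ∘ Sum.inl))
        (fun j => (hx₀ j).reindex (Sum.inl ∘ Sum.inl ∘ Sum.inl))
        (DFun.move τ (fun j => (hy j).reindex (Sum.inl ∘ Sum.inl ∘ Sum.inl))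
          fun i => DFun.var (Sum.inl (Sum.inr i))) fun u => DFun.var (Sum.inr u)
    · exact (DFun.var (Sum.inl (Sum.inl (Sum.inr i)))).eq (DFun.var (Sum.inl (Sum.inr i)))
  · refine Dfn.all_fun (κ := Fin k × Fin d) (Dfn.imp ?_ (Dfn.imp ?_
      (Dfn.all_fun (κ := Fin k × Fin n) (Dfn.imp ?_ ?_))))
    · exact Dfn.forall_finite fun i => (DFun.var (Sum.inr i)).abs.lt (hε.reindex Sum.inl)
    · exact Dfn.forall_finite fun l => Dfn.forall_finite fun l' => Dfn.forall_finite fun i =>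
        Dfn.imp (Dfn.const _) ((DFun.var (Sum.inr (l, i))).eq (DFun.var (Sum.inr (l', i))))
    · exact Dfn.forall_finite fun l => Dfn.rootAt F
        (fun j => (hc j).reindex (Sum.inl ∘ Sum.inl))
        (fun j => (hx₀ j).reindex (Sum.inl ∘ Sum.inl))
        (DFun.move τ (fun j => (hy j).reindex (Sum.inl ∘ Sum.inl))
          fun i => DFun.var (Sum.inl (Sum.inr (l, i)))) fun u => DFun.var (Sum.inr (l, u))
    · refine (DFun.aeval p (T := fun w : (ι ⊕ Fin k × Fin d) ⊕ Fin k × Fin n → ℝ =>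
        Sum.elim (fun v => w (Sum.inr v)) (c fun i => w (.inl (.inl i)))) ?_).eq DFun.zero
      rintro (v | j)
      · exact DFun.var (Sum.inr v)
      · exact (hc j).reindex (Sum.inl ∘ Sum.inl)

end Definability

theorem DFun.prod {ι A : Type*} [Finite ι] (s : Finset A) {f : A → (ι → ℝ) → ℝ}
    (h : ∀ a, DFun (f a)) : DFun (fun v => ∏ a ∈ s, f a v) := by
  classical
  induction s using Finset.induction_on with
  | empty => simpa using DFun.one
  | insert a s ha ih => exact ((h a).mul ih).congr fun v => Finset.prod_insert ha

section Scheme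

/-- A bijection of the real line with the interval `(-1, 1)`. -/
noncomputable def squeeze (r : ℝ) : ℝ := r * (1 + |r|)⁻¹

theorem abs_squeeze_lt (r : ℝ) : |squeeze r| < 1 := by
  have : 0 < 1 + |r| := by positivity
  rw [squeeze, ← div_eq_mul_inv, abs_div, abs_of_pos this, div_lt_one this]
  linarith

theorem squeeze_injective : Function.Injective squeeze := by
  intro r s h
  have hr : 0 < 1 + |r| := by positivity
  have hs : 0 < 1 + |s| := by positivity
  rw [squeeze, squeeze, ← div_eq_mul_inv, ← div_eq_mul_inv, div_eq_div_iff hr.ne' hs.ne'] at h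
  rcases abs_cases r with ⟨h1, h1'⟩ | ⟨h1, h1'⟩ <;> rcases abs_cases s with ⟨h2, h2'⟩ | ⟨h2, h2'⟩ <;>
    rw [h1, h2] at h <;> nlinarith

variable {α : Type v} {k n ℓ d : ℕ} {p : MvPolynomial ((Fin k × Fin n) ⊕ Fin ℓ) ℚ}

theorem isImmersion_of_pattern {P : Finset (Fin d → α)} {x : Fin k → Fin d → α}
    (hx : ∀ y, y ∈ P ↔ ∃ l, x l = y) {c : Fin ℓ → ℝ} {f : (Fin d → ℝ) → (Fin n → ℝ)}
    (hf : OneToOneEachCoord f)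
    (hp : ∀ z : Fin k → Fin d → ℝ, (∀ l l' i, x l i = x l' i → z l i = z l' i) →
      MvPolynomial.aeval (Sum.elim (fun v : Fin k × Fin n => f (z v.1) v.2) c) p = 0) :
    IsImmersion k (collapseT id P) (zeroEdgesParam k n ℓ p c) f := by
  classical
  refine ⟨hf, ?_⟩
  rintro Q ⟨hcard, g, hg1, hg2, hg3⟩ hinj
  have hmem : ∀ y, y ∈ collapseT id P ↔ ∃ l, piCollapse id (x l) = y := by
    intro y
    simp only [collapseT, Finset.mem_image, hx]
    exact ⟨fun ⟨_, ⟨l, rfl⟩, h⟩ => ⟨l, h⟩, fun ⟨l, h⟩ => ⟨_, ⟨l, rfl⟩, h⟩⟩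
  set z : Fin k → Fin d → ℝ := fun l => g (piCollapse id (x l)) with hz
  have hzQ : Finset.univ.image z = Q := by
    ext y
    simp only [Finset.mem_image, Finset.mem_univ, true_and]
    constructor
    · rintro ⟨l, rfl⟩
      exact hg1 _ ((hmem _).2 ⟨l, rfl⟩)
    · intro hy
      obtain ⟨w, hw, rfl⟩ := hg2 y hy
      obtain ⟨l, rfl⟩ := (hmem w).1 hw
      exact ⟨l, rfl⟩
  have hzinj : Function.Injective z := by
    have : Set.InjOn z (Finset.univ : Finset (Fin k)) :=
      Finset.card_image_iff.1 (by rw [hzQ, hcard, Finset.card_univ, Fintype.card_fin])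
    simpa [Set.injOn_univ] using this
  have hzmem : ∀ l, z l ∈ (Q : Set (Fin d → ℝ)) := fun l =>
    hg1 _ ((hmem _).2 ⟨l, rfl⟩)
  refine ⟨fun l => f (z l), fun l l' h => hzinj (hinj (hzmem l) (hzmem l') h), ?_, hp z ?_⟩
  · ext y
    simp only [fimg, Finset.mem_image, ← hzQ, Finset.mem_univ, true_and, exists_exists_eq_and]
  · intro l l' i h
    refine hg3 _ ((hmem _).2 ⟨l, rfl⟩) _ ((hmem _).2 ⟨l', rfl⟩) i (funext fun j => ?_)
    simp only [piCollapse, id]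
    split_ifs with hj
    · rw [hj, h]
    · rfl

variable {β Θ : Type} [Fintype β] [DecidableEq β] [Fintype Θ] [DecidableEq Θ]

theorem exists_soundSet_of_pattern {P : Finset (Fin d → α)} {x : Fin k → Fin d → α}
    (hx : ∀ y, y ∈ P ↔ ∃ l, x l = y)
    {F : Fin n → MvPolynomial (Option β ⊕ Fin ℓ) ℚ} {τ : Fin d → β} {ω : Fin d → Fin n}
    {q : β → Fin k → Θ} {b : Θ → β} (hb : ∀ a l, b (q a l) = a)
    (hq : ∀ a l l', q a l = q a l' → ∀ i, τ i = a → x l i = x l' i)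
    (J : Ideal (MvPolynomial ((Θ ⊕ Fin k × Fin n) ⊕ Fin ℓ) ℚ))
    (hJ : ∀ θ, ∀ G ∈ J, prolong F q θ G ∈ J) (hp : MvPolynomial.rename (Sum.map Sum.inr id) p ∈ J) :
    ∃ Gs : Finset (MvPolynomial ((Θ ⊕ Fin k × Fin n) ⊕ Fin ℓ) ℚ), (∀ G ∈ Gs, G ∈ J) ∧
      ∃ γ : SoundSet k n ℓ d p P, ∀ (c : Fin ℓ → ℝ) (y₀ : β → ℝ) (x₀ : Fin n → ℝ),
        (∀ u, MvPolynomial.aeval (unknownPt y₀ (x₀ u) c) (F u) = 0) →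
        (∀ u, MvPolynomial.aeval (unknownPt y₀ (x₀ u) c)
          (MvPolynomial.pderiv (.inl none) (F u)) ≠ 0) →
        (∀ i, MvPolynomial.aeval (unknownPt y₀ (x₀ (ω i)) c)
          (MvPolynomial.pderiv (.inl (some (τ i))) (F (ω i))) ≠ 0) →
        (∀ G ∈ Gs, MvPolynomial.aeval
          (blockPt (fun θ => y₀ (b θ)) (fun v : Fin k × Fin n => x₀ v.2) c) G = 0) → γ.1 c := by
  obtain ⟨Gs, rfl⟩ : ∃ Gs : Finset (MvPolynomial ((Θ ⊕ Fin k × Fin n) ⊕ Fin ℓ) ℚ),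
      Ideal.span (Gs : Set (MvPolynomial ((Θ ⊕ Fin k × Fin n) ⊕ Fin ℓ) ℚ)) = J :=
    (isNoetherianRing_iff_ideal_fg _).1 inferInstance J
  set N : (Fin ℓ → ℝ) → ((β ⊕ Fin n) ⊕ Unit → ℝ) → ℝ := fun c θ =>
    (∏ u, MvPolynomial.aeval (unknownPt (fun a => θ (.inl (.inl a))) (θ (.inl (.inr u))) c)
      (MvPolynomial.pderiv (.inl none) (F u))) *
    (∏ i, MvPolynomial.aeval (unknownPt (fun a => θ (.inl (.inl a))) (θ (.inl (.inr (ω i)))) c)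
      (MvPolynomial.pderiv (.inl (some (τ i))) (F (ω i)))) with hN
  set X : (Fin ℓ → ℝ) → ((β ⊕ Fin n) ⊕ Unit → ℝ) → Prop := fun c θ =>
    (∀ u, MvPolynomial.aeval (unknownPt (fun a => θ (.inl (.inl a))) (θ (.inl (.inr u))) c)
      (F u) = 0) ∧
    (∀ G : Gs, MvPolynomial.aeval (blockPt (fun t => θ (.inl (.inl (b t))))
      (fun v : Fin k × Fin n => θ (.inl (.inr v.2))) c) G.1 = 0) ∧
    θ (.inr ()) * N c θ = 1 with hX
  have hXD : Dfn (fun w : Fin ℓ ⊕ ((β ⊕ Fin n) ⊕ Unit) → ℝ =>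
      X (fun i => w (.inl i)) (fun j => w (.inr j))) := by
    have hU : ∀ (u : Fin n) f, DFun fun w : Fin ℓ ⊕ ((β ⊕ Fin n) ⊕ Unit) → ℝ =>
        MvPolynomial.aeval (unknownPt (fun a => w (.inr (.inl (.inl a))))
          (w (.inr (.inl (.inr u)))) fun i => w (.inl i)) f := fun u f =>
      DFun.aeval f (DFun.unknownPt (fun j => DFun.var _) (DFun.var _) fun j => DFun.var _)
    refine Dfn.and (Dfn.forall_finite fun u => (hU u _).eq DFun.zero)
      (Dfn.and (Dfn.forall_finite fun G => (DFun.aeval G.1 ?_).eq DFun.zero)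
        (((DFun.var _).mul ((DFun.prod _ fun u => hU u _).mul
          (DFun.prod _ fun i => hU _ _))).eq DFun.one))
    rintro ((t | v) | j) <;> exact DFun.var _
  have hXcl : ∀ v, IsClosed {θ | X v θ} := by
    intro c
    have hU : ∀ (u : Fin n) f, Continuous fun θ : (β ⊕ Fin n) ⊕ Unit → ℝ =>
        MvPolynomial.aeval (unknownPt (fun a => θ (.inl (.inl a))) (θ (.inl (.inr u))) c) f :=
      fun u f => (contDiff_aeval f (n := 0)).continuous.comp ((continuous_unknownPt c).comp
        (f := fun θ : (β ⊕ Fin n) ⊕ Unit → ℝ => (fun a => θ (.inl (.inl a)), θ (.inl (.inr u))))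
        ((continuous_pi fun a => continuous_apply _).prodMk (continuous_apply _)))
    have hB : ∀ f : MvPolynomial ((Θ ⊕ Fin k × Fin n) ⊕ Fin ℓ) ℚ, Continuous fun θ : (β ⊕ Fin n) ⊕ Unit → ℝ =>
        MvPolynomial.aeval (blockPt (fun t : Θ => θ (.inl (.inl (b t))))
          (fun v : Fin k × Fin n => θ (.inl (.inr v.2))) c) f := by
      refine fun f => (contDiff_aeval f (n := 0)).continuous.comp (continuous_pi ?_)
      rintro ((t | v) | j)
      · exact continuous_apply _
      · exact continuous_apply _
      · exact continuous_const
    refine IsClosed.inter (s₁ := {θ | _}) (s₂ := {θ | _ ∧ _}) ?_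
      (IsClosed.inter (s₁ := {θ | _}) (s₂ := {θ | _}) ?_ ?_)
    · simp only [Set.ofPred_forall]
      exact isClosed_iInter fun u => isClosed_eq (hU u _) continuous_const
    · simp only [Set.ofPred_forall]
      exact isClosed_iInter fun G => isClosed_eq (hB _) continuous_const
    · exact isClosed_eq ((continuous_apply _).mul ((continuous_finsetProd _ fun u _ => hU u _).mul
        (continuous_finsetProd _ fun i _ => hU _ _))) continuous_const
  have hXG : ∀ c θ, X c θ → ∃ ε, Good p x F τ c (fun a => θ (.inl (.inl a)))
      (fun u => θ (.inl (.inr u))) ε := by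
    intro c θ ⟨h1, h2, h3⟩
    have h4 : N c θ ≠ 0 := right_ne_zero_of_mul (h3.trans_ne one_ne_zero)
    refine exists_good hb hq Gs (fun θ G hG => hJ θ G (Ideal.subset_span hG)) hp h1
      (ω := ω) (fun u => ?_) (fun i => ?_) fun G hG => h2 ⟨G, hG⟩
    · exact Finset.prod_ne_zero_iff.1 (left_ne_zero_of_mul h4) u (Finset.mem_univ _)
    · exact Finset.prod_ne_zero_iff.1 (right_ne_zero_of_mul h4) i (Finset.mem_univ _)
  obtain ⟨φ, hφ, hφX⟩ := exists_dfn_uniform hXD hXcl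
    (G := fun c θ ε => Good p x F τ c (fun a => θ (.inl (.inl a))) (fun u => θ (.inl (.inr u))) ε)
    (Dfn.good p x F τ (fun j => DFun.var _) (fun j => DFun.var _) (fun j => DFun.var _)
      (DFun.var _))
    (fun v θ ε h => h.1) (fun v θ ε ε' h h0 hε => h.anti h0 hε) hXG
    (R := fun c θ ε w => RootAt F c (fun u => θ (.inl (.inr u)))
      (move τ (fun a => θ (.inl (.inl a))) fun i => ε * squeeze (w (.inl i)))
      fun u => w (.inr u)) (η := Fin d ⊕ Fin n)
    (by
      refine Dfn.rootAt F (fun j => DFun.var _) (fun j => DFun.var _)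
        (DFun.move τ (fun j => DFun.var _) fun i => (DFun.var _).mul ?_) (fun j => DFun.var _)
      exact (DFun.var _).mul (DFun.one.add (DFun.var _).abs).inv)
  refine ⟨Gs, fun G hG => Ideal.subset_span hG,
    ⟨fun c => ∃ θ, X c θ, φ, Dfn.ex_fun hXD, hφ, fun c hc => ?_⟩, fun c y₀ x₀ h1 h2 h3 h4 => ?_⟩
  · obtain ⟨θ, ε, hG, hR⟩ := hφX c hc
    have hw : ∀ (z : Fin d → ℝ) i, |ε * squeeze (z i)| < ε := by
      intro z i
      rw [abs_mul, abs_of_pos hG.1]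
      exact mul_lt_of_lt_one_right hG.1 (abs_squeeze_lt _)
    choose f hf using fun z : Fin d → ℝ => hG.2.1 _ (hw z)
    refine ⟨f, fun z w => ?_, isImmersion_of_pattern hx ?_ fun z hz => ?_⟩
    · rw [hR]
      exact ⟨fun h => hG.2.2.1 _ (hw z) _ _ (hf z) h, fun h => h ▸ hf z⟩
    · rintro z z' ⟨i, hi, hne⟩ h
      refine hi (squeeze_injective (mul_left_cancel₀ hG.1.ne' ?_))
      refine hG.2.2.2.1 i _ (hw z) _ (hw z') (fun j hj => ?_) _ (hf z) (h ▸ hf z')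
      simp only [hne j hj]
    · refine hG.2.2.2.2 (fun v => ε * squeeze (z v.1 v.2)) (fun v => hw _ _) ?_ _ fun l => hf (z l)
      intro l l' i h
      simp only [hz l l' i h]
  · refine ⟨Sum.elim (Sum.elim y₀ x₀) fun _ => (N c (Sum.elim (Sum.elim y₀ x₀) 0))⁻¹, h1,
      fun G => h4 G.1 G.2, inv_mul_cancel₀ ?_⟩
    exact mul_ne_zero (Finset.prod_ne_zero_iff.2 fun u _ => h2 u)
      (Finset.prod_ne_zero_iff.2 fun i _ => h3 i)

end Scheme

/-! ### Indiscernible ultrafilters -/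

section Generic

variable {T σ σ' : Type*}

/-- The ultrafilter describing values of the symbols of the list `l` chosen generically one after
the other, followed by a generic choice of an element of `T`. -/
noncomputable def genU [DecidableEq σ] (U : Ultrafilter T) :
    List σ → Ultrafilter (T × (σ → ℕ))
  | [] => U.map fun t => (t, 0)
  | s :: l => (Filter.hyperfilter ℕ).bind fun a =>
      (genU U l).map fun r => (r.1, Function.update r.2 s a)

/-- Membership in `A` depends only on the values of the symbols in `S`. -/
def SuppOn (S : Set σ) (A : Set (T × (σ → ℕ))) : Prop :=
  ∀ t v v', (∀ s ∈ S, v s = v' s) → ((t, v) ∈ A ↔ (t, v') ∈ A)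

variable [DecidableEq σ] [DecidableEq σ'] {U : Ultrafilter T}

theorem mem_genU_nil {A : Set (T × (σ → ℕ))} : A ∈ genU U ([] : List σ) ↔ ∀ᶠ t in U, (t, 0) ∈ A :=
  Iff.rfl

theorem mem_genU_cons {A : Set (T × (σ → ℕ))} {s : σ} {l : List σ} :
    A ∈ genU U (s :: l) ↔ ∀ᶠ a in (Filter.hyperfilter ℕ : Filter ℕ),
      {r : T × (σ → ℕ) | (r.1, Function.update r.2 s a) ∈ A} ∈ genU U l :=
  Iff.rfl

theorem SuppOn.update {A : Set (T × (σ → ℕ))} {s : σ} {l : List σ}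
    (hA : SuppOn {s' | s' ∈ s :: l} A) (a : ℕ) :
    SuppOn {s' | s' ∈ l} {r : T × (σ → ℕ) | (r.1, Function.update r.2 s a) ∈ A} := by
  intro t v v' h
  refine hA _ _ _ fun s' hs' => ?_
  by_cases hss : s' = s
  · simp [hss]
  · simpa [hss] using h s' ((List.mem_cons.1 hs').resolve_left hss)

theorem mem_genU_of_sublist {l' l : List σ} (h : l'.Sublist l) (hl : l.Nodup)
    {A : Set (T × (σ → ℕ))} (hA : SuppOn {s | s ∈ l'} A) : A ∈ genU U l ↔ A ∈ genU U l' := by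
  induction h generalizing A with
  | slnil => rfl
  | cons s h ih =>
    rw [← ih (List.nodup_cons.1 hl).2 hA, mem_genU_cons]
    have : ∀ a, {r : T × (σ → ℕ) | (r.1, Function.update r.2 s a) ∈ A} = A := by
      intro a
      ext ⟨t, v⟩
      refine hA _ _ _ fun s' hs' => Function.update_of_ne ?_ _ _
      rintro rfl
      exact (List.nodup_cons.1 hl).1 (h.subset hs')
    simp only [this, Filter.eventually_const]
  | cons_cons s h ih =>
    rw [mem_genU_cons, mem_genU_cons]
    exact Filter.eventually_congr (Filter.Eventually.of_forall fun a =>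
      ih (List.nodup_cons.1 hl).2 (hA.update a))

theorem mem_genU_map {l : List σ} {φ : σ → σ'} (hl : (l.map φ).Nodup) {A : Set (T × (σ → ℕ))}
    (hA : SuppOn {s | s ∈ l} A) :
    {r : T × (σ' → ℕ) | (r.1, r.2 ∘ φ) ∈ A} ∈ genU U (l.map φ) ↔ A ∈ genU U l := by
  induction l generalizing A with
  | nil => rfl
  | cons s l ih =>
    rw [List.map_cons, List.nodup_cons] at hl
    rw [List.map_cons, mem_genU_cons, mem_genU_cons]
    refine Filter.eventually_congr (Filter.Eventually.of_forall fun a => ?_)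
    rw [← ih hl.2 (hA.update a)]
    refine iff_of_eq (congrArg (· ∈ genU U (l.map φ)) ?_)
    ext ⟨t, v⟩
    refine hA _ _ _ fun s' hs' => ?_
    rcases List.mem_cons.1 hs' with rfl | hs'
    · simp
    · have h1 : φ s' ≠ φ s := fun h => hl.1 (h ▸ List.mem_map_of_mem hs')
      have h2 : s' ≠ s := fun h => h1 (h ▸ rfl)
      simp [h1, h2]

theorem eventually_fst_genU {Q : T → Prop} (hQ : ∀ᶠ t in U, Q t) (l : List σ) :
    {r : T × (σ → ℕ) | Q r.1} ∈ genU U l := by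
  induction l with
  | nil => exact hQ
  | cons s l ih => exact mem_genU_cons.2 (Filter.Eventually.of_forall fun a => ih)

variable [LinearOrder σ]

/-- The ultrafilter describing generic values of all symbols. -/
noncomputable def genV (σ : Type*) [LinearOrder σ] (U : Ultrafilter T) :
    Ultrafilter (T × (σ → ℕ)) :=
  (Ultrafilter.of (Filter.atTop : Filter (Finset σ))).bind fun S => genU U (S.sort (· ≤ ·))

end Generic

section GenericV

variable {T σ : Type*} [LinearOrder σ] {U : Ultrafilter T}

theorem mem_genV {S : Finset σ} {A : Set (T × (σ → ℕ))} (hA : SuppOn (S : Set σ) A) :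
    A ∈ genV σ U ↔ A ∈ genU U (S.sort (· ≤ ·)) := by
  have h : ∀ᶠ S' in (Ultrafilter.of (Filter.atTop : Filter (Finset σ)) : Filter (Finset σ)),
      (A ∈ genU U (S'.sort (· ≤ ·)) ↔ A ∈ genU U (S.sort (· ≤ ·))) := by
    filter_upwards [Ultrafilter.of_le _ (Filter.eventually_ge_atTop S)] with S' hS'
    refine mem_genU_of_sublist ?_ (Finset.sort_nodup _ _) (by simpa using hA)
    refine List.sublist_of_subperm_of_pairwise (r := (· ≤ ·)) ?_ (Finset.pairwise_sort _ _)
      (Finset.pairwise_sort _ _)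
    exact (Finset.sort_nodup _ _).subperm fun s hs => by
      rw [Finset.mem_sort] at hs ⊢
      exact hS' hs
  refine Iff.trans (b := ∀ᶠ S' in (Ultrafilter.of (Filter.atTop : Filter (Finset σ)) :
    Filter (Finset σ)), A ∈ genU U (S'.sort (· ≤ ·))) Iff.rfl ?_
  rw [Filter.eventually_congr h, Filter.eventually_const]

theorem mem_genV_comp {S : Finset σ} {A : Set (T × (σ → ℕ))} (hA : SuppOn (S : Set σ) A)
    {φ : σ → σ} (hφ : StrictMonoOn φ (S : Set σ)) :
    {r : T × (σ → ℕ) | (r.1, r.2 ∘ φ) ∈ A} ∈ genV σ U ↔ A ∈ genV σ U := by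
  have hs : (S.image φ).sort (· ≤ ·) = (S.sort (· ≤ ·)).map φ := by
    refine List.Perm.eq_of_pairwise' (r := (· ≤ ·)) (Finset.pairwise_sort _ _) ?_ ?_
    · rw [List.pairwise_map]
      exact (Finset.pairwise_sort S _).imp_of_mem fun {a b} ha hb hab =>
        hφ.monotoneOn (by simpa using ha) (by simpa using hb) hab
    · refine (List.perm_ext_iff_of_nodup (Finset.sort_nodup _ _) ?_).2 fun s => by simp
      exact (List.nodup_map_iff_inj_on (Finset.sort_nodup _ _)).2 fun a ha b hb hab =>
        hφ.injOn (by simpa using ha) (by simpa using hb) hab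
  rw [mem_genV hA, mem_genV (S := S.image φ), hs, mem_genU_map]
  · rw [← hs]
    exact Finset.sort_nodup _ _
  · simpa using hA
  · intro t v v' h
    exact hA _ _ _ fun s hs => h _ (by simpa using ⟨s, hs, rfl⟩)

theorem eventually_genV_lt {s s' : σ} (h : s < s') :
    ∀ᶠ r : T × (σ → ℕ) in (genV σ U : Filter (T × (σ → ℕ))), r.2 s < r.2 s' := by
  have h1 : SuppOn (({s, s'} : Finset σ) : Set σ) {r : T × (σ → ℕ) | r.2 s < r.2 s'} := by
    intro t v v' h
    simp [h s (by simp), h s' (by simp)]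
  refine (mem_genV h1).2 ?_
  have h2 : ({s, s'} : Finset σ).sort (· ≤ ·) = [s, s'] := by
    rw [Finset.sort_insert _ (by simpa using h.le) (by simpa using h.ne), Finset.sort_singleton]
  rw [h2, mem_genU_cons]
  refine Filter.Eventually.of_forall fun a => mem_genU_cons.2 ?_
  have h3 : ∀ᶠ b in (Filter.hyperfilter ℕ : Filter ℕ), a < b :=
    Filter.hyperfilter_le_cofinite (Nat.cofinite_eq_atTop ▸ Filter.eventually_gt_atTop a)
  filter_upwards [h3] with b hb
  exact mem_genU_nil.2 (Filter.Eventually.of_forall fun t => by simpa [h.ne, h.ne'] using hb)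

theorem eventually_genV_fst {Q : T → ℕ → Prop} (hQ : ∀ a, ∀ᶠ t in U, Q t a) (s : σ) :
    ∀ᶠ r : T × (σ → ℕ) in (genV σ U : Filter (T × (σ → ℕ))), Q r.1 (r.2 s) := by
  have h1 : SuppOn (({s} : Finset σ) : Set σ) {r : T × (σ → ℕ) | Q r.1 (r.2 s)} := by
    intro t v v' h
    simp [h s (by simp)]
  refine (mem_genV h1).2 ?_
  rw [Finset.sort_singleton, mem_genU_cons]
  refine Filter.Eventually.of_forall fun a => mem_genU_nil.2 ?_
  filter_upwards [hQ a] with t ht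
  simpa using ht

theorem eventually_genV_of {Q : T → Prop} (hQ : ∀ᶠ t in U, Q t) :
    ∀ᶠ r : T × (σ → ℕ) in (genV σ U : Filter (T × (σ → ℕ))), Q r.1 := by
  have h1 : SuppOn ((∅ : Finset σ) : Set σ) {r : T × (σ → ℕ) | Q r.1} := fun t v v' h => Iff.rfl
  exact (mem_genV h1).2 (eventually_fst_genU hQ _)

end GenericV

/-! ### Generic arrays -/

/-- An array indexed by `ℚ^d` of points that is indiscernible and sends copies of `P` to zeros
of `p`. -/
structure GenericArray {K : Type*} [Field K] [Algebra ℚ K] {α : Type v} {k n ℓ d : ℕ}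
    (p : MvPolynomial ((Fin k × Fin n) ⊕ Fin ℓ) ℚ) (P : Finset (Fin d → α))
    (ξ : (Fin d → ℚ) → Fin n → K) (c : Fin ℓ → K) : Prop where
  indisc : ∀ {W : Type} [Finite W] (e e' : W → Fin d → ℚ) (u : W → Fin n),
    (∀ w w' i, e w i < e w' i ↔ e' w i < e' w' i) → ∀ F : MvPolynomial (W ⊕ Fin ℓ) ℚ,
    MvPolynomial.aeval (Sum.elim (fun w => ξ (e w) (u w)) c) F = 0 →
    MvPolynomial.aeval (Sum.elim (fun w => ξ (e' w) (u w)) c) F = 0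
  inj : Function.Injective ξ
  edge : ∀ (x : Fin k → Fin d → α) (S : Fin k → Fin d → ℚ), Function.Injective x →
    (∀ y, y ∈ P ↔ ∃ l, x l = y) → (∀ l l' i, S l i = S l' i ↔ x l i = x l' i) →
    ∃ ρ : Equiv.Perm (Fin k),
      MvPolynomial.aeval (Sum.elim (fun v : Fin k × Fin n => ξ (S (ρ v.1)) v.2) c) p = 0

section Los

variable {I : Type*} {V : Ultrafilter I}

theorem aeval_germ {τ : Type*} (f : τ → I → ℝ) (q : MvPolynomial τ ℚ) :
    MvPolynomial.aeval (fun j => ((f j : I → ℝ) : (V : Filter I).Germ ℝ)) q =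
      ((fun r => MvPolynomial.aeval (fun j => f j r) q : I → ℝ) : (V : Filter I).Germ ℝ) := by
  induction q using MvPolynomial.induction_on with
  | C a =>
    rw [MvPolynomial.aeval_C, eq_ratCast]
    simp only [MvPolynomial.aeval_C, eq_ratCast]
    exact (map_ratCast ((Filter.Germ.coeRingHom (V : Filter I)).comp
      (Pi.constRingHom I ℝ)) a).symm
  | add p q hp hq => simp only [map_add, hp, hq]; rfl
  | mul_X p j hp => simp only [map_mul, hp, MvPolynomial.aeval_X]; rfl

theorem aeval_germ_eq_zero {τ : Type*} (f : τ → I → ℝ) (q : MvPolynomial τ ℚ) :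
    MvPolynomial.aeval (fun j => ((f j : I → ℝ) : (V : Filter I).Germ ℝ)) q = 0 ↔
      ∀ᶠ r in (V : Filter I), MvPolynomial.aeval (fun j => f j r) q = 0 := by
  rw [aeval_germ]
  exact Filter.Germ.coe_eq

end Los

/-! ### The ultrapower array -/

theorem exists_perm_of_image_eq {k : ℕ} {β : Type*} {a b : Fin k → β}
    (ha : Function.Injective a) (h : ∀ l, ∃ l', b l' = a l) :
    ∃ ρ : Equiv.Perm (Fin k), ∀ l, a l = b (ρ l) := by
  choose ρ hρ using h
  have hinj : Function.Injective ρ := fun l l' hl => ha (by rw [← hρ, ← hρ, hl])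
  exact ⟨Equiv.ofBijective ρ (Finite.injective_iff_bijective.1 hinj), fun l => (hρ l).symm⟩

/-- A zero of `p` along an injective copy of the template. -/
theorem exists_perm_aeval_eq_zero {α : Type v} {k n ℓ d : ℕ}
    {p : MvPolynomial ((Fin k × Fin n) ⊕ Fin ℓ) ℚ} {P : Finset (Fin d → α)} {c : Fin ℓ → ℝ}
    {X : Type*} (hX : Nonempty (Fin d → X)) {g : (Fin d → X) → Fin n → ℝ}
    (hg : IsHGEmbedding (LEdges k P X) (zeroEdgesParam k n ℓ p c) g)
    {x : Fin k → Fin d → α} {y : Fin k → Fin d → X} (hx : Function.Injective x)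
    (hxP : ∀ z, z ∈ P ↔ ∃ l, x l = z) (hy : ∀ l l' i, y l i = y l' i ↔ x l i = x l' i) :
    ∃ ρ : Equiv.Perm (Fin k),
      MvPolynomial.aeval (Sum.elim (fun v : Fin k × Fin n => g (y (ρ v.1)) v.2) c) p = 0 := by
  classical
  have hyinj : Function.Injective y := fun l l' h =>
    hx (funext fun i => (hy l l' i).1 (congrFun h i))
  have hQ : Finset.univ.image y ∈ LEdges k P X := by
    refine ⟨by rw [Finset.card_image_of_injective _ hyinj]; simp, ?_⟩
    by_cases hk : Nonempty (Fin k)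
    · refine ⟨fun z => y (Function.invFun x z), ?_, ?_, ?_⟩
      · intro z hz
        simp
      · intro z hz
        obtain ⟨l, -, rfl⟩ := Finset.mem_image.1 hz
        exact ⟨x l, (hxP _).2 ⟨l, rfl⟩, by simp [Function.leftInverse_invFun hx l]⟩
      · intro z hz z' hz' i h
        obtain ⟨l, rfl⟩ := (hxP _).1 hz
        obtain ⟨l', rfl⟩ := (hxP _).1 hz'
        simpa [Function.leftInverse_invFun hx _, hy] using h
    · refine ⟨fun _ => hX.some, fun z hz => ?_, fun z hz => ?_, fun z hz => ?_⟩
      · exact (hk ⟨((hxP _).1 hz).choose⟩).elim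
      · exact (hk ⟨(Finset.mem_image.1 hz).choose⟩).elim
      · exact (hk ⟨((hxP _).1 hz).choose⟩).elim
  obtain ⟨a, ha, hEq, hz⟩ := hg.2 _ hQ
  have : ∀ l, ∃ l', g (y l') = a l := by
    intro l
    have h1 : a l ∈ fimg a Finset.univ := by simp [fimg]
    rw [hEq] at h1
    simpa [fimg] using h1
  obtain ⟨ρ, hρ⟩ := exists_perm_of_image_eq ha this
  refine ⟨ρ, ?_⟩
  simpa only [hρ] using hz

section Array

variable {T : Type*} {n ℓ d : ℕ} {M : T → ℕ} {k : ℕ} {α : Type v}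

open Classical in
/-- Representative of the point of the ultrapower array with index `e`. -/
noncomputable def arrayRep (g : ∀ t, (Fin d → Fin (M t)) → Fin n → ℝ) (e : Fin d → ℚ)
    (u : Fin n) (r : T × ((Fin d ×ₗ ℚ) → ℕ)) : ℝ :=
  if h : ∀ i, r.2 (toLex (i, e i)) < M r.1 then g r.1 (fun i => ⟨_, h i⟩) u else 0

theorem exists_strictMonoOn_lex {W : Type*} [Finite W] {e e' : W → Fin d → ℚ}
    (h : ∀ w w' i, e w i < e w' i ↔ e' w i < e' w' i) :
    ∃ (S : Finset (Fin d ×ₗ ℚ)) (φ : Fin d ×ₗ ℚ → Fin d ×ₗ ℚ),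
      (∀ w i, toLex (i, e w i) ∈ S) ∧ StrictMonoOn φ S ∧
        ∀ w i, φ (toLex (i, e w i)) = toLex (i, e' w i) := by
  classical
  have := Fintype.ofFinite W
  have heq : ∀ w w' i, e w i = e w' i → e' w i = e' w' i := by
    intro w w' i hw
    apply le_antisymm <;> rw [← not_lt, ← h, hw] <;> exact lt_irrefl _
  let S : Finset (Fin d ×ₗ ℚ) :=
    Finset.univ.image fun a : W × Fin d => toLex (a.2, e a.1 a.2)
  let φ : Fin d ×ₗ ℚ → Fin d ×ₗ ℚ := fun s =>
    if hs : ∃ a : W × Fin d, toLex (a.2, e a.1 a.2) = s then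
      toLex (hs.choose.2, e' hs.choose.1 hs.choose.2) else s
  have hφ : ∀ w i, φ (toLex (i, e w i)) = toLex (i, e' w i) := by
    intro w i
    have hs : ∃ a : W × Fin d, toLex (a.2, e a.1 a.2) = toLex (i, e w i) := ⟨(w, i), rfl⟩
    have h1 := hs.choose_spec
    simp only [φ, dif_pos hs]
    generalize hs.choose = b at h1 ⊢
    obtain ⟨w', i'⟩ := b
    have h2 := Prod.mk.inj (toLex.injective h1)
    obtain rfl : i' = i := h2.1
    exact congrArg (fun z => toLex (i', z)) (heq _ _ _ h2.2)
  refine ⟨S, φ, fun w i => Finset.mem_image.2 ⟨(w, i), Finset.mem_univ _, rfl⟩, ?_, hφ⟩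
  intro s hs s' hs' hlt
  obtain ⟨⟨w, i⟩, -, rfl⟩ := Finset.mem_image.1 (Finset.mem_coe.1 hs)
  obtain ⟨⟨w', i'⟩, -, rfl⟩ := Finset.mem_image.1 (Finset.mem_coe.1 hs')
  rw [hφ, hφ]
  rw [Prod.Lex.toLex_lt_toLex] at hlt ⊢
  rcases hlt with hlt | ⟨heq', hlt⟩
  · exact Or.inl hlt
  · obtain rfl : i = i' := heq'
    exact Or.inr ⟨rfl, (h _ _ _).1 hlt⟩

theorem genericArray_arrayRep {U : Ultrafilter T} (hM : ∀ a, ∀ᶠ t in U, a < M t)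
    {p : MvPolynomial ((Fin k × Fin n) ⊕ Fin ℓ) ℚ} {P : Finset (Fin d → α)} {c : T → Fin ℓ → ℝ}
    {g : ∀ t, (Fin d → Fin (M t)) → Fin n → ℝ}
    (hg : ∀ t, IsHGEmbedding (LEdges k P (Fin (M t))) (zeroEdgesParam k n ℓ p (c t)) (g t)) :
    GenericArray (K := (genV (Fin d ×ₗ ℚ) U : Filter (T × ((Fin d ×ₗ ℚ) → ℕ))).Germ ℝ) p P
      (fun e u => (arrayRep g e u : T × ((Fin d ×ₗ ℚ) → ℕ) → ℝ))
      (fun j => ((fun r => c r.1 j : T × ((Fin d ×ₗ ℚ) → ℕ) → ℝ))) := by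
  have hzero : ∀ {W : Type} (e : W → Fin d → ℚ) (u : W → Fin n) (F : MvPolynomial (W ⊕ Fin ℓ) ℚ),
      MvPolynomial.aeval (Sum.elim
        (fun w => ((arrayRep g (e w) (u w) : T × ((Fin d ×ₗ ℚ) → ℕ) → ℝ) :
          (genV (Fin d ×ₗ ℚ) U : Filter (T × ((Fin d ×ₗ ℚ) → ℕ))).Germ ℝ))
        (fun j => ((fun r => c r.1 j : T × ((Fin d ×ₗ ℚ) → ℕ) → ℝ) :
          (genV (Fin d ×ₗ ℚ) U : Filter (T × ((Fin d ×ₗ ℚ) → ℕ))).Germ ℝ))) F = 0 ↔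
      {r | MvPolynomial.aeval (Sum.elim (fun w => arrayRep g (e w) (u w) r) (c r.1)) F = 0} ∈
        genV (Fin d ×ₗ ℚ) U := by
    intro W e u F
    have h1 := aeval_germ_eq_zero (V := genV (Fin d ×ₗ ℚ) U) (Sum.elim
      (fun w => (arrayRep g (e w) (u w) : T × ((Fin d ×ₗ ℚ) → ℕ) → ℝ))
      (fun j => (fun r => c r.1 j : T × ((Fin d ×ₗ ℚ) → ℕ) → ℝ))) F
    refine Iff.trans (Eq.to_iff ?_) (h1.trans (Eq.to_iff ?_))
    · exact congrArg (fun z => MvPolynomial.aeval z F = 0)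
        (funext fun j => by cases j <;> rfl)
    · change ({r | _} ∈ _) = _
      refine congrArg (· ∈ genV (Fin d ×ₗ ℚ) U) (Set.ext fun r => ?_)
      rw [Set.mem_ofPred_eq, Set.mem_ofPred_eq]
      have : (fun j => Sum.elim (fun w => (arrayRep g (e w) (u w) : T × ((Fin d ×ₗ ℚ) → ℕ) → ℝ))
          (fun j r => c r.1 j) j r) =
          Sum.elim (fun w => arrayRep g (e w) (u w) r) (c r.1) := by
        funext j
        cases j <;> rfl
      rw [this]
  have hbd : ∀ e : Fin d → ℚ, ∀ᶠ r in (genV (Fin d ×ₗ ℚ) U : Filter (T × ((Fin d ×ₗ ℚ) → ℕ))),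
      ∀ i, r.2 (toLex (i, e i)) < M r.1 := fun e =>
    Filter.eventually_all.2 fun i => eventually_genV_fst (Q := fun t a => a < M t) hM _
  have hne : ∀ (e e' : Fin d → ℚ) (i : Fin d), e i ≠ e' i →
      ∀ᶠ r in (genV (Fin d ×ₗ ℚ) U : Filter (T × ((Fin d ×ₗ ℚ) → ℕ))),
        r.2 (toLex (i, e i)) ≠ r.2 (toLex (i, e' i)) := by
    intro e e' i h
    rcases lt_or_gt_of_ne h with h | h
    · filter_upwards [eventually_genV_lt (σ := Fin d ×ₗ ℚ) (s := toLex (i, e i))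
        (s' := toLex (i, e' i)) (Prod.Lex.toLex_lt_toLex.2 (Or.inr ⟨rfl, h⟩))] with r hr
      exact hr.ne
    · filter_upwards [eventually_genV_lt (σ := Fin d ×ₗ ℚ) (s := toLex (i, e' i))
        (s' := toLex (i, e i)) (Prod.Lex.toLex_lt_toLex.2 (Or.inr ⟨rfl, h⟩))] with r hr
      exact hr.ne'
  refine ⟨?_, ?_, ?_⟩
  · intro W _ e e' u h F hF
    rw [hzero] at hF ⊢
    obtain ⟨S, φ, hS, hφ, hφe⟩ := exists_strictMonoOn_lex h
    have hsupp : SuppOn (S : Set (Fin d ×ₗ ℚ))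
        {r | MvPolynomial.aeval (Sum.elim (fun w => arrayRep g (e w) (u w) r) (c r.1)) F = 0} := by
      intro t v v' hv
      have : ∀ w, arrayRep g (e w) (u w) (t, v) = arrayRep g (e w) (u w) (t, v') := by
        intro w
        have h2 : ∀ i, v (toLex (i, e w i)) = v' (toLex (i, e w i)) := fun i => hv _ (hS w i)
        simp only [arrayRep, h2]
      simp only [Set.mem_ofPred_eq, this]
    rw [← mem_genV_comp hsupp hφ] at hF
    refine Filter.mem_of_superset hF fun r hr => ?_
    have : ∀ w, arrayRep g (e w) (u w) (r.1, r.2 ∘ φ) = arrayRep g (e' w) (u w) r := by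
      intro w
      simp only [arrayRep, Function.comp_apply, hφe]
    simpa only [Set.mem_ofPred_eq, this] using hr
  · intro e e' h
    by_contra hee
    obtain ⟨i, hi⟩ := Function.ne_iff.1 hee
    have h1 : ∀ᶠ r in (genV (Fin d ×ₗ ℚ) U : Filter (T × ((Fin d ×ₗ ℚ) → ℕ))),
        ∀ u, arrayRep g e u r = arrayRep g e' u r :=
      Filter.eventually_all.2 fun u => Filter.Germ.coe_eq.1 (congrFun h u)
    have h2 := ((h1.and (hbd e)).and ((hbd e').and (hne e e' i hi))).exists
    obtain ⟨r, ⟨hr1, hr2⟩, hr3, hr4⟩ := h2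
    have h3 := (hg r.1).1 (a₁ := fun i => ⟨_, hr2 i⟩) (a₂ := fun i => ⟨_, hr3 i⟩)
      (funext fun u => by simpa only [arrayRep, dif_pos hr2, dif_pos hr3] using hr1 u)
    exact hr4 (Fin.mk.inj (congrFun h3 i))
  · intro x S hx hxP hS
    have h1 : ∀ᶠ r in (genV (Fin d ×ₗ ℚ) U : Filter (T × ((Fin d ×ₗ ℚ) → ℕ))),
        ∃ ρ : Equiv.Perm (Fin k), MvPolynomial.aeval (Sum.elim
          (fun v : Fin k × Fin n => arrayRep g (S (ρ v.1)) v.2 r) (c r.1)) p = 0 := by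
      have h2 : ∀ᶠ r in (genV (Fin d ×ₗ ℚ) U : Filter (T × ((Fin d ×ₗ ℚ) → ℕ))),
          ∀ l i, r.2 (toLex (i, S l i)) < M r.1 := Filter.eventually_all.2 fun l => hbd (S l)
      have h3 : ∀ᶠ r in (genV (Fin d ×ₗ ℚ) U : Filter (T × ((Fin d ×ₗ ℚ) → ℕ))),
          ∀ l l' i, S l i ≠ S l' i → r.2 (toLex (i, S l i)) ≠ r.2 (toLex (i, S l' i)) := by
        simp only [Filter.eventually_all]
        exact fun l l' i hi => hne _ _ _ hi
      filter_upwards [h2, h3, hbd 0] with r hr2 hr3 hr4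
      obtain ⟨ρ, hρ⟩ := exists_perm_aeval_eq_zero ⟨fun i => ⟨_, hr4 i⟩⟩ (hg r.1) (x := x)
        (y := fun l i => ⟨r.2 (toLex (i, S l i)), hr2 l i⟩) hx hxP (by
          intro l l' i
          rw [← hS, Fin.mk.injEq]
          refine ⟨fun h => ?_, fun h => by rw [h]⟩
          by_contra hne'
          exact hr3 l l' i hne' h)
      refine ⟨ρ, ?_⟩
      simpa only [arrayRep, dif_pos (hr2 _)] using hρ
    obtain ⟨ρ, hρ⟩ := Ultrafilter.eventually_exists_iff.1 h1
    exact ⟨ρ, (hzero (W := Fin k × Fin n) (fun v => S (ρ v.1)) (fun v => v.2) p).2 hρ⟩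

end Array

/-! ### Specialization of generic arrays -/

section Specialize

theorem exists_sum_mul_eq_zero {K : Type*} [Field K] {N : Type*} [Finite N] (S : Finset N)
    {a b : ℕ → N → K} (h : ∀ r s, r < s → ∑ m ∈ S, a r m * b s m = 0) :
    ∃ r, ∑ m ∈ S, a r m * b r m = 0 := by
  classical
  let W : ℕ →o (Submodule K (N → K))ᵒᵈ :=
    ⟨fun j => OrderDual.toDual (Submodule.span K (b '' Set.Ici j)), fun i j hij =>
      Submodule.span_mono (Set.image_mono (Set.Ici_subset_Ici.2 hij))⟩
  obtain ⟨j, hj⟩ := WellFoundedGT.monotone_chain_condition W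
  have h1 : b j ∈ Submodule.span K (b '' Set.Ici (j + 1)) := by
    have h2 : Submodule.span K (b '' Set.Ici j) = Submodule.span K (b '' Set.Ici (j + 1)) :=
      hj (j + 1) (Nat.le_succ j)
    rw [← h2]
    exact Submodule.subset_span ⟨j, Set.self_mem_Ici, rfl⟩
  let L : (N → K) →ₗ[K] K := ∑ m ∈ S, a j m • LinearMap.proj m
  have hL : ∀ y, L y = ∑ m ∈ S, a j m * y m := fun y => by simp [L]
  have h3 : Submodule.span K (b '' Set.Ici (j + 1)) ≤ LinearMap.ker L := by
    rw [Submodule.span_le]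
    rintro _ ⟨s, hs, rfl⟩
    rw [SetLike.mem_coe, LinearMap.mem_ker, hL]
    exact h j s hs
  exact ⟨j, by rw [← hL]; exact h3 h1⟩

/-- A polynomial separates as a sum of products along a partition of the variables. -/
theorem exists_aeval_ite_eq_sum {K : Type*} [Field K] [Algebra ℚ K] {σ : Type*} [Finite σ]
    (R : σ → Prop) [DecidablePred R] (G : MvPolynomial σ ℚ) :
    ∃ A B : (σ → K) → (σ →₀ ℕ) → K, ∀ X Y : σ → K,
      MvPolynomial.aeval (fun j => if R j then X j else Y j) G =
        ∑ m ∈ G.support, A X m * B Y m := by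
  have := Fintype.ofFinite σ
  refine ⟨fun X m => algebraMap ℚ K (G.coeff m) * ∏ j with R j, X j ^ m j,
    fun Y m => ∏ j with ¬ R j, Y j ^ m j, fun X Y => ?_⟩
  rw [MvPolynomial.aeval_def, MvPolynomial.eval₂_eq']
  refine Finset.sum_congr rfl fun m _ => ?_
  rw [mul_assoc, ← Finset.prod_filter_mul_prod_filter_not _ (fun j => R j)]
  congr 2 <;> exact Finset.prod_congr rfl fun j hj => by simp [(Finset.mem_filter.1 hj).2]

variable {K : Type*} [Field K] [Algebra ℚ K] {α : Type v} {k n ℓ d : ℕ}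
  {p : MvPolynomial ((Fin k × Fin n) ⊕ Fin ℓ) ℚ} {P : Finset (Fin d → α)}
  {ξ : (Fin d → ℚ) → Fin n → K} {c : Fin ℓ → K}

open Classical in
/-- Replace the value `r` by `r'` and the value `s` by `s'` at the coordinate `i`. -/
noncomputable def moveTwo (i : Fin d) (r s r' s' : ℚ) (e : Fin d → ℚ) : Fin d → ℚ :=
  fun j => if j = i then if e j = r then r' else if e j = s then s' else e j else e j

theorem moveTwo_lt_iff {W : Type*} {e : W → Fin d → ℚ} {i : Fin d} {r s r' s' : ℚ}
    (hgap : ∀ w, e w i ≤ r ∨ s ≤ e w i) (hr : r ≤ r') (hrs : r' < s') (hs : s' ≤ s) (w w' : W)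
    (j : Fin d) :
    e w j < e w' j ↔ moveTwo i r s r' s' (e w) j < moveTwo i r s r' s' (e w') j := by
  unfold moveTwo
  by_cases hj : j = i
  · subst hj
    have h1 := hgap w
    have h2 := hgap w'
    simp only [if_true]
    grind
  · simp [hj]

theorem moveTwo_self_lt_iff {W : Type*} {e : W → Fin d → ℚ} {i : Fin d} {r s r' r'' : ℚ}
    (hgap : ∀ w, e w i ≤ r ∨ s ≤ e w i) (hr : r ≤ r') (hs : r' ≤ s) (hr' : r ≤ r'')
    (hs' : r'' ≤ s) (hrs : r < s) (w w' : W) (j : Fin d) :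
    moveTwo i r s r' r' (e w) j < moveTwo i r s r' r' (e w') j ↔
      moveTwo i r s r'' r'' (e w) j < moveTwo i r s r'' r'' (e w') j := by
  unfold moveTwo
  by_cases hj : j = i
  · subst hj
    have h1 := hgap w
    have h2 := hgap w'
    simp only [if_true]
    grind
  · simp [hj]

/-- Merging two adjacent positions preserves algebraic relations. -/
theorem GenericArray.merge (hξ : GenericArray p P ξ c) {W : Type} [Finite W] {e : W → Fin d → ℚ}
    {u : W → Fin n} {F : MvPolynomial (W ⊕ Fin ℓ) ℚ} {i : Fin d} {r s : ℚ} (hrs : r < s)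
    (hgap : ∀ w, e w i ≤ r ∨ s ≤ e w i)
    (hF : MvPolynomial.aeval (Sum.elim (fun w => ξ (e w) (u w)) c) F = 0) :
    MvPolynomial.aeval (Sum.elim (fun w => ξ (moveTwo i r s r r (e w)) (u w)) c) F = 0 := by
  classical
  have key : ∀ r' s', r ≤ r' → r' < s' → s' ≤ s →
      MvPolynomial.aeval (Sum.elim (fun w => ξ (moveTwo i r s r' s' (e w)) (u w)) c) F = 0 :=
    fun r' s' hr hlt hs => hξ.indisc _ _ u (moveTwo_lt_iff hgap hr hlt hs) F hF
  let R : W ⊕ Fin ℓ → Prop := Sum.elim (fun w => e w i = r) fun _ => False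
  obtain ⟨A, B, hAB⟩ := exists_aeval_ite_eq_sum (K := K) R F
  let X : ℚ → W ⊕ Fin ℓ → K := fun r' =>
    Sum.elim (fun w => ξ (moveTwo i r s r' r' (e w)) (u w)) c
  have hX : ∀ r' s', Sum.elim (fun w => ξ (moveTwo i r s r' s' (e w)) (u w)) c =
      fun j => if R j then X r' j else X s' j := by
    intro r' s'
    funext j
    rcases j with w | j
    · by_cases hw : e w i = r
      · have : moveTwo i r s r' s' (e w) = moveTwo i r s r' r' (e w) := by
          funext j
          unfold moveTwo
          by_cases hj : j = i
          · subst hj; simp [hw]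
          · simp [hj]
        simp [R, X, hw, this]
      · have : moveTwo i r s r' s' (e w) = moveTwo i r s s' s' (e w) := by
          funext j
          unfold moveTwo
          by_cases hj : j = i
          · subst hj; simp [hw]
          · simp [hj]
        simp [R, X, hw, this]
    · simp [R, X]
  let t : ℕ → ℚ := fun a => s - (s - r) / (a + 1)
  have ht : ∀ a, r ≤ t a ∧ t a ≤ s := by
    intro a
    have h1 : (0 : ℚ) < a + 1 := by positivity
    have h2 : (s - r) / (a + 1) ≤ s - r :=
      div_le_self (sub_pos.2 hrs).le (by linarith [(Nat.cast_nonneg a : (0 : ℚ) ≤ a)])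
    have h3 : 0 ≤ (s - r) / (a + 1) := div_nonneg (sub_pos.2 hrs).le h1.le
    exact ⟨by simp only [t]; linarith, by simp only [t]; linarith⟩
  have htlt : ∀ a b, a < b → t a < t b := by
    intro a b hab
    have h1 : (0 : ℚ) < a + 1 := by positivity
    have h2 : (a : ℚ) < b := by exact_mod_cast hab
    exact sub_lt_sub_left (div_lt_div_of_pos_left (sub_pos.2 hrs) h1 (by linarith)) _
  obtain ⟨a, ha⟩ := exists_sum_mul_eq_zero (N := F.support) Finset.univ
    (a := fun a m => A (X (t a)) m) (b := fun a m => B (X (t a)) m) (fun a b hab => by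
      rw [Finset.univ_eq_attach, Finset.sum_attach F.support
        (fun m => A (X (t a)) m * B (X (t b)) m), ← hAB, ← hX]
      exact key _ _ (ht a).1 (htlt a b hab) (ht b).2)
  rw [Finset.univ_eq_attach, Finset.sum_attach F.support
    (fun m => A (X (t a)) m * B (X (t a)) m), ← hAB, ← hX] at ha
  exact hξ.indisc _ _ u (moveTwo_self_lt_iff hgap (ht a).1 (ht a).2 le_rfl hrs.le hrs) F ha

/-- Algebraic relations are preserved by weakly monotone changes of the indices. -/
theorem GenericArray.specialize (hξ : GenericArray p P ξ c) {W : Type} [Finite W]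
    {e e' : W → Fin d → ℚ} (u : W → Fin n) (h : ∀ w w' i, e w i ≤ e w' i → e' w i ≤ e' w' i)
    {F : MvPolynomial (W ⊕ Fin ℓ) ℚ}
    (hF : MvPolynomial.aeval (Sum.elim (fun w => ξ (e w) (u w)) c) F = 0) :
    MvPolynomial.aeval (Sum.elim (fun w => ξ (e' w) (u w)) c) F = 0 := by
  classical
  have := Fintype.ofFinite W
  induction hN : (Finset.univ.image fun a : W × Fin d => (a.2, e a.1 a.2)).card using
    Nat.strong_induction_on generalizing e with
  | _ N ih =>
  subst hN
  by_cases hstrict : ∀ w w' i, e w i < e w' i → e' w i < e' w' i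
  · refine hξ.indisc e e' u (fun w w' i => ⟨hstrict w w' i, fun hlt => ?_⟩) F hF
    exact lt_of_not_ge fun hge => (h _ _ _ hge).not_gt hlt
  · push Not at hstrict
    obtain ⟨w, w₁, i, hlt, hge⟩ := hstrict
    obtain ⟨w₂, hw₂, hmin⟩ := Finset.exists_min_image
      (Finset.univ.filter fun w' => e w i < e w' i) (fun w' => e w' i) ⟨w₁, by simpa using hlt⟩
    have hlt₂ : e w i < e w₂ i := by simpa using hw₂
    have hle : e w₂ i ≤ e w₁ i := hmin _ (by simpa using hlt)
    have hgap : ∀ w', e w' i ≤ e w i ∨ e w₂ i ≤ e w' i := fun w' =>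
      (le_or_gt (e w' i) (e w i)).imp_right fun h => hmin _ (by simpa using h)
    have heq : e' w₂ i = e' w i :=
      le_antisymm ((h _ _ _ hle).trans hge) (h _ _ _ hlt₂.le)
    refine ih _ ?_ (e := fun a => moveTwo i (e w i) (e w₂ i) (e w i) (e w i) (e a)) ?_
      (hξ.merge hlt₂ hgap hF) rfl
    · refine Finset.card_lt_card (Finset.ssubset_iff_subset_ne.2 ⟨?_, fun hEq => ?_⟩)
      · rintro ⟨j, v⟩ hv
        obtain ⟨⟨a, j'⟩, -, hv⟩ := Finset.mem_image.1 hv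
        obtain ⟨rfl, rfl⟩ := Prod.mk.inj hv
        by_cases ha : j' = i ∧ e a j' = e w₂ i
        · obtain ⟨rfl, ha⟩ := ha
          exact Finset.mem_image.2 ⟨(w, j'), Finset.mem_univ _, by simp [moveTwo, ha]⟩
        · refine Finset.mem_image.2 ⟨(a, j'), Finset.mem_univ _, ?_⟩
          unfold moveTwo
          grind
      · have hmem : (i, e w₂ i) ∈ Finset.univ.image fun a : W × Fin d => (a.2, e a.1 a.2) :=
          Finset.mem_image.2 ⟨(w₂, i), Finset.mem_univ _, rfl⟩
        rw [← hEq] at hmem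
        obtain ⟨⟨a, j'⟩, -, hv⟩ := Finset.mem_image.1 hmem
        obtain ⟨rfl, hv⟩ := Prod.mk.inj hv
        simp only [moveTwo, if_true] at hv
        grind
    · intro a b j hab
      unfold moveTwo at hab
      by_cases hj : j = i
      · subst hj
        simp only [if_true] at hab
        have h1 := h a b j
        have h2 := h w b j
        have h3 := h a w j
        have h4 := h w₂ b j
        have h5 := h a w₂ j
        grind
      · simp only [hj, if_false] at hab
        exact h _ _ _ hab

end Specialize

/-! ### Derivations detecting algebraic dependence -/

section Detect

open Algebra TensorProduct in
/-- In characteristic zero, derivations can be prescribed on a transcendence basis. -/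
theorem IsTranscendenceBasis.exists_derivation {L K ι : Type*} [Field L] [Field K] [CharZero L]
    [Algebra L K] {v : ι → K} (hv : IsTranscendenceBasis L v) (a : ι → K) :
    ∃ D : Derivation L K K, ∀ i, D (v i) = a i := by
  let A := MvPolynomial ι L
  let : Algebra A K := (MvPolynomial.aeval v).toAlgebra
  have : IsScalarTower L A K := IsScalarTower.of_algebraMap_eq fun x => by
    rw [RingHom.algebraMap_toAlgebra]
    simp [A]
  have hinj : Function.Injective (algebraMap A K) := hv.1
  have : FaithfulSMul A K := (faithfulSMul_iff_algebraMap_injective A K).2 hinj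
  let := FractionRing.liftAlgebra A K
  have : IsScalarTower A (FractionRing A) K := FractionRing.isScalarTower_liftAlgebra A K
  have halg : Algebra.IsAlgebraic A K := by
    have := hv.isAlgebraic
    refine Algebra.IsAlgebraic.of_ringHom_of_comp_eq (S := Algebra.adjoin L (Set.range v)) (B := K)
      hv.1.aevalEquiv (RingHom.id K) (EquivLike.surjective _) Function.injective_id ?_
    ext x
    · simp [A, RingHom.algebraMap_toAlgebra]
    · simp [A, RingHom.algebraMap_toAlgebra]
  have : Algebra.IsAlgebraic (FractionRing A) K :=
    (IsFractionRing.comap_isAlgebraic_iff (A := A)).1 halg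
  have : CharZero (FractionRing A) := inferInstance
  have : Algebra.FormallyEtale (FractionRing A) K := Algebra.FormallyEtale.of_isSeparable _ K
  have : Algebra.FormallyEtale A (FractionRing A) :=
    Algebra.FormallyEtale.of_isLocalization (nonZeroDivisors A)
  have : Algebra.FormallyEtale A K := Algebra.FormallyEtale.comp A (FractionRing A) K
  let D₀ : Derivation L A K := MvPolynomial.mkDerivation L a
  let e := KaehlerDifferential.tensorKaehlerEquivOfFormallyEtale L A K
  let φ : K ⊗[A] KaehlerDifferential L A →ₗ[K] K := 
    TensorProduct.AlgebraTensorModule.lift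
      ((LinearMap.lsmul K (KaehlerDifferential L A →ₗ[A] K)).flip D₀.liftKaehlerDifferential)
  refine ⟨(φ ∘ₗ e.symm.toLinearMap).compDer (KaehlerDifferential.D L K), fun i => ?_⟩
  have h1 : v i = algebraMap A K (MvPolynomial.X i) := by
    rw [RingHom.algebraMap_toAlgebra]
    simp [A]
  have h2 := KaehlerDifferential.tensorKaehlerEquivOfFormallyEtale_symm_D_algebraMap L A K (MvPolynomial.X i)
  simp [h1, e, h2, φ, D₀]
  exact MvPolynomial.mkDerivation_X _ _ _

theorem exists_derivation_ne_zero_of_transcendental {L K : Type*} [Field L] [Field K] [CharZero L]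
    [Algebra L K] {z : K} (hz : Transcendental L z) : ∃ D : Derivation L K K, D z ≠ 0 := by
  have h1 : AlgebraicIndepOn L id {z} :=
    (algebraicIndependent_singleton_iff (⟨z, rfl⟩ : ({z} : Set K))).2 hz
  obtain ⟨t, ht, hb⟩ := exists_isTranscendenceBasis_superset h1
  obtain ⟨D, hD⟩ := hb.exists_derivation fun _ => 1
  refine ⟨D, ?_⟩
  have := hD ⟨z, ht rfl⟩
  simp only at this
  rw [this]
  exact one_ne_zero

/-- A derivation for which linear dependence of differentials means algebraic dependence
over `c`. -/
structure Detects {K N : Type*} [Field K] [Algebra ℚ K] [AddCommGroup N] [Module K N] [Module ℚ N]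
    {ℓ : ℕ} (δ : Derivation ℚ K N) (c : Fin ℓ → K) : Prop where
  zero : ∀ j, δ (c j) = 0
  exists_poly : ∀ {β : Type} [Finite β] (y : β → K) (z : K),
    δ z ∈ Submodule.span K (Set.range fun b => δ (y b)) →
    ∃ F : MvPolynomial (Option β ⊕ Fin ℓ) ℚ, MvPolynomial.aeval (unknownPt y z c) F = 0 ∧
      MvPolynomial.aeval (unknownPt y z c) (MvPolynomial.pderiv (.inl none) F) ≠ 0

theorem pderiv_eval₂_rename {β : Type*} {m : ℕ}
    (Q : Polynomial (MvPolynomial (β ⊕ Fin m) ℚ)) :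
    MvPolynomial.pderiv (.inl none) (Q.eval₂ (MvPolynomial.rename (Sum.map some id)).toRingHom
      (MvPolynomial.X (.inl none : Option β ⊕ Fin m))) =
    Q.derivative.eval₂ (MvPolynomial.rename (Sum.map some id)).toRingHom
      (MvPolynomial.X (.inl none : Option β ⊕ Fin m)) := by
  have h0 : ∀ a : MvPolynomial (β ⊕ Fin m) ℚ, MvPolynomial.pderiv (.inl none : Option β ⊕ Fin m)
      (MvPolynomial.rename (Sum.map some id) a) = 0 := by
    classical
    intro a
    refine MvPolynomial.pderiv_eq_zero_of_notMem_vars fun h => ?_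
    obtain ⟨v, -, hv⟩ := Finset.mem_image.1 (MvPolynomial.vars_rename _ _ h)
    cases v <;> simp at hv
  induction Q using Polynomial.induction_on' with
  | add p q hp hq => simp only [Polynomial.eval₂_add, map_add, hp, hq]
  | monomial a b =>
    rw [Polynomial.derivative_monomial, Polynomial.eval₂_monomial, Polynomial.eval₂_monomial]
    simp only [AlgHom.toRingHom_eq_coe, RingHom.coe_coe, Derivation.leibniz, h0, smul_zero,
      add_zero, Derivation.leibniz_pow, MvPolynomial.pderiv_X_self, map_mul, map_natCast]
    simp
    ring

theorem exists_poly_of_isAlgebraic {K : Type*} [Field K] [Algebra ℚ K] {β : Type*} {m : ℕ}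
    {y : β → K} {z : K} {c : Fin m → K}
    (h : IsAlgebraic (Algebra.adjoin ℚ (Set.range (Sum.elim y c))) z) :
    ∃ F : MvPolynomial (Option β ⊕ Fin m) ℚ, MvPolynomial.aeval (unknownPt y z c) F = 0 ∧
      MvPolynomial.aeval (unknownPt y z c) (MvPolynomial.pderiv (.inl none) F) ≠ 0 := by
  classical
  rw [Algebra.adjoin_range_eq_range_aeval] at h
  let φ : MvPolynomial (β ⊕ Fin m) ℚ →ₐ[ℚ] K := MvPolynomial.aeval (Sum.elim y c)
  change IsAlgebraic φ.range z at h
  have hex : ∃ N, ∃ q : Polynomial φ.range, q ≠ 0 ∧ Polynomial.aeval z q = 0 ∧ q.natDegree = N := by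
    obtain ⟨q, hq, hz⟩ := h
    exact ⟨_, q, hq, hz, rfl⟩
  obtain ⟨q, hq0, hqz, hqN⟩ := Nat.find_spec hex
  have hdeg : q.natDegree ≠ 0 := fun h0 => by
    rw [Polynomial.eq_C_of_natDegree_eq_zero h0, Polynomial.aeval_C] at hqz
    refine hq0 ?_
    rw [Polynomial.eq_C_of_natDegree_eq_zero h0,
      show q.coeff 0 = 0 from Subtype.ext hqz, Polynomial.C_0]
  have : CharZero K := algebraRat.charZero K
  have : CharZero φ.range := ⟨fun a b hab => Nat.cast_injective (R := K) (by
    exact_mod_cast congrArg Subtype.val hab)⟩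
  have hder : q.derivative ≠ 0 := fun h0 =>
    hdeg (Polynomial.derivative_eq_zero.1 h0)
  have hderz : Polynomial.aeval z q.derivative ≠ 0 := fun h0 =>
    Nat.find_min hex (hqN ▸ Polynomial.natDegree_derivative_lt hdeg) ⟨_, hder, h0, rfl⟩
  obtain ⟨Q, hQ⟩ := Polynomial.map_surjective φ.rangeRestrict.toRingHom
    (AlgHom.rangeRestrict_surjective φ) q
  have key : ∀ Q : Polynomial (MvPolynomial (β ⊕ Fin m) ℚ),
      MvPolynomial.aeval (unknownPt y z c)
        (Q.eval₂ (MvPolynomial.rename (Sum.map some id)).toRingHom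
          (MvPolynomial.X (.inl none : Option β ⊕ Fin m))) =
      Polynomial.aeval z (Q.map φ.rangeRestrict.toRingHom) := by
    intro Q
    rw [← AlgHom.coe_toRingHom, Polynomial.hom_eval₂, Polynomial.aeval_def, Polynomial.eval₂_map]
    have h1 : (MvPolynomial.aeval (R := ℚ) (unknownPt y z c)).toRingHom
        (MvPolynomial.X (.inl none : Option β ⊕ Fin m)) = z := by
      simp [unknownPt]
    have h2 : ((MvPolynomial.aeval (R := ℚ) (unknownPt y z c)).toRingHom).comp
        ((MvPolynomial.rename (R := ℚ)
          (Sum.map some id : β ⊕ Fin m → Option β ⊕ Fin m)).toRingHom) =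
        (algebraMap φ.range K).comp φ.rangeRestrict.toRingHom := by
      refine MvPolynomial.ringHom_ext (fun a => ?_) fun v => ?_
      · simp
      · rcases v with v | v <;> simp [unknownPt, φ]
    exact congrArg₂ (fun f t => Polynomial.eval₂ f t Q) h2 h1
  refine ⟨Q.eval₂ (MvPolynomial.rename (Sum.map some id)).toRingHom
    (MvPolynomial.X (.inl none : Option β ⊕ Fin m)), ?_, ?_⟩
  · rw [key, hQ, hqz]
  · rw [pderiv_eval₂_rename, key, ← Polynomial.derivative_map, hQ]
    exact hderz

open scoped IntermediateField.algebraAdjoinAdjoin in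
theorem exists_detects {K : Type u} [Field K] [Algebra ℚ K] {m : ℕ} (c : Fin m → K) :
    ∃ (N : Type u) (_ : AddCommGroup N) (_ : Module K N) (_ : Module ℚ N)
      (δ : Derivation ℚ K N), Detects δ c := by
  let S := Submodule.span K (Set.range fun j => KaehlerDifferential.D ℚ K (c j))
  let δ : Derivation ℚ K (KaehlerDifferential ℚ K ⧸ S) := S.mkQ.compDer (KaehlerDifferential.D ℚ K)
  have hδ : ∀ z, δ z = S.mkQ (KaehlerDifferential.D ℚ K z) := fun z => rfl
  refine ⟨KaehlerDifferential ℚ K ⧸ S, inferInstance, inferInstance, inferInstance, δ, fun j => ?_, ?_⟩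
  · rw [hδ, Submodule.mkQ_apply, Submodule.Quotient.mk_eq_zero]
    exact Submodule.subset_span ⟨j, rfl⟩
  · intro β _ y z hz
    apply exists_poly_of_isAlgebraic
    let L := IntermediateField.adjoin ℚ (Set.range (Sum.elim y c))
    have hL : ∀ j, ∃ a : L, algebraMap L K a = Sum.elim y c j := fun j =>
      ⟨⟨_, IntermediateField.subset_adjoin _ _ ⟨j, rfl⟩⟩, rfl⟩
    suffices h : IsAlgebraic L z by
      exact (IsFractionRing.isAlgebraic_iff (Algebra.adjoin ℚ (Set.range (Sum.elim y c))) L K).2 h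
    by_contra htr
    obtain ⟨D, hD⟩ := exists_derivation_ne_zero_of_transcendental htr
    have hD0 : ∀ j, D (Sum.elim y c j) = 0 := fun j => by
      obtain ⟨a, ha⟩ := hL j
      rw [← ha, D.map_algebraMap]
    let φ := (D.restrictScalars ℚ).liftKaehlerDifferential
    have hφ : ∀ a, φ (KaehlerDifferential.D ℚ K a) = D a := fun a =>
      Derivation.liftKaehlerDifferential_comp_D _ _
    have hS : S ≤ LinearMap.ker φ := by
      rw [Submodule.span_le]
      rintro _ ⟨j, rfl⟩
      exact (hφ _).trans (hD0 (.inr j))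
    have hspan : Submodule.span K (Set.range fun b => δ (y b)) ≤ LinearMap.ker (S.liftQ φ hS) := by
      rw [Submodule.span_le]
      rintro _ ⟨b, rfl⟩
      exact (hφ _).trans (hD0 (.inl b))
    exact hD ((hφ _).symm.trans (hspan hz))

end Detect

/-! ### Differentials of generic arrays -/

section ChainRule

theorem Derivation.apply_aeval {A M : Type*} [CommRing A] [Algebra ℚ A] [AddCommGroup M]
    [Module A M] [Module ℚ M] {V : Type*} [Fintype V] (δ : Derivation ℚ A M) (f : V → A)
    (F : MvPolynomial V ℚ) :
    δ (MvPolynomial.aeval f F) =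
      ∑ v, MvPolynomial.aeval f (MvPolynomial.pderiv v F) • δ (f v) := by
  classical
  induction F using MvPolynomial.induction_on with
  | C a => simp
  | add p q hp hq => simp only [map_add, hp, hq, add_smul, Finset.sum_add_distrib]
  | mul_X p j hp =>
    simp only [map_mul, Derivation.leibniz, hp, MvPolynomial.aeval_X, MvPolynomial.pderiv_X,
      smul_eq_mul, map_add, add_smul, Finset.sum_add_distrib, Finset.smul_sum, mul_smul]
    congr 1
    rw [Finset.sum_eq_single j]
    · simp
    · intro b _ hb
      simp [hb.symm]
    · simp

variable {K N : Type*} [Field K] [Algebra ℚ K] [AddCommGroup N] [Module K N] [Module ℚ N]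
  {β Θ : Type} {k n ℓ : ℕ} {δ : Derivation ℚ K N} {c : Fin ℓ → K}

theorem Derivation.apply_aeval_unknownPt {A M : Type*} [CommRing A] [Algebra ℚ A]
    [AddCommGroup M] [Module A M] [Module ℚ M] (δ : Derivation ℚ A M) {c : Fin ℓ → A} [Fintype β]
    (hc : ∀ j, δ (c j) = 0) (y : β → A) (z : A)
    (F : MvPolynomial (Option β ⊕ Fin ℓ) ℚ) :
    δ (MvPolynomial.aeval (unknownPt y z c) F) =
      MvPolynomial.aeval (unknownPt y z c) (MvPolynomial.pderiv (.inl none) F) • δ z +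
      ∑ a, MvPolynomial.aeval (unknownPt y z c) (MvPolynomial.pderiv (.inl (some a)) F) •
        δ (y a) := by
  rw [δ.apply_aeval, Fintype.sum_sum_type, Fintype.sum_option]
  simp [unknownPt, hc]

theorem Derivation.mem_span_of_aeval_eq_zero [Finite β] (hc : ∀ j, δ (c j) = 0) {y : β → K}
    {z : K} {F : MvPolynomial (Option β ⊕ Fin ℓ) ℚ}
    (h0 : MvPolynomial.aeval (unknownPt y z c) F = 0)
    (h1 : MvPolynomial.aeval (unknownPt y z c) (MvPolynomial.pderiv (.inl none) F) ≠ 0)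
    {R : β → Prop} (hR : ∀ a, ¬ R a →
      MvPolynomial.aeval (unknownPt y z c) (MvPolynomial.pderiv (.inl (some a)) F) = 0) :
    δ z ∈ Submodule.span K (Set.range fun a : {a // R a} => δ (y a)) := by
  have := Fintype.ofFinite β
  have h := δ.apply_aeval_unknownPt hc y z F
  rw [h0, map_zero, eq_comm, add_eq_zero_iff_eq_neg] at h
  rw [← Submodule.smul_mem_iff _ h1, h]
  refine Submodule.neg_mem _ (Submodule.sum_mem _ fun a _ => ?_)
  by_cases ha : R a
  · exact Submodule.smul_mem _ _ (Submodule.subset_span ⟨⟨a, ha⟩, rfl⟩)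
  · rw [hR a ha, zero_smul]
    exact Submodule.zero_mem _

/-- The ideal of relations among independent elements and their algebraic functions is closed
under differentiation. -/
theorem aeval_prolong_eq_zero [Fintype β] [Fintype Θ] [DecidableEq Θ] (hc : ∀ j, δ (c j) = 0)
    {F : Fin n → MvPolynomial (Option β ⊕ Fin ℓ) ℚ} {q : β → Fin k → Θ} {Y : Θ → K}
    {X : Fin k × Fin n → K} (hY : LinearIndependent K fun θ => δ (Y θ))
    (hF : ∀ v, MvPolynomial.aeval (unknownPt (fun a => Y (q a v.1)) (X v) c) (F v.2) = 0) (θ : Θ)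
    {G : MvPolynomial ((Θ ⊕ Fin k × Fin n) ⊕ Fin ℓ) ℚ}
    (hG : MvPolynomial.aeval (blockPt Y X c) G = 0) :
    MvPolynomial.aeval (blockPt Y X c) (prolong F q θ G) = 0 := by
  obtain ⟨φ, hφ⟩ : ∃ φ : N →ₗ[K] K, ∀ θ', φ (δ (Y θ')) = Pi.single (M := fun _ => K) θ 1 θ' := by
    obtain ⟨φ, hφ⟩ := LinearMap.exists_extend
      ((Finsupp.lapply θ : (Θ →₀ K) →ₗ[K] K) ∘ₗ hY.repr)
    refine ⟨φ, fun θ' => ?_⟩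
    have h1 := LinearMap.congr_fun hφ ⟨δ (Y θ'), Submodule.subset_span ⟨θ', rfl⟩⟩
    have h2 := hY.repr_eq_single θ' ⟨δ (Y θ'), Submodule.subset_span ⟨θ', rfl⟩⟩ rfl
    simp only [LinearMap.comp_apply, Submodule.subtype_apply] at h1
    rw [h1]
    simp [h2, Finsupp.single_apply, Pi.single_apply, eq_comm]
  have h := sum_mul_aeval_prolong F q G Y (fun θ' => φ (δ (Y θ'))) X (fun v => φ (δ (X v))) c
    fun v => by
      have h1 := congrArg φ (δ.apply_aeval_unknownPt hc (fun a => Y (q a v.1)) (X v) (F v.2))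
      rw [hF v] at h1
      simpa using h1.symm
  have h2 : φ (δ (MvPolynomial.aeval (blockPt Y X c) G)) = 0 := by rw [hG, map_zero, map_zero]
  rw [δ.apply_aeval, Fintype.sum_sum_type, Fintype.sum_sum_type] at h2
  simp only [blockPt, Sum.elim_inl, Sum.elim_inr, hc, smul_zero, Finset.sum_const_zero, add_zero,
    map_add, map_sum, map_smul, smul_eq_mul] at h2
  simp only [blockPt] at h
  rw [h2, mul_zero] at h
  simpa [hφ, Pi.single_apply, blockPt] using h

end ChainRule

section Greedy

theorem mem_span_image_of_wellFounded {K N G κ : Type*} [Field K] [AddCommGroup N] [Module K N]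
    [Preorder κ] [WellFoundedLT κ] (key : G → κ) (f : G → N) (g : G) :
    f g ∈ Submodule.span K (f '' {g | f g ∉ Submodule.span K (f '' {g' | key g' < key g})}) := by
  induction h : key g using WellFoundedLT.induction generalizing g with
  | _ a ih =>
  subst h
  by_cases hg : f g ∈ Submodule.span K (f '' {g' | key g' < key g})
  · refine Submodule.span_le.2 ?_ hg
    rintro _ ⟨g', hg', rfl⟩
    exact ih _ hg' g' rfl
  · exact Submodule.subset_span ⟨g, hg, rfl⟩

theorem exists_finset_mem_span_image {K N G ι : Type*} [Field K] [AddCommGroup N] [Module K N]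
    [Finite ι] {f : G → N} {B : Set G} {z : ι → N}
    (hz : ∀ i, z i ∈ Submodule.span K (f '' B)) :
    ∃ S : Finset G, ↑S ⊆ B ∧ ∀ i, z i ∈ Submodule.span K (Set.range fun b : S => f b) := by
  classical
  have := Fintype.ofFinite ι
  have h : ∀ i, ∃ S : Finset G, ↑S ⊆ B ∧ z i ∈ Submodule.span K (f '' S) := fun i => by
    obtain ⟨T, hT, hz⟩ := Submodule.mem_span_finite_of_mem_span (hz i)
    obtain ⟨S, hS, rfl⟩ := Finset.subset_set_image_iff.1 hT
    exact ⟨S, hS, by simpa using hz⟩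
  choose S hS hz using h
  refine ⟨Finset.univ.biUnion S, by simpa using hS, fun i => ?_⟩
  refine Submodule.span_mono ?_ (hz i)
  rintro _ ⟨b, hb, rfl⟩
  exact ⟨⟨b, Finset.mem_biUnion.2 ⟨i, Finset.mem_univ _, hb⟩⟩, rfl⟩

end Greedy

section Uniform

theorem unknownPt_eq_elim {β K : Type*} {n ℓ d : ℕ} (ξ : (Fin d → ℚ) → Fin n → K) (c : Fin ℓ → K)
    (e : Option β → Fin d → ℚ) (w : Option β → Fin n) :
    unknownPt (fun b => ξ (e (some b)) (w (some b))) (ξ (e none) (w none)) c =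
      Sum.elim (fun o => ξ (e o) (w o)) c := by
  funext s
  rcases s with (_ | _) | _ <;> rfl

variable {K N : Type*} [Field K] [Algebra ℚ K] [AddCommGroup N] [Module K N] [Module ℚ N]
  {α : Type v} {k n ℓ d : ℕ} {δ : Derivation ℚ K N} {c : Fin ℓ → K}
  {p : MvPolynomial ((Fin k × Fin n) ⊕ Fin ℓ) ℚ} {P : Finset (Fin d → α)}
  {ξ : (Fin d → ℚ) → Fin n → K}

/-- Two families of index tuples have the same coordinatewise order type. -/
def SameOrder {W : Type*} {d : ℕ} (e e' : W → Fin d → ℚ) : Prop :=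
  ∀ w w' i, e w i < e w' i ↔ e' w i < e' w' i

/-- Linear dependence of differentials is witnessed by a polynomial depending only on the order
type of the indices. -/
theorem GenericArray.exists_poly (hξ : GenericArray p P ξ c) (hδ : Detects δ c) {β : Type}
    [Finite β] (e : Option β → Fin d → ℚ) (w : Option β → Fin n)
    (h : δ (ξ (e none) (w none)) ∈
      Submodule.span K (Set.range fun b => δ (ξ (e (some b)) (w (some b))))) :
    ∃ F : MvPolynomial (Option β ⊕ Fin ℓ) ℚ, ∀ e' : Option β → Fin d → ℚ, SameOrder e e' →
      MvPolynomial.aeval (unknownPt (fun b => ξ (e' (some b)) (w (some b)))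
        (ξ (e' none) (w none)) c) F = 0 ∧
      MvPolynomial.aeval (unknownPt (fun b => ξ (e' (some b)) (w (some b)))
        (ξ (e' none) (w none)) c) (MvPolynomial.pderiv (.inl none) F) ≠ 0 := by
  obtain ⟨F, h0, h1⟩ := hδ.exists_poly _ _ h
  rw [unknownPt_eq_elim] at h0 h1
  refine ⟨F, fun e' he => ?_⟩
  rw [unknownPt_eq_elim]
  exact ⟨hξ.indisc e e' w he F h0, fun h2 =>
    h1 (hξ.indisc e' e w (fun a b i => (he a b i).symm) _ h2)⟩

theorem GenericArray.mem_span_of_sameOrder (hξ : GenericArray p P ξ c) (hδ : Detects δ c)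
    {β : Type} [Finite β] {e e' : Option β → Fin d → ℚ} {w : Option β → Fin n}
    (he : SameOrder e e')
    (h : δ (ξ (e none) (w none)) ∈
      Submodule.span K (Set.range fun b => δ (ξ (e (some b)) (w (some b))))) :
    δ (ξ (e' none) (w none)) ∈
      Submodule.span K (Set.range fun b => δ (ξ (e' (some b)) (w (some b)))) := by
  obtain ⟨F, hF⟩ := hξ.exists_poly hδ e w h
  refine Submodule.span_mono ?_ (Derivation.mem_span_of_aeval_eq_zero (R := fun _ => True) hδ.zero
    (hF e' he).1 (hF e' he).2 fun a ha => (ha trivial).elim)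
  rintro _ ⟨a, rfl⟩
  exact ⟨a.1, rfl⟩

/-- Along a line, the differential of some entry is not determined by a finite set of
differentials off the line. -/
theorem GenericArray.exists_notMem_span (hξ : GenericArray p P ξ c) (hδ : Detects δ c) {β : Type}
    [Finite β] (e : β → Fin d → ℚ) (w : β → Fin n) (i : Fin d) (he : ∀ b, e b i ≠ 0) :
    ∃ u, δ (ξ 0 u) ∉ Submodule.span K (Set.range fun b => δ (ξ (e b) (w b))) := by
  by_contra! h
  have hlt : ∃ ε : ℚ, 0 < ε ∧ ∀ b, ε ≤ |e b i| := by
    have := Fintype.ofFinite β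
    rcases isEmpty_or_nonempty β with hβ | hβ
    · exact ⟨1, one_pos, fun b => (hβ.false b).elim⟩
    · obtain ⟨b, -, hb⟩ := Finset.exists_min_image Finset.univ (fun b => |e b i|)
        Finset.univ_nonempty
      exact ⟨_, abs_pos.2 (he b), fun b' => hb b' (Finset.mem_univ _)⟩
  obtain ⟨ε, hε, hle⟩ := hlt
  have hu := fun u => hξ.exists_poly hδ (fun o => o.elim 0 e) (fun o => o.elim u w) (h u)
  choose F hF using hu
  simp only [Option.elim] at hF
  have hF' : ∀ t ∈ Set.Ioo 0 ε, ∀ u, _ := fun t ht u =>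
    hF u (fun o => o.elim (Function.update 0 i t) e) (by
      have key : ∀ b j, ((0 : ℚ) < e b j ↔ Function.update (0 : Fin d → ℚ) i t j < e b j) ∧
          (e b j < 0 ↔ e b j < Function.update (0 : Fin d → ℚ) i t j) := by
        intro b j
        by_cases hj : j = i
        · subst hj
          have h1 := hle b
          have h2 := he b
          rw [Function.update_self]
          obtain ⟨h3, h4⟩ := ht
          rcases abs_cases (e b j) with h5 | h5 <;>
            exact ⟨⟨fun h => by linarith, fun h => by linarith⟩,
              ⟨fun h => by linarith, fun h => by linarith⟩⟩
        · simp [Function.update_of_ne hj]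
      rintro (_ | a) (_ | b) j
      · simp
      · exact (key b j).1
      · exact (key a j).2
      · exact Iff.rfl)
  let Ψ : MvPolynomial (Option β ⊕ Fin ℓ) ℚ →ₐ[ℚ] Polynomial K :=
    MvPolynomial.aeval (unknownPt (fun b => Polynomial.C (ξ (e b) (w b))) Polynomial.X
      fun j => Polynomial.C (c j))
  have hev : ∀ z G, (Ψ G).eval z =
      MvPolynomial.aeval (unknownPt (fun b => ξ (e b) (w b)) z c) G := by
    intro z G
    have : ((Polynomial.aeval z).restrictScalars ℚ).comp Ψ =
        MvPolynomial.aeval (unknownPt (fun b => ξ (e b) (w b)) z c) := by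
      refine MvPolynomial.algHom_ext fun s => ?_
      rcases s with (_ | _) | _ <;> simp [Ψ, unknownPt]
    rw [← this]
    simp
  have hder : ∀ G, (Ψ G).derivative = Ψ (MvPolynomial.pderiv (.inl none) G) := by
    have := Fintype.ofFinite β
    intro G
    have h1 := ((Polynomial.derivative' (R := K)).restrictScalars ℚ).apply_aeval_unknownPt
      (c := fun j => Polynomial.C (c j)) (fun j => Polynomial.derivative_C)
      (fun b => Polynomial.C (ξ (e b) (w b))) Polynomial.X G
    simpa [Polynomial.derivative'] using h1
  have hne : ∀ u, Ψ (F u) ≠ 0 := fun u h0 => by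
    refine (hF' (ε / 2) ⟨half_pos hε, half_lt_self hε⟩ u).2 ?_
    refine (hev _ _).symm.trans ?_
    rw [← hder, h0, Polynomial.derivative_zero, Polynomial.eval_zero]
  have hfin : (Set.univ.pi fun u => {z | (Ψ (F u)).IsRoot z}).Finite :=
    Set.Finite.pi fun u => Polynomial.finite_setOfPred_isRoot (hne u)
  refine (Set.Ioo_infinite hε).mono (s := Set.Ioo 0 ε) subset_rfl
    (Set.Finite.of_finite_image (f := fun t => ξ (Function.update 0 i t)) (hfin.subset ?_) ?_)
  · rintro _ ⟨t, ht, rfl⟩ u -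
    exact (hev _ _).trans (hF' t ht u).1
  · intro t _ t' _ h
    simpa using congrFun (hξ.inj h) i

end Uniform

/-! ### Independent families of entries -/

section Place

variable {k n d : ℕ}

/-- Replace the zero coordinates of the index of `g` by those of `t`. -/
def place (t : Fin d → ℚ) (g : (Fin d → ℚ) × Fin n) : (Fin d → ℚ) × Fin n :=
  (fun i => if g.1 i = 0 then t i else g.1 i, g.2)

/-- Translate the small coordinates by `s`. -/
def shiftSmall (ε : ℚ) (s e : Fin d → ℚ) : Fin d → ℚ :=
  fun i => if |e i| < ε then e i - s i else e i

/-- Replace small numbers by zero. -/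
def collapseSmall (ε v : ℚ) : ℚ := if |v| < ε then 0 else v

/-- Entries ordered by the number of vanishing coordinates of the index. -/
noncomputable def genKey (g : (Fin d → ℚ) × Fin n) : ℕ ×ₗ ℕ :=
  toLex ((Finset.univ.filter fun i => g.1 i = 0).card, Encodable.encode g)

theorem genKey_injective : Function.Injective (genKey (d := d) (n := n)) := fun _ _ h =>
  Encodable.encode_injective (congrArg (fun x => (ofLex x).2) h)

theorem genKey_lt_of_place_ne {ε : ℚ} {b b₀ : (Fin d → ℚ) × Fin n}
    (hb : ∀ i, b.1 i = 0 ∨ ε ≤ |b.1 i|) {t t₀ : Fin d → ℚ} (ht : ∀ i, 0 < t i ∧ t i < ε)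
    (hle : genKey b ≤ genKey b₀) (hne : place t b ≠ place t₀ b₀) :
    genKey (shiftSmall ε (fun i => if b₀.1 i = 0 then t₀ i else 0) (place t b).1, b.2) <
      genKey b₀ := by
  set s : Fin d → ℚ := fun i => if b₀.1 i = 0 then t₀ i else 0 with hs
  set g := shiftSmall ε s (place t b).1 with hg
  have h0 : ∀ i, b.1 i = 0 → g i = t i - s i := fun i hi => by
    have h1 : |t i| < ε := by rw [abs_of_pos (ht i).1]; exact (ht i).2
    simp [hg, shiftSmall, place, hi, h1]
  have h1 : ∀ i, b.1 i ≠ 0 → g i = b.1 i := fun i hi => by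
    have h2 := (hb i).resolve_left hi
    simp [hg, shiftSmall, place, hi, not_lt.2 h2]
  have hsub : (Finset.univ.filter fun i => g i = 0) ⊆ Finset.univ.filter fun i => b.1 i = 0 := by
    intro i hi
    simp only [Finset.mem_filter, Finset.mem_univ, true_and] at hi ⊢
    by_contra hne
    exact hne (h1 i hne ▸ hi)
  by_cases heq : (Finset.univ.filter fun i => g i = 0) = Finset.univ.filter fun i => b.1 i = 0
  · have hz : ∀ i, b.1 i = 0 → g i = 0 := fun i hi => by
      have : i ∈ Finset.univ.filter fun i => g i = 0 := by rw [heq]; simpa using hi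
      simpa using this
    have hgb : (g, b.2) = b := by
      refine Prod.ext (funext fun i => ?_) rfl
      by_cases hi : b.1 i = 0
      · exact (hz i hi).trans hi.symm
      · exact h1 i hi
    rw [hgb]
    refine lt_of_le_of_ne hle fun hkey => hne ?_
    obtain rfl := genKey_injective hkey
    refine Prod.ext (funext fun i => ?_) rfl
    by_cases hi : b.1 i = 0
    · have h2 := h0 i hi
      rw [hz i hi] at h2
      simp only [hs, hi, if_true] at h2
      simp only [place, hi, if_true]
      linarith
    · simp [place, hi]
  · have hcard := Finset.card_lt_card (Finset.ssubset_iff_subset_ne.2 ⟨hsub, heq⟩)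
    have hle' : (Finset.univ.filter fun i => b.1 i = 0).card ≤
        (Finset.univ.filter fun i => b₀.1 i = 0).card := by
      rcases Prod.Lex.le_iff.1 hle with h | h
      · exact h.le
      · exact h.1.le
    exact Prod.Lex.lt_iff.2 (.inl (hcard.trans_le hle'))

theorem shiftSmall_place_self {ε : ℚ} {b : (Fin d → ℚ) × Fin n}
    (hb : ∀ i, b.1 i = 0 ∨ ε ≤ |b.1 i|) {t : Fin d → ℚ} (ht : ∀ i, 0 < t i ∧ t i < ε) :
    shiftSmall ε (fun i => if b.1 i = 0 then t i else 0) (place t b).1 = b.1 := by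
  funext i
  by_cases hi : b.1 i = 0
  · have h1 : |t i| < ε := by rw [abs_of_pos (ht i).1]; exact (ht i).2
    simp [shiftSmall, place, hi, h1]
  · have h2 := (hb i).resolve_left hi
    simp [shiftSmall, place, hi, not_lt.2 h2]

theorem collapseSmall_place {ε : ℚ} {b : (Fin d → ℚ) × Fin n}
    (hb : ∀ i, b.1 i = 0 ∨ ε ≤ |b.1 i|) {t : Fin d → ℚ} (ht : ∀ i, 0 < t i ∧ t i < ε) :
    (fun i => collapseSmall ε ((place t b).1 i)) = b.1 := by
  funext i
  by_cases hi : b.1 i = 0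
  · have h1 : |t i| < ε := by rw [abs_of_pos (ht i).1]; exact (ht i).2
    simp [collapseSmall, place, hi, h1]
  · have h2 := (hb i).resolve_left hi
    simp [collapseSmall, place, hi, not_lt.2 h2]

theorem collapseSmall_mono {ε : ℚ} : Monotone (collapseSmall ε) := by
  intro v w h
  unfold collapseSmall
  grind [abs_lt]

theorem sameOrder_place {ε : ℚ} (hε : 0 < ε) {S : Finset ((Fin d → ℚ) × Fin n)}
    (hS : ∀ b ∈ S, ∀ i, b.1 i = 0 ∨ ε ≤ |b.1 i|) {t : Fin d → ℚ}
    (ht : ∀ i, 0 < t i ∧ t i < ε) :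
    SameOrder (fun o : Option S => o.elim 0 fun b => b.1.1)
      (fun o : Option S => o.elim t fun b => (place t b.1).1) := by
  have key : ∀ (o : Option S) (i : Fin d),
      ((o.elim 0 fun b => b.1.1) i = 0 ∧ (o.elim t fun b => (place t b.1).1) i = t i) ∨
      (ε ≤ |(o.elim 0 fun b => b.1.1) i| ∧
        (o.elim t fun b => (place t b.1).1) i = (o.elim 0 fun b => b.1.1) i) := by
    rintro (_ | b) i
    · exact .inl ⟨rfl, rfl⟩
    · rcases hS b.1 b.2 i with h | h
      · exact .inl ⟨h, if_pos h⟩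
      · refine .inr ⟨h, if_neg fun h0 => ?_⟩
        change ε ≤ |b.1.1 i| at h
        rw [show b.1.1 i = 0 from h0, abs_zero] at h
        exact h.not_gt hε
  intro o o' i
  have h1 := key o i
  have h2 := key o' i
  have h3 := ht i
  beta_reduce
  generalize (o.elim 0 fun b => b.1.1) i = v at *
  generalize (o'.elim 0 fun b => b.1.1) i = v' at *
  generalize (o.elim t fun b => (place t b.1).1) i = w at *
  generalize (o'.elim t fun b => (place t b.1).1) i = w' at *
  grind [le_abs]

end Place

section Independent

variable {K N : Type*} [Field K] [Algebra ℚ K] [AddCommGroup N] [Module K N] [Module ℚ N]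
  {α : Type v} {k n ℓ d : ℕ} {δ : Derivation ℚ K N} {c : Fin ℓ → K}
  {p : MvPolynomial ((Fin k × Fin n) ⊕ Fin ℓ) ℚ} {P : Finset (Fin d → α)}
  {ξ : (Fin d → ℚ) → Fin n → K}

theorem GenericArray.linearIndependent_place (hξ : GenericArray p P ξ c) (hδ : Detects δ c)
    {S : Finset ((Fin d → ℚ) × Fin n)}
    (hS : ∀ b ∈ S, δ (ξ b.1 b.2) ∉
      Submodule.span K ((fun g => δ (ξ g.1 g.2)) '' {g | genKey g < genKey b}))
    {ε : ℚ} (hSε : ∀ b ∈ S, ∀ i, b.1 i = 0 ∨ ε ≤ |b.1 i|)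
    {t : Fin k → Fin d → ℚ} (ht : ∀ l i, 0 < t l i ∧ t l i < ε / 2)
    {Θ : Type} [Finite Θ] {θ : Θ → (Fin d → ℚ) × Fin n} (hθ : Function.Injective θ)
    {b : Θ → (Fin d → ℚ) × Fin n} {l : Θ → Fin k} (hbS : ∀ j, b j ∈ S)
    (hb : ∀ j, place (t (l j)) (b j) = θ j) :
    LinearIndependent K fun j => δ (ξ (θ j).1 (θ j).2) := by
  classical
  have hε : ∀ l i, 0 < t l i ∧ t l i < ε := fun l i => ⟨(ht l i).1, by linarith [ht l i]⟩
  by_contra hLI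
  obtain ⟨s, g, hsum, j₁, hj₁, hgj₁⟩ := not_linearIndependent_iff.1 hLI
  obtain ⟨j₀, hj₀, hmax⟩ := Finset.exists_max_image (s.filter fun j => g j ≠ 0)
    (fun j => genKey (b j)) ⟨j₁, by simp [hj₁, hgj₁]⟩
  obtain ⟨hj₀s, hgj₀⟩ := Finset.mem_filter.1 hj₀
  let β : Type := {j // (j ∈ s.filter fun j => g j ≠ 0) ∧ j ≠ j₀}
  have hspan : δ (ξ (θ j₀).1 (θ j₀).2) ∈
      Submodule.span K (Set.range fun j : β => δ (ξ (θ j.1).1 (θ j.1).2)) := by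
    rw [← Finset.add_sum_erase _ _ hj₀s, add_eq_zero_iff_eq_neg] at hsum
    rw [← Submodule.smul_mem_iff _ hgj₀, hsum]
    refine Submodule.neg_mem _ (Submodule.sum_mem _ fun j hj => ?_)
    obtain ⟨hne, hjs⟩ := Finset.mem_erase.1 hj
    by_cases hgj : g j = 0
    · rw [hgj, zero_smul]
      exact Submodule.zero_mem _
    · exact Submodule.smul_mem _ _ (Submodule.subset_span
        ⟨⟨j, Finset.mem_filter.2 ⟨hjs, hgj⟩, hne⟩, rfl⟩)
  let sh : Fin d → ℚ := fun i => if (b j₀).1 i = 0 then t (l j₀) i else 0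
  let e : Option β → Fin d → ℚ := fun o => o.elim (θ j₀).1 fun j => (θ j.1).1
  let w : Option β → Fin n := fun o => o.elim (θ j₀).2 fun j => (θ j.1).2
  have hval : ∀ o i, (0 < e o i ∧ e o i < ε / 2) ∨ ε ≤ |e o i| := by
    have h1 : ∀ j i, (0 < (θ j).1 i ∧ (θ j).1 i < ε / 2) ∨ ε ≤ |(θ j).1 i| := by
      intro j i
      rw [← hb]
      by_cases hi : (b j).1 i = 0
      · left
        simpa [place, hi] using ht (l j) i
      · right
        simpa [place, hi] using (hSε _ (hbS j) i).resolve_left hi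
    rintro (_ | j) i
    · exact h1 _ _
    · exact h1 _ _
  have hsh : ∀ i, 0 ≤ sh i ∧ (sh i < ε / 2 ∨ sh i = 0) := fun i => by
    simp only [sh]
    split_ifs
    · exact ⟨(ht _ i).1.le, .inl (ht _ i).2⟩
    · exact ⟨le_rfl, .inr rfl⟩
  have horder : SameOrder e fun o => shiftSmall ε sh (e o) := by
    intro o o' i
    have h1 := hval o i
    have h2 := hval o' i
    have h3 := hsh i
    simp only [shiftSmall]
    generalize e o i = v at *
    generalize e o' i = v' at *
    generalize sh i = r at *
    have h4 := abs_lt (a := v) (b := ε)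
    have h5 := abs_lt (a := v') (b := ε)
    grind [le_abs]
  have hmem := hξ.mem_span_of_sameOrder hδ (w := w) horder hspan
  have hnone : shiftSmall ε sh (e none) = (b j₀).1 := by
    simp only [e, Option.elim, ← hb]
    exact shiftSmall_place_self (hSε _ (hbS _)) (hε _)
  have hw : ∀ j, (θ j).2 = (b j).2 := fun j => by rw [← hb]; rfl
  simp only [hnone] at hmem
  refine hS _ (hbS j₀) (Submodule.span_mono ?_ (by simpa only [w, Option.elim, hw] using hmem))
  rintro _ ⟨⟨j, hj, hne⟩, rfl⟩
  refine ⟨(shiftSmall ε sh (θ j).1, (b j).2), ?_, rfl⟩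
  simp only [Set.mem_ofPred_eq]
  rw [← hb j]
  refine genKey_lt_of_place_ne (hSε _ (hbS j)) (hε _) (hmax j hj) fun h => hne (hθ ?_)
  rw [← hb, ← hb, h]

end Independent

/-! ### Patterns of generic arrays -/

section Pattern

theorem exists_pos_le_abs {ι κ : Type*} (S : Finset ι) [Finite κ] (f : ι → κ → ℚ) :
    ∃ ε : ℚ, 0 < ε ∧ ∀ b ∈ S, ∀ i, f b i = 0 ∨ ε ≤ |f b i| := by
  classical
  have := Fintype.ofFinite κ
  let V := ((S ×ˢ (Finset.univ : Finset κ)).image fun x => |f x.1 x.2|).filter fun v => v ≠ 0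
  rcases V.eq_empty_or_nonempty with hV | hV
  · refine ⟨1, one_pos, fun b hb i => .inl ?_⟩
    by_contra hne
    have : |f b i| ∈ V := Finset.mem_filter.2
      ⟨Finset.mem_image.2 ⟨(b, i), by simp [hb], rfl⟩, abs_ne_zero.2 hne⟩
    simp [hV] at this
  · refine ⟨V.min' hV, ?_, fun b hb i => or_iff_not_imp_left.2 fun hne => V.min'_le _ ?_⟩
    · obtain ⟨h1, h2⟩ := Finset.mem_filter.1 (V.min'_mem hV)
      obtain ⟨x, -, hx⟩ := Finset.mem_image.1 h1
      exact lt_of_le_of_ne (hx ▸ abs_nonneg _) h2.symm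
    · exact Finset.mem_filter.2
        ⟨Finset.mem_image.2 ⟨(b, i), by simp [hb], rfl⟩, abs_ne_zero.2 hne⟩

/-- Small rational positions realizing the coordinatewise equalities of `x`. -/
theorem exists_small_positions {α : Type*} {k d : ℕ} (x : Fin k → Fin d → α) {ε : ℚ}
    (hε : 0 < ε) :
    ∃ t : Fin k → Fin d → ℚ, (∀ l i, 0 < t l i ∧ t l i < ε) ∧
      ∀ l l' i, t l i = t l' i ↔ x l i = x l' i := by
  classical
  have hne : ∀ l i, (Finset.univ.filter fun l' => x l' i = x l i).Nonempty := fun l i =>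
    ⟨l, by simp⟩
  let m : Fin k → Fin d → Fin k := fun l i =>
    (Finset.univ.filter fun l' => x l' i = x l i).min' (hne l i)
  have hm : ∀ l i, x (m l i) i = x l i := fun l i => by
    simpa using (Finset.univ.filter fun l' => x l' i = x l i).min'_mem (hne l i)
  refine ⟨fun l i => ε / (m l i + 2 : ℚ), fun l i => ?_, fun l l' i => ⟨fun h => ?_, fun h => ?_⟩⟩
  · have h1 : (0 : ℚ) ≤ (m l i : ℕ) := Nat.cast_nonneg _
    exact ⟨by positivity, div_lt_self hε (by linarith)⟩
  · rw [div_eq_div_iff (by positivity) (by positivity), mul_right_inj' hε.ne', add_left_inj,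
      Nat.cast_inj] at h
    rw [← hm l, ← hm l', Fin.ext h.symm]
  · simp only [m, h]

variable {K : Type u} [Field K] [Algebra ℚ K] {α : Type v} {k n ℓ d : ℕ} {c : Fin ℓ → K}
  {p : MvPolynomial ((Fin k × Fin n) ⊕ Fin ℓ) ℚ} {P : Finset (Fin d → α)}
  {ξ : (Fin d → ℚ) → Fin n → K}

theorem exists_enumeration {β : Type*} {P : Finset β} {k : ℕ} (hP : P.card = k) :
    ∃ x : Fin k → β, Function.Injective x ∧ ∀ y, y ∈ P ↔ ∃ l, x l = y := by
  subst hP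
  refine ⟨fun l => (P.equivFin.symm l).1, Subtype.val_injective.comp P.equivFin.symm.injective,
    fun y => ⟨fun hy => ⟨P.equivFin ⟨y, hy⟩, by simp⟩, ?_⟩⟩
  rintro ⟨l, rfl⟩
  exact (P.equivFin.symm l).2

/-- A generic array yields a pattern, whose relations survive the collapse to the origin. -/
theorem GenericArray.exists_pattern (hξ : GenericArray p P ξ c) (hP : P.card = k) :
    ∃ (S : Finset ((Fin d → ℚ) × Fin n)) (Θ : Type) (_ : Fintype Θ) (_ : DecidableEq Θ)
      (x : Fin k → Fin d → α) (F : Fin n → MvPolynomial (Option S ⊕ Fin ℓ) ℚ) (τ : Fin d → S)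
      (ω : Fin d → Fin n) (q : S → Fin k → Θ) (b : Θ → S)
      (J : Ideal (MvPolynomial ((Θ ⊕ Fin k × Fin n) ⊕ Fin ℓ) ℚ)),
      (∀ y, y ∈ P ↔ ∃ l, x l = y) ∧ (∀ a l, b (q a l) = a) ∧
      (∀ a l l', q a l = q a l' → ∀ i, τ i = a → x l i = x l' i) ∧
      (∀ θ, ∀ G ∈ J, prolong F q θ G ∈ J) ∧
      MvPolynomial.rename (Sum.map Sum.inr id) p ∈ J ∧
      (∀ u, MvPolynomial.aeval (unknownPt (fun b : S => ξ b.1.1 b.1.2) (ξ 0 u) c) (F u) = 0) ∧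
      (∀ u, MvPolynomial.aeval (unknownPt (fun b : S => ξ b.1.1 b.1.2) (ξ 0 u) c)
        (MvPolynomial.pderiv (.inl none) (F u)) ≠ 0) ∧
      (∀ i, MvPolynomial.aeval (unknownPt (fun b : S => ξ b.1.1 b.1.2) (ξ 0 (ω i)) c)
        (MvPolynomial.pderiv (.inl (some (τ i))) (F (ω i))) ≠ 0) ∧
      ∀ G ∈ J, MvPolynomial.aeval (blockPt (fun θ => ξ (b θ).1.1 (b θ).1.2)
        (fun v : Fin k × Fin n => ξ 0 v.2) c) G = 0 := by
  classical
  obtain ⟨N, _, _, _, δ, hδ⟩ := exists_detects c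
  let f : (Fin d → ℚ) × Fin n → N := fun g => δ (ξ g.1 g.2)
  obtain ⟨S, hSB, hS⟩ := exists_finset_mem_span_image
    (fun u : Fin n => mem_span_image_of_wellFounded (K := K) genKey f ((0 : Fin d → ℚ), u))
  obtain ⟨ε, hε, hSε⟩ := exists_pos_le_abs S fun b i => b.1 i
  obtain ⟨x, t, hxP, ht, htx, hp⟩ : ∃ (x : Fin k → Fin d → α) (t : Fin k → Fin d → ℚ),
      (∀ y, y ∈ P ↔ ∃ l, x l = y) ∧ (∀ l i, 0 < t l i ∧ t l i < ε / 2) ∧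
      (∀ l l' i, t l i = t l' i ↔ x l i = x l' i) ∧
      MvPolynomial.aeval (Sum.elim (fun v : Fin k × Fin n => ξ (t v.1) v.2) c) p = 0 := by
    obtain ⟨x, hx, hxP⟩ := exists_enumeration hP
    obtain ⟨t, ht, htx⟩ := exists_small_positions x (half_pos hε)
    obtain ⟨ρ, hρ⟩ := hξ.edge x t hx hxP htx
    exact ⟨x ∘ ρ, t ∘ ρ, fun y => (hxP y).trans (by rw [ρ.surjective.exists]; rfl),
      fun l i => ht _ i, fun l l' i => htx _ _ i, hρ⟩
  have hε' : ∀ l i, 0 < t l i ∧ t l i < ε := fun l i => ⟨(ht l i).1, by linarith [ht l i]⟩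
  obtain ⟨Θ, _, _, θ, q, r, hθ, hq, hr⟩ : ∃ (Θ : Type) (_ : Fintype Θ) (_ : DecidableEq Θ)
      (θ : Θ → (Fin d → ℚ) × Fin n) (q : S → Fin k → Θ) (r : Θ → S × Fin k),
      Function.Injective θ ∧ (∀ b l, θ (q b l) = place (t l) b.1) ∧
      ∀ j, place (t (r j).2) (r j).1.1 = θ j := by
    have hΘ : ∀ j : (Finset.univ : Finset (S × Fin k)).image fun a => place (t a.2) a.1.1,
        ∃ a : S × Fin k, place (t a.2) a.1.1 = j.1 := fun j => by
      obtain ⟨a, -, ha⟩ := Finset.mem_image.1 j.2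
      exact ⟨a, ha⟩
    choose r hr using hΘ
    exact ⟨_, inferInstance, inferInstance, Subtype.val, fun b l =>
      ⟨place (t l) b.1, Finset.mem_image.2 ⟨(b, l), Finset.mem_univ _, rfl⟩⟩, r,
      Subtype.val_injective, fun _ _ => rfl, hr⟩
  have hcol : ∀ j, (fun i => collapseSmall ε ((θ j).1 i)) = (r j).1.1.1 := fun j => by
    rw [← hr]
    exact collapseSmall_place (hSε _ (r j).1.2) (hε' _)
  have hqr : ∀ b l, (r (q b l)).1 = b := fun b l => by
    have h2 := congrArg Prod.snd ((hr (q b l)).trans (hq b l))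
    refine Subtype.ext (Prod.ext ?_ h2)
    rw [← hcol, hq]
    exact collapseSmall_place (hSε _ b.2) (hε' _)
  choose F hF using fun u => hξ.exists_poly hδ (fun o : Option S => o.elim 0 fun b => b.1.1)
    (fun o => o.elim u fun b => b.1.2) (hS u)
  have hF0 : ∀ u, MvPolynomial.aeval (unknownPt (fun b : S => ξ b.1.1 b.1.2) (ξ 0 u) c)
      (F u) = 0 ∧ MvPolynomial.aeval (unknownPt (fun b : S => ξ b.1.1 b.1.2) (ξ 0 u) c)
        (MvPolynomial.pderiv (.inl none) (F u)) ≠ 0 := fun u =>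
    hF u (fun o : Option S => o.elim 0 fun b => b.1.1) fun _ _ _ => Iff.rfl
  have hFt : ∀ l u, MvPolynomial.aeval (unknownPt
      (fun b : S => ξ (place (t l) b.1).1 b.1.2) (ξ (t l) u) c) (F u) = 0 := fun l u =>
    (hF u (fun o : Option S => o.elim (t l) fun b => (place (t l) b.1).1)
      (sameOrder_place hε hSε (hε' l))).1
  have hτ : ∀ i, ∃ b : S, b.1.1 i = 0 ∧ ∃ u,
      MvPolynomial.aeval (unknownPt (fun b : S => ξ b.1.1 b.1.2) (ξ 0 u) c)
        (MvPolynomial.pderiv (.inl (some b)) (F u)) ≠ 0 := by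
    intro i
    by_contra! h
    obtain ⟨u, hu⟩ := hξ.exists_notMem_span hδ (fun b : {b : S // b.1.1 i ≠ 0} => b.1.1.1)
      (fun b => b.1.1.2) i fun b => b.2
    exact hu (Derivation.mem_span_of_aeval_eq_zero hδ.zero (hF0 u).1 (hF0 u).2 fun b hb =>
      h b (not_not.1 hb) u)
  choose τ hτ ω hω using hτ
  have hLI : LinearIndependent K fun j => δ (ξ (θ j).1 (θ j).2) :=
    hξ.linearIndependent_place hδ (fun b hb => hSB hb) hSε ht hθ (fun j => (r j).1.2) hr
  refine ⟨S, Θ, inferInstance, inferInstance, x, F, τ, ω, q, fun j => (r j).1,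
    RingHom.ker (MvPolynomial.aeval (R := ℚ) (blockPt (fun j => ξ (θ j).1 (θ j).2)
      (fun v : Fin k × Fin n => ξ (t v.1) v.2) c)), hxP, hqr, ?_, ?_, ?_,
    fun u => (hF0 u).1, fun u => (hF0 u).2, hω, ?_⟩
  · rintro a l l' h i rfl
    refine (htx _ _ i).1 ?_
    have h1 := congrFun (congrArg (fun j => (θ j).1) h) i
    simpa [hq, place, hτ i] using h1
  · intro j G hG
    refine aeval_prolong_eq_zero hδ.zero hLI (fun v => ?_) j hG
    have h1 := hFt v.1 v.2
    simpa only [hq, place] using h1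
  · rw [RingHom.mem_ker, MvPolynomial.aeval_rename]
    have h1 : blockPt (fun j => ξ (θ j).1 (θ j).2) (fun v : Fin k × Fin n => ξ (t v.1) v.2) c ∘
        Sum.map Sum.inr id = Sum.elim (fun v : Fin k × Fin n => ξ (t v.1) v.2) c := by
      funext s
      rcases s with _ | _ <;> rfl
    rw [h1, hp]
  · intro G hG
    let e : Θ ⊕ Fin k × Fin n → Fin d → ℚ := Sum.elim (fun j => (θ j).1) fun v => t v.1
    let w : Θ ⊕ Fin k × Fin n → Fin n := Sum.elim (fun j => (θ j).2) fun v => v.2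
    have hpt : blockPt (fun j => ξ (θ j).1 (θ j).2) (fun v : Fin k × Fin n => ξ (t v.1) v.2) c =
        Sum.elim (fun a => ξ (e a) (w a)) c := by
      funext s
      rcases s with (_ | _) | _ <;> rfl
    have hpt' : blockPt (fun j => ξ (r j).1.1.1 (r j).1.1.2)
        (fun v : Fin k × Fin n => ξ 0 v.2) c =
        Sum.elim (fun a => ξ (fun i => collapseSmall ε (e a i)) (w a)) c := by
      funext s
      rcases s with (j | v) | _
      · simp only [blockPt, Sum.elim_inl, e, hcol]
        have h2 : (r j).1.1.2 = (θ j).2 := by rw [← hr j]; rfl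
        rw [h2]
        rfl
      · have : (fun i => collapseSmall ε (t v.1 i)) = 0 := funext fun i => if_pos (by
          rw [abs_of_pos (ht _ i).1]; exact (hε' _ i).2)
        simp [blockPt, e, w, this]
      · rfl
    rw [hpt']
    rw [RingHom.mem_ker, hpt] at hG
    exact hξ.specialize w (fun _ _ _ h => collapseSmall_mono h) hG

end Pattern

/-! ### The compactness argument -/

section Compactness

variable {I : Type*} {V : Ultrafilter I} {β Θ : Type} {k n ℓ : ℕ}

theorem aeval_unknownPt_germ_eq_zero (y : β → I → ℝ) (z : I → ℝ) (c : Fin ℓ → I → ℝ)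
    (F : MvPolynomial (Option β ⊕ Fin ℓ) ℚ) :
    MvPolynomial.aeval (unknownPt (K := (V : Filter I).Germ ℝ) (fun b => (y b : I → ℝ)) z
      fun j => (c j : I → ℝ)) F = 0 ↔
    ∀ᶠ r in (V : Filter I),
      MvPolynomial.aeval (unknownPt (fun b => y b r) (z r) fun j => c j r) F = 0 := by
  have h1 : (unknownPt (K := (V : Filter I).Germ ℝ) (fun b => (y b : I → ℝ)) z
      fun j => (c j : I → ℝ)) = fun s => ((unknownPt y z c s : I → ℝ) : (V : Filter I).Germ ℝ) := by
    funext s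
    rcases s with (_ | _) | _ <;> rfl
  have h2 : ∀ r, (unknownPt (fun b => y b r) (z r) fun j => c j r) =
      fun s => unknownPt y z c s r := by
    intro r
    funext s
    rcases s with (_ | _) | _ <;> rfl
  simp only [h1, h2]
  exact aeval_germ_eq_zero _ _

theorem aeval_blockPt_germ_eq_zero (Y : Θ → I → ℝ) (X : Fin k × Fin n → I → ℝ)
    (c : Fin ℓ → I → ℝ) (G : MvPolynomial ((Θ ⊕ Fin k × Fin n) ⊕ Fin ℓ) ℚ) :
    MvPolynomial.aeval (blockPt (K := (V : Filter I).Germ ℝ) (fun j => (Y j : I → ℝ))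
      (fun v => (X v : I → ℝ)) fun j => (c j : I → ℝ)) G = 0 ↔
    ∀ᶠ r in (V : Filter I),
      MvPolynomial.aeval (blockPt (fun j => Y j r) (fun v => X v r) fun j => c j r) G = 0 := by
  have h1 : (blockPt (K := (V : Filter I).Germ ℝ) (fun j => (Y j : I → ℝ))
      (fun v => (X v : I → ℝ)) fun j => (c j : I → ℝ)) =
      fun s => ((blockPt Y X c s : I → ℝ) : (V : Filter I).Germ ℝ) := by
    funext s
    rcases s with (_ | _) | _ <;> rfl
  have h2 : ∀ r, (blockPt (fun j => Y j r) (fun v => X v r) fun j => c j r) =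
      fun s => blockPt Y X c s r := by
    intro r
    funext s
    rcases s with (_ | _) | _ <;> rfl
  simp only [h1, h2]
  exact aeval_germ_eq_zero _ _

/-- Some definable set of parameters with uniformly definable immersions contains all parameters
for which large grids embed. -/
theorem exists_soundSet {α : Type v} (k n ℓ d : ℕ)
    (p : MvPolynomial ((Fin k × Fin n) ⊕ Fin ℓ) ℚ) (P : Finset (Fin d → α)) (hP : P.card = k) :
    ∃ (M : ℕ) (γ : SoundSet k n ℓ d p P), ∀ c,
      Embeddable (LEdges k P (Fin M)) (zeroEdgesParam k n ℓ p c) → γ.1 c := by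
  by_contra! h
  choose C hC hCγ using h
  let T := ℕ × SoundSet k n ℓ d p P
  have hT : (Filter.atTop : Filter T).NeBot := by
    rw [← Filter.prod_atTop_atTop_eq]
    infer_instance
  let U : Ultrafilter T := Ultrafilter.of Filter.atTop
  have hU : ∀ Q : T → Prop, (∀ᶠ t in Filter.atTop, Q t) → ∀ᶠ t in U, Q t := fun Q hQ =>
    Ultrafilter.of_le _ hQ
  let c : T → Fin ℓ → ℝ := fun t => C t.1 t.2
  choose g hg using fun t : T => hC t.1 t.2
  have hM : ∀ a, ∀ᶠ t : T in U, a < t.1 := fun a => hU _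
    ((Filter.eventually_ge_atTop ((a + 1, Classical.arbitrary _) : T)).mono fun t ht => ht.1)
  have hξ := genericArray_arrayRep (U := U) hM (c := c) hg
  obtain ⟨S, Θ, _, _, x, F, τ, ω, q, b, J, hx, hb, hq, hJ, hp, h0, h1, h2, h3⟩ :=
    hξ.exists_pattern hP
  obtain ⟨Gs, hGs, γ, hγ⟩ := exists_soundSet_of_pattern hx hb hq J hJ hp
  have e0 := Filter.eventually_all.2 fun u => (aeval_unknownPt_germ_eq_zero
    (fun b : S => arrayRep g b.1.1 b.1.2) (arrayRep g 0 u) (fun j r => c r.1 j) _).1 (h0 u)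
  have e1 := Filter.eventually_all.2 fun u => Ultrafilter.eventually_not.2
    ((aeval_unknownPt_germ_eq_zero (fun b : S => arrayRep g b.1.1 b.1.2) (arrayRep g 0 u)
      (fun j r => c r.1 j) _).not.1 (h1 u))
  have e2 := Filter.eventually_all.2 fun i => Ultrafilter.eventually_not.2
    ((aeval_unknownPt_germ_eq_zero (fun b : S => arrayRep g b.1.1 b.1.2) (arrayRep g 0 (ω i))
      (fun j r => c r.1 j) _).not.1 (h2 i))
  have e3 := (Filter.eventually_all_finset Gs).2 fun G hG => (aeval_blockPt_germ_eq_zero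
    (fun j => arrayRep g (b j).1.1 (b j).1.2) (fun v : Fin k × Fin n => arrayRep g 0 v.2)
    (fun j r => c r.1 j) _).1 (h3 G (hGs G hG))
  have e4 := eventually_genV_of (σ := Fin d ×ₗ ℚ) (hU _
    ((Filter.eventually_ge_atTop ((0, γ) : T)).mono fun t ht => ht.2))
  obtain ⟨r, hr0, hr1, hr2, hr3, hr4⟩ := (e0.and (e1.and (e2.and (e3.and e4)))).exists
  exact hCγ r.1.1 r.1.2 (hr4 _ (hγ _ _ _ hr0 hr1 hr2 hr3))

end Compactness

/-- Theorem 3.1: for a `((k,n)+ℓ)`-ary polynomial `p` over `ℚ` and a `d`-dimensional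
`k`-template `P`, there are `M < ω` and formulas `φ_π` (one for each surjection
`π : d → m`, `m ≤ d`) such that whenever `c ∈ ℝ^ℓ` and `L(M^d,P)` is embeddable into
the zero hypergraph `H_c`, some `φ_π(z,x,c)` defines (the graph of) an immersion of
`L(ℝ^m,P^π)` into `H_c`. -/
theorem uniform_immersion_formulas {α : Type v} (k n ℓ d : ℕ)
    (p : MvPolynomial ((Fin k × Fin n) ⊕ Fin ℓ) ℚ)
    (P : Finset (Fin d → α)) (hP : P.card = k) :
    ∃ M : ℕ, ∃ Φ : (m : ℕ) → (Fin d → Fin m) → OFFml,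
      (∀ (m : ℕ) (π : Fin d → Fin m), ∀ i ∈ (Φ m π).fv, i < m + n + ℓ) ∧
      ∀ c : Fin ℓ → ℝ,
        Embeddable (LEdges k P (Fin M)) (zeroEdgesParam k n ℓ p c) →
        ∃ (m : ℕ) (π : Fin d → Fin m), m ≤ d ∧ Function.Surjective π ∧
          ∃ f : (Fin m → ℝ) → (Fin n → ℝ),
            (∀ (z : Fin m → ℝ) (x : Fin n → ℝ),
              ((Φ m π).Realize (valu m n ℓ z x c) ↔ f z = x)) ∧
            IsImmersion k (collapseT π P) (zeroEdgesParam k n ℓ p c) f := by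
  obtain ⟨M, γ, hγ⟩ := exists_soundSet k n ℓ d p P hP
  exact ⟨M, exists_formulas_of_soundSet γ hγ⟩
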